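/- Suppose 0 < 1/n ≪ δ ≪ 1 and 0 ≤ γ < δ. Let 𝒞 be a set of n colors and 𝒟 = {D_i : i ∈ 𝒞} a collection of digraphs on a common vertex set V of size n with δ⁰(𝒟) ≥ ⌈n/2⌉. Assume: (i) C¹ ∪ C² ∪ C³ ∪ C⁴ is a partition of V with |C²| ≥ 50δ^{1/4}·n, min{|C³|+|C⁴|, |C¹|+|C⁴|} ≥ ⌈n/2⌉, and |C⁴| = ⌊(|C²|+|C⁴|+1)/2⌋ + γn; (ii) 𝒞' ∪ 𝒞'' is a partition of 𝒞 with |𝒞''| ≤ δn; (iii) for all i ∈ 𝒞', the induced sub-digraphs D_i[C²], D_i[C², C¹], and D_i[C³, C²] have no edges. Then 𝒟 contains a transversal directed Hamilton cycle. -/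

import Mathlib

open Finset

/-- Out-degree of a vertex in a digraph given as a relation on `Fin n`. -/
noncomputable def outDeg {n : ℕ} (D : Fin n → Fin n → Prop) (v : Fin n) : ℕ :=
  Nat.card {w : Fin n // D v w}

/-- In-degree of a vertex in a digraph given as a relation on `Fin n`. -/
noncomputable def inDeg {n : ℕ} (D : Fin n → Fin n → Prop) (v : Fin n) : ℕ :=
  Nat.card {w : Fin n // D w v}

section Concentration

variable {α : Type*} [Fintype α] [DecidableEq α]

/-- Deviation of the permutation statistic `∑ a, M a (σ a)` from its mean. -/
noncomputable def permDev (M : α → α → ℝ) (σ : Equiv.Perm α) : ℝ :=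
  ∑ a, M a (σ a) - (∑ a, ∑ b, M a b) / Fintype.card α

lemma permDev_sub_mul_swap (M : α → α → ℝ) (σ : Equiv.Perm α) (a b : α) :
    permDev M σ - permDev M (σ * Equiv.swap a b) =
      M a (σ a) + M b (σ b) - M a (σ b) - M b (σ a) := by
  unfold permDev
  rw [sub_sub_sub_cancel_right, ← Finset.sum_sub_distrib]
  rcases eq_or_ne a b with rfl | hab
  · simp
  · rw [Finset.sum_eq_add a b hab]
    · simp
      ring
    · rintro c - ⟨h1, h2⟩
      simp [Equiv.swap_apply_of_ne_of_ne h1 h2]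
    · simp
    · simp

lemma sum_permDev_sub_mul_swap [Nonempty α] (M : α → α → ℝ) (σ : Equiv.Perm α) :
    ∑ a, ∑ b, (permDev M σ - permDev M (σ * Equiv.swap a b)) =
      2 * Fintype.card α * permDev M σ := by
  have hm : (Fintype.card α : ℝ) ≠ 0 := by
    exact_mod_cast Fintype.card_ne_zero
  simp only [permDev_sub_mul_swap, Finset.sum_sub_distrib, Finset.sum_add_distrib,
    Finset.sum_const, Finset.card_univ, nsmul_eq_mul]
  have h1 : ∑ x, ∑ y, M x (σ y) = ∑ x, ∑ y, M x y :=
    Finset.sum_congr rfl fun x _ => Equiv.sum_comp σ (M x)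
  have h2 : ∑ x, ∑ y, M y (σ x) = ∑ x, ∑ y, M x y := by
    rw [Finset.sum_comm]; exact h1
  rw [h1, h2, ← Finset.mul_sum]
  unfold permDev
  field_simp
  ring

lemma sum_permDev_mul [Nonempty α] (M : α → α → ℝ) (g : ℝ → ℝ) :
    4 * (Fintype.card α : ℝ) * ∑ σ : Equiv.Perm α, permDev M σ * g (permDev M σ) =
      ∑ a, ∑ b, ∑ σ : Equiv.Perm α, (permDev M σ - permDev M (σ * Equiv.swap a b)) *
        (g (permDev M σ) - g (permDev M (σ * Equiv.swap a b))) := by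
  have key : ∀ a b : α, ∑ σ : Equiv.Perm α, (permDev M σ - permDev M (σ * Equiv.swap a b)) *
      (g (permDev M σ) - g (permDev M (σ * Equiv.swap a b))) =
      2 * ∑ σ : Equiv.Perm α, (permDev M σ - permDev M (σ * Equiv.swap a b)) *
        g (permDev M σ) := by
    intro a b
    have h : ∑ σ : Equiv.Perm α, (permDev M σ - permDev M (σ * Equiv.swap a b)) *
        g (permDev M (σ * Equiv.swap a b)) =
        ∑ σ : Equiv.Perm α, (permDev M (σ * Equiv.swap a b) - permDev M σ) *
        g (permDev M σ) := by
      rw [← Equiv.sum_comp (Equiv.mulRight (Equiv.swap a b))]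
      simp [mul_assoc]
    simp only [mul_sub, Finset.sum_sub_distrib] at h ⊢
    simp only [sub_mul, Finset.sum_sub_distrib] at h ⊢
    linarith
  simp only [key, ← Finset.mul_sum]
  have : ∑ a, ∑ b, ∑ σ : Equiv.Perm α, (permDev M σ - permDev M (σ * Equiv.swap a b)) *
        g (permDev M σ) = ∑ σ : Equiv.Perm α, 2 * Fintype.card α * permDev M σ *
        g (permDev M σ) := by
    simp only [← sum_permDev_sub_mul_swap, Finset.sum_mul]
    rw [Finset.sum_comm_cycle]
  rw [this, Finset.mul_sum, Finset.mul_sum]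
  exact Finset.sum_congr rfl fun σ _ => by ring

variable {M : α → α → ℝ}

lemma sq_permDev_sub_le (h0 : ∀ a b, 0 ≤ M a b) (h1 : ∀ a b, M a b ≤ 1)
    (σ : Equiv.Perm α) (a b : α) :
    (permDev M σ - permDev M (σ * Equiv.swap a b)) ^ 2 ≤ 4 := by
  rw [permDev_sub_mul_swap]
  have := h0 a (σ a); have := h0 b (σ b); have := h0 a (σ b); have := h0 b (σ a)
  have := h1 a (σ a); have := h1 b (σ b); have := h1 a (σ b); have := h1 b (σ a)
  nlinarith

lemma sum_sq_permDev_le [Nonempty α] (h0 : ∀ a b, 0 ≤ M a b) (h1 : ∀ a b, M a b ≤ 1) :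
    ∑ σ : Equiv.Perm α, permDev M σ ^ 2 ≤
      Fintype.card α * Fintype.card (Equiv.Perm α) := by
  have hm : (0 : ℝ) < Fintype.card α := by exact_mod_cast Fintype.card_pos
  have h := sum_permDev_mul M id
  have h2 : ∑ a : α, ∑ b : α, ∑ σ : Equiv.Perm α,
      (permDev M σ - permDev M (σ * Equiv.swap a b)) *
        (id (permDev M σ) - id (permDev M (σ * Equiv.swap a b))) ≤
      ∑ a : α, ∑ b : α, ∑ σ : Equiv.Perm α, (4 : ℝ) := by
    gcongr with a _ b _ σ _
    have := sq_permDev_sub_le h0 h1 σ a b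
    simp only [id]; nlinarith
  rw [← h] at h2
  simp only [Finset.sum_const, Finset.card_univ, nsmul_eq_mul, id] at h2
  simp only [← pow_two] at h2
  have : (Fintype.card α : ℝ) * ∑ σ : Equiv.Perm α, permDev M σ ^ 2 ≤
      Fintype.card α * (Fintype.card α * Fintype.card (Equiv.Perm α)) := by linarith
  exact le_of_mul_le_mul_left this hm

lemma sum_pow_four_permDev_le [Nonempty α] (h0 : ∀ a b, 0 ≤ M a b) (h1 : ∀ a b, M a b ≤ 1) :
    ∑ σ : Equiv.Perm α, permDev M σ ^ 4 ≤
      3 * (Fintype.card α : ℝ) ^ 2 * Fintype.card (Equiv.Perm α) := by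
  have hm : (0 : ℝ) < Fintype.card α := by exact_mod_cast Fintype.card_pos
  have h := sum_permDev_mul M (fun x => x ^ 3)
  have h2 : ∑ a : α, ∑ b : α, ∑ σ : Equiv.Perm α,
      (permDev M σ - permDev M (σ * Equiv.swap a b)) *
        ((fun x => x ^ 3) (permDev M σ) - (fun x => x ^ 3) (permDev M (σ * Equiv.swap a b))) ≤
      ∑ a : α, ∑ b : α, ∑ σ : Equiv.Perm α,
        6 * (permDev M σ ^ 2 + permDev M (σ * Equiv.swap a b) ^ 2) := by
    refine Finset.sum_le_sum fun a _ => Finset.sum_le_sum fun b _ => Finset.sum_le_sum fun σ _ => ?_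
    have := sq_permDev_sub_le h0 h1 σ a b
    generalize permDev M σ = x at *
    generalize permDev M (σ * Equiv.swap a b) = y at *
    have e : (x - y) * (x ^ 3 - y ^ 3) = (x - y) ^ 2 * (x ^ 2 + x * y + y ^ 2) := by ring
    have : (x - y) ^ 2 * (x ^ 2 + x * y + y ^ 2) ≤ 4 * (x ^ 2 + x * y + y ^ 2) :=
      mul_le_mul_of_nonneg_right this (by nlinarith [sq_nonneg (x + y)])
    nlinarith [sq_nonneg (x - y)]
  have h3 : ∀ a b : α, ∑ σ : Equiv.Perm α, permDev M (σ * Equiv.swap a b) ^ 2 =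
      ∑ σ : Equiv.Perm α, permDev M σ ^ 2 := fun a b =>
    Equiv.sum_comp (Equiv.mulRight (Equiv.swap a b)) fun σ => permDev M σ ^ 2
  rw [← h] at h2
  simp only [← Finset.mul_sum, Finset.sum_add_distrib, h3, Finset.sum_const, Finset.card_univ,
    nsmul_eq_mul] at h2
  have h4 := sum_sq_permDev_le h0 h1
  have e : ∀ σ : Equiv.Perm α, permDev M σ * permDev M σ ^ 3 = permDev M σ ^ 4 :=
    fun σ => by ring
  simp only [e] at h2
  have : (Fintype.card α : ℝ) * ∑ σ : Equiv.Perm α, permDev M σ ^ 4 ≤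
      Fintype.card α * (3 * (Fintype.card α : ℝ) ^ 2 * Fintype.card (Equiv.Perm α)) := by
    have := mul_le_mul_of_nonneg_left h4 (by positivity : 0 ≤ 3 * (Fintype.card α : ℝ) ^ 2)
    nlinarith
  exact le_of_mul_le_mul_left this hm

/-- Simultaneous concentration of few permutation statistics. -/
theorem exists_perm_abs_permDev_le {ι : Type*} [Fintype ι] (M : ι → α → α → ℝ)
    (h0 : ∀ i a b, 0 ≤ M i a b) (h1 : ∀ i a b, M i a b ≤ 1) {η : ℝ} (hη : 0 < η)
    (hcard : 3 * (Fintype.card ι : ℝ) < η ^ 4 * (Fintype.card α : ℝ) ^ 2) :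
    ∃ σ : Equiv.Perm α, ∀ i, |permDev (M i) σ| ≤ η * Fintype.card α := by
  by_contra! hcon
  have hne : Nonempty α := by
    by_contra hemp
    rw [not_nonempty_iff] at hemp
    have : (Fintype.card α : ℝ) = 0 := by simp
    rw [this] at hcard
    have : (0 : ℝ) ≤ Fintype.card ι := by positivity
    nlinarith
  have hm : (0 : ℝ) < Fintype.card α := by exact_mod_cast Fintype.card_pos
  have hp : (0 : ℝ) < Fintype.card (Equiv.Perm α) := by exact_mod_cast Fintype.card_pos
  have hlow : ∑ _σ : Equiv.Perm α, (η * Fintype.card α : ℝ) ^ 4 ≤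
      ∑ σ : Equiv.Perm α, ∑ i, permDev (M i) σ ^ 4 := by
    gcongr with σ _
    obtain ⟨i, hi⟩ := hcon σ
    calc (η * Fintype.card α : ℝ) ^ 4 ≤ |permDev (M i) σ| ^ 4 := by gcongr
      _ = permDev (M i) σ ^ 4 := by rw [← abs_pow, abs_of_nonneg (by positivity)]
      _ ≤ _ := Finset.single_le_sum (f := fun i => permDev (M i) σ ^ 4)
          (fun _ _ => by positivity) (mem_univ i)
  rw [Finset.sum_comm] at hlow
  have hup : ∑ i, ∑ σ : Equiv.Perm α, permDev (M i) σ ^ 4 ≤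
      ∑ _i : ι, 3 * (Fintype.card α : ℝ) ^ 2 * Fintype.card (Equiv.Perm α) := by
    gcongr with i _
    exact sum_pow_four_permDev_le (h0 i) (h1 i)
  simp only [Finset.sum_const, Finset.card_univ, nsmul_eq_mul] at hlow hup
  have h := hlow.trans hup
  have h' : η ^ 4 * (Fintype.card α : ℝ) ^ 2 * ((Fintype.card α : ℝ) ^ 2 *
      Fintype.card (Equiv.Perm α)) ≤ 3 * (Fintype.card ι : ℝ) * ((Fintype.card α : ℝ) ^ 2 *
      Fintype.card (Equiv.Perm α)) := by nlinarith
  exact absurd (le_of_mul_le_mul_right h' (by positivity)) (not_le.mpr hcard)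

end Concentration

section Contraction

set_option linter.unusedSectionVars false

open Equiv

variable {V C : Type*} [Fintype V] [DecidableEq V] [DecidableEq C]

lemma sameCycle_mul_swap_of_right {π : Perm V} {a b x : V} (hab : ¬ π.SameCycle a b)
    (hx : π.SameCycle b x) : (π * swap a b).SameCycle a x := by
  have hpos : ∀ i : ℕ, (π * swap a b).SameCycle a ((π ^ (i + 1)) b) := by
    intro i
    induction i with
    | zero =>
      have h : (π * swap a b) a = (π ^ (0 + 1)) b := by simp
      rw [← h]
      exact (Perm.sameCycle_apply_right).2 (Perm.SameCycle.refl _ _)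
    | succ i ih =>
      by_cases hb : (π ^ (i + 1)) b = b
      · have h : (π * swap a b) a = (π ^ (i + 1 + 1)) b := by
          rw [pow_succ' π (i + 1), Perm.mul_apply π (π ^ (i + 1)), hb]; simp
        rw [← h]
        exact (Perm.sameCycle_apply_right).2 (Perm.SameCycle.refl _ _)
      · have ha : (π ^ (i + 1)) b ≠ a := by
          rintro h
          exact hab (Perm.SameCycle.symm ⟨((i + 1 : ℕ) : ℤ), by rw [zpow_natCast]; exact h⟩)
        have h : (π * swap a b) ((π ^ (i + 1)) b) = (π ^ (i + 1 + 1)) b := by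
          rw [Perm.mul_apply, swap_apply_of_ne_of_ne ha hb, pow_succ' π (i + 1), Perm.mul_apply]
        rw [← h]
        exact (Perm.sameCycle_apply_right).2 ih
  obtain ⟨i, -, -, rfl⟩ := hx.exists_pow_eq''
  rcases i with _ | i
  · have h := hpos (orderOf π - 1)
    rw [Nat.sub_add_cancel (orderOf_pos π), pow_orderOf_eq_one] at h
    simpa using h
  · exact hpos i

lemma sameCycle_mul_swap {π : Perm V} {a b x : V} (hab : ¬ π.SameCycle a b)
    (hx : π.SameCycle a x ∨ π.SameCycle b x) : (π * swap a b).SameCycle a x := by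
  rcases hx with hx | hx
  · have h1 : (π * swap a b).SameCycle a b :=
      sameCycle_mul_swap_of_right hab (Perm.SameCycle.refl _ _)
    have h2 : (π * swap b a).SameCycle b x :=
      sameCycle_mul_swap_of_right (fun h => hab h.symm) hx
    rw [swap_comm] at h2
    exact h1.trans h2
  · exact sameCycle_mul_swap_of_right hab hx

/-- A rainbow Hamilton cycle in the digraph obtained by contracting paths: `I` is the set of
starting vertices of the paths, `e a` is the end of the path starting at `a`, and `K` is the
set of available colours. -/
def HamSys (D : C → V → V → Prop) (I : Finset V) (e : V → V) (K : Finset C) : Prop :=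
  ∃ π : Perm V, (∀ x ∉ I, π x = x) ∧ (∀ x ∈ I, ∀ y ∈ I, π.SameCycle x y) ∧
    ∃ φ : V → C, Set.InjOn φ I ∧ ∀ a ∈ I, φ a ∈ K ∧ D (φ a) (e a) (π a)

lemma HamSys.contract {D : C → V → V → Prop} {I : Finset V} {e : V → V} {K : Finset C}
    {a y : V} {i : C} (ha : a ∈ I) (hy : y ∈ I) (hay : a ≠ y) (hi : i ∈ K)
    (hD : D i (e a) y) (h : HamSys D (I.erase y) (Function.update e a (e y)) (K.erase i)) :
    HamSys D I e K := by
  obtain ⟨π, hfix, hcyc, φ, hinj, hφ⟩ := h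
  have hπy : π y = y := hfix y (by simp)
  have hns : ¬ π.SameCycle a y := by
    rintro h
    have := h.symm
    rw [Perm.SameCycle] at this
    obtain ⟨i, hi⟩ := this
    rw [Perm.zpow_apply_eq_self_of_apply_eq_self hπy] at hi
    exact hay hi.symm
  have haI : a ∈ I.erase y := mem_erase.2 ⟨hay, ha⟩
  have hall : ∀ x ∈ I, (π * swap a y).SameCycle a x := by
    intro x hx
    by_cases hxy : x = y
    · subst hxy
      exact sameCycle_mul_swap hns (Or.inr (Perm.SameCycle.refl _ _))
    · exact sameCycle_mul_swap hns (Or.inl (hcyc a haI x (mem_erase.2 ⟨hxy, hx⟩)))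
  refine ⟨π * swap a y, ?_, ?_, Function.update (Function.update φ y (φ a)) a i, ?_, ?_⟩
  · intro x hx
    have h1 : x ≠ a := by rintro rfl; exact hx ha
    have h2 : x ≠ y := by rintro rfl; exact hx hy
    rw [Perm.mul_apply, swap_apply_of_ne_of_ne h1 h2]
    exact hfix x fun h => hx (mem_of_mem_erase h)
  · intro x hx z hz
    exact (hall x hx).symm.trans (hall z hz)
  · have hne : ∀ z ∈ I.erase y, φ z ≠ i := fun z hz h => by
      have := (hφ z hz).1
      rw [h] at this
      simp at this
    intro x hx z hz hxz
    simp only [Function.update_apply] at hxz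
    have hin : ∀ w ∈ I, w ≠ y → w ∈ I.erase y := fun w hw h => mem_erase.2 ⟨h, hw⟩
    have hx' := hin x hx
    have hz' := hin z hz
    split_ifs at hxz with h1 h2 h3 h4 h5 h6 h7 h8
    · rw [h1, h2]
    · exact absurd hxz.symm (hne a haI)
    · exact absurd hxz.symm (hne z (hz' h3))
    · exact absurd hxz (hne a haI)
    · rw [h4, h6]
    · exact absurd (hinj (mem_coe.2 haI) (mem_coe.2 (hz' h6)) hxz).symm h5
    · exact absurd hxz (hne x (hx' h4))
    · exact absurd (hinj (mem_coe.2 (hx' h4)) (mem_coe.2 haI) hxz) h1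
    · exact hinj (mem_coe.2 (hx' h4)) (mem_coe.2 (hz' h8)) hxz
  · intro b hb
    by_cases hba : b = a
    · subst hba
      simp [hi, hπy, hD]
    · by_cases hby : b = y
      · subst hby
        have := hφ a haI
        simp only [Function.update_self, ne_eq, hba, not_false_eq_true,
          Function.update_of_ne] at this ⊢
        refine ⟨mem_of_mem_erase this.1, ?_⟩
        simpa using this.2
      · have := hφ b (mem_erase.2 ⟨hby, hb⟩)
        simp only [ne_eq, hba, hby, not_false_eq_true,
          Function.update_of_ne, Perm.mul_apply, swap_apply_of_ne_of_ne hba hby] at this ⊢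
        exact ⟨mem_of_mem_erase this.1, this.2⟩

/-- A state of the path-building process: `I` and `L` are the sets of first and last vertices
of the current paths, `K` the set of unused colours, and all vertices outside `U` are trivial
paths. -/
def PathState (D : C → V → V → Prop) [Fintype C] (I L : Finset V) (K : Finset C)
    (U : Finset V) : Prop :=
  ∃ e : V → V, Set.InjOn e I ∧ I.image e = L ∧ (∀ z ∉ U, z ∈ I ∧ e z = z) ∧ #K = #I ∧
    (HamSys D I e K → HamSys D univ id univ)

variable [Fintype C] {D : C → V → V → Prop} {I L U : Finset V} {K : Finset C}

lemma PathState.init (h : Fintype.card C = Fintype.card V) :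
    PathState D univ univ univ ∅ :=
  ⟨id, Function.injective_id.injOn, by simp, by simp, by simpa using h, fun h => h⟩

lemma PathState.mono (h : PathState D I L K U) {U' : Finset V} (hU : U ⊆ U') :
    PathState D I L K U' := by
  obtain ⟨e, h1, h2, h3, h4, h5⟩ := h
  exact ⟨e, h1, h2, fun z hz => h3 z fun h => hz (hU h), h4, h5⟩

lemma PathState.mem_left (h : PathState D I L K U) {z : V} (hz : z ∉ U) : z ∈ I := by
  obtain ⟨e, h1, h2, h3, h4, h5⟩ := h
  exact (h3 z hz).1

lemma PathState.mem_right (h : PathState D I L K U) {z : V} (hz : z ∉ U) : z ∈ L := by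
  obtain ⟨e, h1, h2, h3, h4, h5⟩ := h
  rw [← h2]
  exact mem_image.2 ⟨z, h3 z hz⟩

/-- Adding one edge to the current path system. -/
lemma PathState.step (h : PathState D I L K U) {x y : V} {i : C} (hx : x ∈ L) (hy : y ∈ I)
    (hxy : x ≠ y) (hfresh : x ∉ U ∨ y ∉ U) (hi : i ∈ K) (hD : D i x y) :
    PathState D (I.erase y) (L.erase x) (K.erase i) (U ∪ {x, y}) := by
  obtain ⟨e, h1, h2, h3, h4, h5⟩ := h
  rw [← h2] at hx
  obtain ⟨a, ha, rfl⟩ := mem_image.1 hx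
  have hea : e a ∉ U → e a = a := fun h => h1 (mem_coe.2 (h3 _ h).1) (mem_coe.2 ha) (h3 _ h).2
  have hay : a ≠ y := by
    rintro rfl
    rcases hfresh with h | h
    · exact hxy (hea h)
    · exact hxy (h3 _ h).2
  have hupd : ∀ b ∈ I.erase y, (b = a ∧ Function.update e a (e y) b = e y) ∨
      (b ≠ a ∧ Function.update e a (e y) b = e b) := by
    intro b hb
    by_cases hba : b = a
    · left; subst hba; simp
    · right; simp [hba]
  have himg : (I.erase y).image (Function.update e a (e y)) = L.erase (e a) := by
    ext w
    simp only [mem_image, mem_erase, ← h2]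
    constructor
    · rintro ⟨b, hb, rfl⟩
      rcases hupd b (mem_erase.2 hb) with ⟨h, h'⟩ | ⟨h, h'⟩
      · rw [h']
        exact ⟨fun h => hay (h1 (mem_coe.2 hy) (mem_coe.2 ha) h).symm, y, hy, rfl⟩
      · rw [h']
        exact ⟨fun h'' => h (h1 (mem_coe.2 hb.2) (mem_coe.2 ha) h''), b, hb.2, rfl⟩
    · rintro ⟨hw, b, hb, rfl⟩
      by_cases hby : b = y
      · subst hby
        exact ⟨a, ⟨hay, ha⟩, by simp⟩
      · have hba : b ≠ a := by rintro rfl; exact hw rfl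
        exact ⟨b, ⟨hby, hb⟩, by simp [hba]⟩
  have hcard : #((I.erase y).image (Function.update e a (e y))) = #(I.erase y) := by
    rw [himg, card_erase_of_mem (by rw [← h2]; exact mem_image_of_mem _ ha),
      card_erase_of_mem hy, ← h2, card_image_of_injOn h1]
  refine ⟨Function.update e a (e y), ?_, himg, ?_, ?_, ?_⟩
  · exact card_image_iff.1 hcard
  · intro z hz
    simp only [mem_union, mem_insert, mem_singleton, not_or] at hz
    have hzI := h3 z hz.1
    refine ⟨mem_erase.2 ⟨hz.2.2, hzI.1⟩, ?_⟩
    have hza : z ≠ a := by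
      rintro rfl
      exact hz.2.1 hzI.2.symm
    simp [hza, hzI.2]
  · rw [card_erase_of_mem hi, card_erase_of_mem hy, h4]
  · exact fun h => h5 (HamSys.contract ha hy hay hi hD h)

/-- A rainbow Hamilton cycle, written as an enumeration of the vertices and of the colours. -/
lemma HamSys.exists_equiv {n : ℕ} {D : Fin n → Fin n → Fin n → Prop}
    (h : HamSys D univ id univ) :
    ∃ σ φ : Fin n ≃ Fin n, ∀ k : Fin n, D (φ k) (σ k) (σ (finRotate n k)) := by
  obtain ⟨π, -, hcyc, φ, hinj, hφ⟩ := h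
  rcases n with _ | n
  · exact ⟨Equiv.refl _, Equiv.refl _, fun k => k.elim0⟩
  have hsurj : Function.Surjective fun k : Fin (n + 1) => (π ^ (k : ℕ)) 0 := by
    intro x
    have h0 := hcyc 0 (mem_univ _) x (mem_univ _)
    by_cases hs : (0 : Fin (n + 1)) ∈ π.support
    · obtain ⟨i, hi, hx⟩ := h0.exists_pow_eq_of_mem_support hs
      have hle : #(π.cycleOf 0).support ≤ n + 1 := by
        simpa using card_le_univ (π.cycleOf 0).support
      exact ⟨⟨i, hi.trans_le hle⟩, hx⟩
    · rw [Perm.notMem_support] at hs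
      obtain ⟨i, hi⟩ := h0
      rw [Perm.zpow_apply_eq_self_of_apply_eq_self hs] at hi
      exact ⟨0, by simpa using hi⟩
  have hbij := Finite.injective_iff_bijective.1 (Finite.injective_iff_surjective.2 hsurj)
  have hφb : Function.Bijective φ := by
    refine Finite.injective_iff_bijective.1 fun x y h => hinj (by simp) (by simp) h
  refine ⟨Equiv.ofBijective _ hbij, (Equiv.ofBijective _ hbij).trans (Equiv.ofBijective _ hφb), ?_⟩
  have hord : (π ^ (n + 1)) 0 = 0 := by
    obtain ⟨k, hk⟩ := hbij.2 ((π ^ (n + 1)) 0)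
    have hk' : (π ^ (k : ℕ)) 0 = (π ^ (n + 1)) 0 := hk
    obtain ⟨k, hkn⟩ := k
    rcases k with _ | k
    · simpa using hk'.symm
    · simp only [pow_succ' π, Perm.mul_apply, EmbeddingLike.apply_eq_iff_eq] at hk'
      have := hbij.1 (a₁ := ⟨k, by omega⟩) (a₂ := ⟨n, by omega⟩) hk'
      simp only [Fin.mk.injEq] at this
      omega
  intro k
  have h1 := (hφ ((π ^ (k : ℕ)) 0) (mem_univ _)).2
  have h2 : (π ^ ((finRotate (n + 1) k : Fin (n + 1)) : ℕ)) 0 = π ((π ^ (k : ℕ)) 0) := by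
    rw [coe_finRotate]
    split_ifs with hk
    · subst hk
      rw [← Perm.mul_apply, ← pow_succ']
      simpa using hord.symm
    · rw [← Perm.mul_apply, ← pow_succ']
  simp only [Equiv.ofBijective_apply, Equiv.trans_apply, id] at h1 ⊢
  rw [h2]
  exact h1

end Contraction

section Layering

variable {α : Type*} [Fintype α] [DecidableEq α]

/-- Layer transitions: from layer `0` to any later layer, from any layer to the last layer, and
otherwise from a layer to the next one. -/
def LayerStep (t i j : ℕ) : Prop :=
  (1 ≤ i ∧ j = i + 1 ∧ j ≤ t) ∨ (i = 0 ∧ 1 ≤ j) ∨ (i ≤ t ∧ j = t + 1)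

/-- The edges used to find a one-factor all of whose cycles meet `A`. -/
def Allowed (D : α → α → Prop) (A P P' : Finset α) (t : ℕ) (lam : α → ℕ) (x y : α) : Prop :=
  D x y ∧ ((x ∈ A ∧ y ∈ P') ∨ (x ∈ P ∧ y ∈ A) ∨
    (x ∉ A ∧ y ∉ A ∧ LayerStep t (lam x) (lam y)))

/-- The vertices of layer `j`. -/
def layer (A : Finset α) (lam : α → ℕ) (j : ℕ) : Finset α := {v | v ∉ A ∧ lam v = j}

@[simp] lemma mem_layer {A : Finset α} {lam : α → ℕ} {j : ℕ} {v : α} :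
    v ∈ layer A lam j ↔ v ∉ A ∧ lam v = j := by simp [layer]

open Classical in
/-- The conditions on a layering that concern out-neighbourhoods. -/
structure HalfLay (D : α → α → Prop) (A P P' : Finset α) (t : ℕ) (lam : α → ℕ)
    (w κ μ : ℝ) : Prop where
  out_A : ∀ x ∈ A, (#{y ∈ P' | ¬ D x y} : ℝ) ≤ μ * Fintype.card α
  out_P : ∀ x ∈ P, (#A : ℝ) / 4 ≤ #{y ∈ A | D x y}
  last_sub : ∀ v ∉ A, lam v = t + 1 → v ∈ P
  card_layer : ∀ j, 1 ≤ j → j ≤ t → (#(layer A lam j) : ℝ) ≤ w * (Fintype.card α - #A + κ)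
  card_P : ∀ j, 1 ≤ j → j ≤ t → w * (Fintype.card α / 2 - κ) ≤ #(P ∩ layer A lam j)
  card_last : (#(layer A lam (t + 1)) : ℝ) ≤ #A / 32
  out_C3 : ∀ x ∉ A, x ∉ P → ∀ j, 1 ≤ j → j ≤ t →
    w * (Fintype.card α / 2 - κ) ≤ #{y ∈ layer A lam j | D x y}
  out_W : ∀ x ∉ A, ∀ j, 1 ≤ j → j ≤ t →
    w * (Fintype.card α / 2 - #A - κ) ≤ #{y ∈ layer A lam j | D x y}
  out_last : ∀ x ∉ A, x ∉ P → 4 * (w * Fintype.card α) ≤ #{y ∈ layer A lam (t + 1) | D x y}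
  out_zero : ∀ x ∉ A, x ∉ P → lam x = 0 →
    (Fintype.card α / 2 - κ : ℝ) ≤ #{y | y ∉ A ∧ 1 ≤ lam y ∧ D x y}
  out_t : ∀ x ∉ A, x ∉ P → lam x = t →
    6 * (w * Fintype.card α) ≤ #{y ∈ P' ∩ layer A lam (t + 1) | D x y} ∨
    ∃ G ⊆ P' ∩ layer A lam (t + 1), 6 * (w * Fintype.card α) ≤ #G ∧
      ∀ y ∈ G, 6 * (w * Fintype.card α) ≤
        #A / (4 * Fintype.card α) * #{p ∈ P | lam p + 1 ≤ t ∧ D p y}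

/-- A layering satisfying all conditions needed for Hall's condition. -/
structure Lay (D : α → α → Prop) (A P P' : Finset α) (t : ℕ) (lam : α → ℕ)
    (w κ μ : ℝ) : Prop where
  fwd : HalfLay D A P P' t lam w κ μ
  bwd : HalfLay (fun x y => D y x) A P' P t (fun v => t + 1 - lam v) w κ μ
  hP : Disjoint P A
  hP' : Disjoint P' A
  lam_le : ∀ v, lam v ≤ t + 1
  card_add : #P + #P' = Fintype.card α
  card_P : (Fintype.card α / 2 - μ * Fintype.card α : ℝ) ≤ #P
  card_P' : (Fintype.card α / 2 - μ * Fintype.card α : ℝ) ≤ #P'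
  t_pos : 1 ≤ t
  w_pos : 0 < w
  w_le : w * Fintype.card α ≤ #A / 16
  t_w : 1 / 2 ≤ (t - 1) * w
  κ_eq : κ = #A / 20
  μ_nonneg : 0 ≤ μ
  μ_le : μ * Fintype.card α ≤ #A / 16
  A_pos : 0 < #A

variable {D : α → α → Prop} {A P P' : Finset α} {t : ℕ} {lam : α → ℕ} {w κ μ : ℝ}

lemma Lay.symm (h : Lay D A P P' t lam w κ μ) :
    Lay (fun x y => D y x) A P' P t (fun v => t + 1 - lam v) w κ μ where
  fwd := h.bwd
  bwd := by
    have e : (fun v => t + 1 - (t + 1 - lam v)) = lam :=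
      funext fun v => Nat.sub_sub_self (h.lam_le v)
    simpa only [e] using h.fwd
  hP := h.hP'
  hP' := h.hP
  lam_le := fun v => Nat.sub_le _ _
  card_add := by rw [add_comm]; exact h.card_add
  card_P := h.card_P'
  card_P' := h.card_P
  t_pos := h.t_pos
  w_pos := h.w_pos
  w_le := h.w_le
  t_w := h.t_w
  κ_eq := h.κ_eq
  μ_nonneg := h.μ_nonneg
  μ_le := h.μ_le
  A_pos := h.A_pos

lemma Lay.allowed_symm (h : Lay D A P P' t lam w κ μ) {x y : α}
    (hxy : Allowed (fun x y => D y x) A P' P t (fun v => t + 1 - lam v) y x) :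
    Allowed D A P P' t lam x y := by
  obtain ⟨h1, h2⟩ := hxy
  refine ⟨h1, ?_⟩
  have hx := h.lam_le x
  have hy := h.lam_le y
  rcases h2 with h2 | h2 | h2
  · exact Or.inr (Or.inl h2.symm)
  · exact Or.inl h2.symm
  · refine Or.inr (Or.inr ⟨h2.2.1, h2.1, ?_⟩)
    have := h2.2.2
    unfold LayerStep at this ⊢
    simp only at this
    omega

lemma layer_symm (hle : ∀ v, lam v ≤ t + 1) {j : ℕ} (hj : j ≤ t + 1) :
    layer A (fun v => t + 1 - lam v) j = layer A lam (t + 1 - j) := by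
  ext v
  have := hle v
  simp only [mem_layer, and_congr_right_iff]
  intro _
  omega

lemma card_filter_add_card_inter_le {β : Type*} [DecidableEq β] (T Y : Finset β)
    (p : β → Prop) [DecidablePred p]
    (h : ∀ y ∈ T, y ∈ Y → ¬ p y) : (#{y ∈ T | p y} : ℝ) + #(Y ∩ T) ≤ #T := by
  have hd : Disjoint {y ∈ T | p y} (Y ∩ T) := by
    rw [Finset.disjoint_left]
    intro y hy hy'
    rw [mem_filter] at hy
    rw [mem_inter] at hy'
    exact h y hy.1 hy'.1 hy.2
  have : #({y ∈ T | p y} ∪ (Y ∩ T)) ≤ #T :=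
    card_le_card (union_subset (filter_subset _ _) inter_subset_right)
  rw [card_union_of_disjoint hd] at this
  exact_mod_cast this

lemma card_inter_le_card {β : Type*} [DecidableEq β] (X T : Finset β) :
    (#(X ∩ T) : ℝ) ≤ #T := by exact_mod_cast card_le_card inter_subset_right

lemma card_eq_sum_layer (hle : ∀ v, lam v ≤ t + 1) {Z : Finset α} (hZ : Disjoint Z A) :
    (#Z : ℝ) = ∑ j ∈ range (t + 2), (#(Z ∩ layer A lam j) : ℝ) := by
  rw [card_eq_sum_card_fiberwise (f := lam) (t := range (t + 2))]
  · push_cast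
    refine sum_congr rfl fun j _ => ?_
    congr 2
    ext v
    simp only [mem_filter, mem_inter, mem_layer]
    constructor
    · rintro ⟨h1, h2⟩
      exact ⟨h1, Finset.disjoint_left.1 hZ h1, h2⟩
    · rintro ⟨h1, -, h2⟩
      exact ⟨h1, h2⟩
  · intro v _
    have := hle v
    simp only [coe_range, Set.mem_Iio]
    omega

lemma Lay.card_P'_layer (h : Lay D A P P' t lam w κ μ) {j : ℕ} (h1 : 1 ≤ j) (h2 : j ≤ t) :
    w * (Fintype.card α / 2 - κ) ≤ #(P' ∩ layer A lam j) := by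
  have := h.bwd.card_P (t + 1 - j) (by omega) (by omega)
  rwa [layer_symm h.lam_le (by omega), show t + 1 - (t + 1 - j) = j by omega] at this

lemma Lay.card_first (h : Lay D A P P' t lam w κ μ) : (#(layer A lam 0) : ℝ) ≤ #A / 32 := by
  have := h.bwd.card_last
  rwa [layer_symm h.lam_le le_rfl, show t + 1 - (t + 1) = 0 by omega] at this

open Classical in
lemma Lay.in_C1 (h : Lay D A P P' t lam w κ μ) {y : α} (hy : y ∉ A) (hyP : y ∉ P') {j : ℕ}
    (h1 : 1 ≤ j) (h2 : j ≤ t) :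
    w * (Fintype.card α / 2 - κ) ≤ #{x ∈ layer A lam j | D x y} := by
  have := h.bwd.out_C3 y hy hyP (t + 1 - j) (by omega) (by omega)
  rwa [layer_symm h.lam_le (by omega), show t + 1 - (t + 1 - j) = j by omega] at this

open Classical in
lemma Lay.in_W (h : Lay D A P P' t lam w κ μ) {y : α} (hy : y ∉ A) {j : ℕ}
    (h1 : 1 ≤ j) (h2 : j ≤ t) :
    w * (Fintype.card α / 2 - #A - κ) ≤ #{x ∈ layer A lam j | D x y} := by
  have := h.bwd.out_W y hy (t + 1 - j) (by omega) (by omega)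
  rwa [layer_symm h.lam_le (by omega), show t + 1 - (t + 1 - j) = j by omega] at this

open Classical in
lemma Lay.in_first (h : Lay D A P P' t lam w κ μ) {y : α} (hy : y ∉ A) (hyP : y ∉ P') :
    4 * (w * Fintype.card α) ≤ #{x ∈ layer A lam 0 | D x y} := by
  have := h.bwd.out_last y hy hyP
  rwa [layer_symm h.lam_le le_rfl, show t + 1 - (t + 1) = 0 by omega] at this

/-- If `X` meets `A`, then few vertices of `P'` lie in `Y`, and if there are any, many vertices
of `A` lie outside `X`. -/
lemma Lay.card_Y_inter_P' (h : Lay D A P P' t lam w κ μ) {X Y : Finset α}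
    (hXY : ∀ x ∈ X, ∀ y ∈ Y, ¬ Allowed D A P P' t lam x y)
    (hXA : (X ∩ A).Nonempty) : (#(Y ∩ P') : ℝ) ≤ #(A \ X) := by
  classical
  obtain ⟨a, ha⟩ := hXA
  rw [mem_inter] at ha
  rcases (Y ∩ P').eq_empty_or_nonempty with hY | ⟨y, hy⟩
  · rw [hY]; simp
  rw [mem_inter] at hy
  have h1 : (#(Y ∩ P') : ℝ) ≤ #{y ∈ P' | ¬ D a y} := by
    exact_mod_cast card_le_card fun z hz => by
      rw [mem_inter] at hz
      exact mem_filter.2 ⟨hz.2, fun hD => hXY a ha.1 z hz.1 ⟨hD, Or.inl ⟨ha.2, hz.2⟩⟩⟩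
  have h2 := h.fwd.out_A a ha.2
  have h3 := h.bwd.out_P y hy.2
  have h4 : (#{x ∈ A | D x y} : ℝ) ≤ #(A \ X) := by
    exact_mod_cast card_le_card fun z hz => by
      rw [mem_filter] at hz
      exact mem_sdiff.2 ⟨hz.1, fun hzX => hXY z hzX y hy.1 ⟨hz.2, Or.inl ⟨hz.1, hy.2⟩⟩⟩
  have h5 := h.μ_le
  have : (0 : ℝ) ≤ #A := by positivity
  linarith

lemma Lay.card_layer_of_C1 (h : Lay D A P P' t lam w κ μ) {X Y : Finset α}
    (hXY : ∀ x ∈ X, ∀ y ∈ Y, ¬ Allowed D A P P' t lam x y)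
    (hXA : (X ∩ A).Nonempty) (hYA : Disjoint Y A) :
    (#X : ℝ) + #Y ≤ Fintype.card α := by
  classical
  have hP := h.card_Y_inter_P' hXY hXA
  have hkey : (#(Y \ P') : ℝ) ≤ #(univ \ (A ∪ X)) := by
    by_cases hlast : ∃ y ∈ Y \ P', lam y = t + 1
    · obtain ⟨y, hy, hyl⟩ := hlast
      rw [mem_sdiff] at hy
      have hyA := Finset.disjoint_left.1 hYA hy.1
      have h1 := h.bwd.out_zero y hyA hy.2 (by simp [hyl])
      have h2 : (#{x | x ∉ A ∧ 1 ≤ t + 1 - lam x ∧ D x y} : ℝ) ≤ #(univ \ (A ∪ X)) := by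
        exact_mod_cast card_le_card fun z hz => by
          simp only [mem_filter, mem_univ, true_and] at hz
          simp only [mem_sdiff, mem_univ, true_and, mem_union, not_or]
          refine ⟨hz.1, fun hzX => hXY z hzX y hy.1 ⟨hz.2.2, Or.inr (Or.inr ⟨hz.1, hyA, ?_⟩)⟩⟩
          unfold LayerStep
          omega
      have h3 : #(Y \ P') + #P' + #A ≤ Fintype.card α := by
        rw [← card_union_of_disjoint sdiff_disjoint, ← card_union_of_disjoint]
        · exact card_le_univ _
        · rw [Finset.disjoint_union_left]
          exact ⟨hYA.mono_left sdiff_subset, h.hP'⟩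
      have h3' : (#(Y \ P') + #P' + #A : ℝ) ≤ Fintype.card α := by exact_mod_cast h3
      have h4 := h.card_P'
      have h5 := h.μ_le
      have h6 := h.κ_eq
      have : (0 : ℝ) ≤ #A := by positivity
      linarith
    · push Not at hlast
      have hd : Disjoint (Y \ P') A := hYA.mono_left sdiff_subset
      have hd2 : Disjoint (univ \ (A ∪ X)) A :=
        (disjoint_sdiff_self_left).mono_right subset_union_left
      rw [card_eq_sum_layer h.lam_le hd, card_eq_sum_layer h.lam_le hd2, sum_range_succ',
        sum_range_succ]
      have h0 : (#(Y \ P' ∩ layer A lam 0) : ℝ) = 0 := by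
        norm_cast
        rw [card_eq_zero, eq_empty_iff_forall_notMem]
        intro v hv
        simp only [mem_inter, mem_sdiff, mem_layer] at hv
        exact hv.1.2 (h.bwd.last_sub v hv.2.1 (by omega))
      have ht : (#(Y \ P' ∩ layer A lam (t + 1)) : ℝ) = 0 := by
        norm_cast
        rw [card_eq_zero, eq_empty_iff_forall_notMem]
        intro v hv
        simp only [mem_inter, mem_layer] at hv
        exact hlast v hv.1 hv.2.2
      rw [h0, ht, add_zero, add_zero, sum_range_succ, sum_range_succ]
      have hlt : (0 : ℝ) ≤ #(univ \ (A ∪ X) ∩ layer A lam (t + 1)) := by positivity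
      have hlt' : (0 : ℝ) ≤ #(univ \ (A ∪ X) ∩ layer A lam t) := by positivity
      refine le_trans (sum_le_sum fun j hj => ?_)
        ((le_add_of_nonneg_right hlt').trans (le_add_of_nonneg_right hlt))
      rw [mem_range] at hj
      rcases (Y \ P' ∩ layer A lam (j + 1)).eq_empty_or_nonempty with hemp | ⟨y, hy⟩
      · rw [hemp]; simp
      simp only [mem_inter, mem_sdiff, mem_layer] at hy
      have h1 : (#{x ∈ layer A lam j | D x y} : ℝ) ≤ #(univ \ (A ∪ X) ∩ layer A lam j) := by
        exact_mod_cast card_le_card fun z hz => by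
          simp only [mem_filter, mem_layer] at hz
          simp only [mem_inter, mem_sdiff, mem_univ, true_and, mem_union, not_or, mem_layer]
          refine ⟨⟨hz.1.1, fun hzX => hXY z hzX y hy.1.1
            ⟨hz.2, Or.inr (Or.inr ⟨hz.1.1, hy.2.1, ?_⟩)⟩⟩, hz.1⟩
          unfold LayerStep
          omega
      have h2 : (#(Y \ P' ∩ layer A lam (j + 1)) : ℝ) + #(P' ∩ layer A lam (j + 1)) ≤
          #(layer A lam (j + 1)) := by
        norm_cast
        rw [← card_union_of_disjoint]
        · exact card_le_card (union_subset inter_subset_right inter_subset_right)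
        · exact (disjoint_sdiff_self_left).mono inter_subset_left inter_subset_left
      have h3 := h.fwd.card_layer (j + 1) (by omega) (by omega)
      have h4 := h.card_P'_layer (j := j + 1) (by omega) (by omega)
      have h5 := h.κ_eq
      have h6 := h.w_pos
      have h7 := h.A_pos
      have h7' : (0 : ℝ) < #A := by exact_mod_cast h7
      have h8 : (#A : ℝ) ≤ Fintype.card α := by exact_mod_cast card_le_univ A
      rcases Nat.eq_zero_or_pos j with rfl | hj0
      · have h9 := h.in_first hy.2.1 hy.1.2
        nlinarith [card_inter_le_card (Y \ P') (layer A lam (0 + 1))]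
      · have h9 := h.in_C1 hy.2.1 hy.1.2 (j := j) (by omega) (by omega)
        nlinarith
  have e1 : (#X : ℝ) + #(univ \ (A ∪ X)) + #(A \ X) = Fintype.card α := by
    norm_cast
    rw [← card_union_of_disjoint, ← card_union_of_disjoint, ← card_univ]
    · congr 1
      ext v
      simp only [mem_union, mem_sdiff, mem_univ, true_and]
      tauto
    · rw [Finset.disjoint_left]
      intro v
      simp only [mem_union, mem_sdiff, mem_univ, true_and]
      tauto
    · rw [Finset.disjoint_left]
      intro v
      simp only [mem_union, mem_sdiff, mem_univ, true_and]
      tauto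
  have e2 : (#Y : ℝ) = #(Y ∩ P') + #(Y \ P') := by
    exact_mod_cast (card_inter_add_card_sdiff Y P').symm
  linarith

lemma Lay.symm_hXY (h : Lay D A P P' t lam w κ μ) {X Y : Finset α}
    (hXY : ∀ x ∈ X, ∀ y ∈ Y, ¬ Allowed D A P P' t lam x y)
    : ∀ y ∈ Y, ∀ x ∈ X,
    ¬ Allowed (fun x y => D y x) A P' P t (fun v => t + 1 - lam v) y x :=
  fun y hy x hx hall => hXY x hx y hy (h.allowed_symm hall)

lemma Lay.card_le_of_P (h : Lay D A P P' t lam w κ μ)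
    (X : Finset α) :
    (#X : ℝ) ≤ #A - #(A \ X) + #(X ∩ P) + (Fintype.card α - #A - #P) := by
  have h1 : #X ≤ #(X ∩ A) + #(X ∩ P) + #(univ \ (A ∪ P)) := by
    refine le_trans (card_le_card ?_) ((card_union_le _ _).trans
      (Nat.add_le_add_right (card_union_le _ _) _))
    intro v hv
    simp only [mem_union, mem_inter, mem_sdiff, mem_univ, true_and]
    tauto
  have h2 : #(univ \ (A ∪ P)) + (#A + #P) = Fintype.card α := by
    rw [← card_union_of_disjoint h.hP.symm, ← card_univ, card_sdiff_add_card_eq_card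
      (subset_univ _)]
  have h3 : #(A \ X) + #(X ∩ A) = #A := by
    rw [inter_comm]; exact card_sdiff_add_card_inter A X
  have h1' : (#X : ℝ) ≤ #(X ∩ A) + #(X ∩ P) + #(univ \ (A ∪ P)) := by exact_mod_cast h1
  have h2' : (#(univ \ (A ∪ P)) : ℝ) + (#A + #P) = Fintype.card α := by exact_mod_cast h2
  have h3' : (#(A \ X) : ℝ) + #(X ∩ A) = #A := by exact_mod_cast h3
  linarith

lemma Lay.card_add_le_of_both (h : Lay D A P P' t lam w κ μ) {X Y : Finset α}
    (hXY : ∀ x ∈ X, ∀ y ∈ Y, ¬ Allowed D A P P' t lam x y)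
    (hXA : (X ∩ A).Nonempty) (hYA : (Y ∩ A).Nonempty) :
    (#X : ℝ) + #Y ≤ Fintype.card α := by
  have h1 := h.card_Y_inter_P' hXY hXA
  have h2 := h.symm.card_Y_inter_P' (h.symm_hXY hXY) hYA
  have h3 := h.card_le_of_P X
  have h4 := h.symm.card_le_of_P Y
  have h5 : (#P + #P' : ℝ) = Fintype.card α := by exact_mod_cast h.card_add
  linarith

lemma Lay.card_decomp (h : Lay D A P P' t lam w κ μ)
    {Z : Finset α} (hZ : Disjoint Z A) :
    (#Z : ℝ) = #(Z ∩ layer A lam 0) + #(Z ∩ layer A lam 1) +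
      ∑ i ∈ range (t - 1), (#(Z ∩ layer A lam (i + 2)) : ℝ) + #(Z ∩ layer A lam (t + 1)) ∧
    (#Z : ℝ) = #(Z ∩ layer A lam 0) +
      ∑ i ∈ range (t - 1), (#(Z ∩ layer A lam (i + 1)) : ℝ) + #(Z ∩ layer A lam t) +
      #(Z ∩ layer A lam (t + 1)) := by
  obtain ⟨s, rfl⟩ : ∃ s, t = s + 1 := ⟨t - 1, by have := h.t_pos; omega⟩
  rw [card_eq_sum_layer h.lam_le hZ]
  constructor
  · rw [sum_range_succ, sum_range_succ', sum_range_succ']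
    simp only [Nat.add_sub_cancel]
    ring_nf
  · rw [sum_range_succ, sum_range_succ, sum_range_succ']
    simp only [Nat.add_sub_cancel]
    ring

lemma Lay.card_Y_layer (h : Lay D A P P' t lam w κ μ) {X Y : Finset α}
    (hXY : ∀ x ∈ X, ∀ y ∈ Y, ¬ Allowed D A P P' t lam x y)
    {x : α} (hx : x ∈ X) (hxA : x ∉ A) (hxP : x ∉ P) {j : ℕ}
    (h1 : 1 ≤ j) (h2 : j + 1 ≤ t) (hlam : lam x = 0 ∨ lam x = j) :
    (#(Y ∩ layer A lam (j + 1)) : ℝ) ≤ w * (Fintype.card α / 2 - #A + 2 * κ) := by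
  classical
  have e1 := h.fwd.out_C3 x hxA hxP (j + 1) (by omega) h2
  have e2 := h.fwd.card_layer (j + 1) (by omega) h2
  have e3 := card_filter_add_card_inter_le (layer A lam (j + 1)) Y (fun y => D x y)
    fun y hy hyY hD => hXY x hx y hyY ⟨hD, Or.inr (Or.inr ⟨hxA, (mem_layer.1 hy).1, by
      unfold LayerStep; have := (mem_layer.1 hy).2; omega⟩)⟩
  nlinarith

lemma Lay.pair_slack (h : Lay D A P P' t lam w κ μ) {X Y : Finset α}
    (hXY : ∀ x ∈ X, ∀ y ∈ Y, ¬ Allowed D A P P' t lam x y)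
    {j : ℕ} (h1 : 1 ≤ j) (h2 : j + 1 ≤ t)
    (hb : (#(Y ∩ layer A lam (j + 1)) : ℝ) ≤ w * (Fintype.card α / 2 - #A + 2 * κ)) :
    (#(X ∩ layer A lam j) : ℝ) + #(Y ∩ layer A lam (j + 1)) + w * #A / 2 ≤
      #(P ∩ layer A lam j) + #(P' ∩ layer A lam (j + 1)) := by
  classical
  have e1 := h.fwd.card_P j h1 (by omega)
  have e2 := h.card_P'_layer (j := j + 1) (by omega) h2
  have e3 := h.fwd.card_layer j h1 (by omega)
  have e5 := h.κ_eq
  have e6 := h.w_pos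
  have e7' : (0 : ℝ) < #A := by exact_mod_cast h.A_pos
  have e9 : 0 < w * #A := by positivity
  have e10 : w * κ = w * #A / 20 := by rw [e5]; ring
  rcases (Y ∩ layer A lam (j + 1)).eq_empty_or_nonempty with hemp | ⟨y, hy⟩
  · rw [hemp]
    have := card_inter_le_card X (layer A lam j)
    simp only [card_empty, CharP.cast_eq_zero, add_zero]
    nlinarith
  · rw [mem_inter, mem_layer] at hy
    have e8 := h.in_W hy.2.1 h1 (by omega)
    have e4 := card_filter_add_card_inter_le (layer A lam j) X (fun x => D x y)
      fun x hx hxX hD => hXY x hxX y hy.1 ⟨hD, Or.inr (Or.inr ⟨(mem_layer.1 hx).1, hy.2.1, by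
        unfold LayerStep; have := (mem_layer.1 hx).2; omega⟩)⟩
    nlinarith

lemma Lay.pair_min (h : Lay D A P P' t lam w κ μ) {X Y : Finset α}
    (hXY : ∀ x ∈ X, ∀ y ∈ Y, ¬ Allowed D A P P' t lam x y)
    {j : ℕ} (h1 : 1 ≤ j) (h2 : j + 1 ≤ t) :
    (#(X ∩ layer A lam j) : ℝ) + #(Y ∩ layer A lam (j + 1)) +
      min (w * #A / 2) #((P ∩ layer A lam j) \ X) ≤
      #(P ∩ layer A lam j) + #(P' ∩ layer A lam (j + 1)) := by
  by_cases hx : ∃ x ∈ X, x ∈ layer A lam j ∧ x ∉ P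
  · obtain ⟨x, hx, hxl, hxP⟩ := hx
    rw [mem_layer] at hxl
    have := h.pair_slack hXY h1 h2 (h.card_Y_layer hXY hx hxl.1 hxP h1 h2 (Or.inr hxl.2))
    linarith [min_le_left (w * #A / 2) (#((P ∩ layer A lam j) \ X) : ℝ)]
  by_cases hy : ∃ y ∈ Y, y ∈ layer A lam (j + 1) ∧ y ∉ P'
  · obtain ⟨y, hy, hyl, hyP⟩ := hy
    rw [mem_layer] at hyl
    have hs := h.symm
    have hs2 := h.symm_hXY hXY
    have e1 : t + 1 - (j + 1) = t - j := by omega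
    have l1 : layer A (fun v => t + 1 - lam v) (t - j + 1) = layer A lam j := by
      rw [layer_symm h.lam_le (by omega)]; congr 1; omega
    have l2 : layer A (fun v => t + 1 - lam v) (t - j) = layer A lam (j + 1) := by
      rw [layer_symm h.lam_le (by omega)]; congr 1; omega
    have := hs.pair_slack hs2 (j := t - j) (by omega) (by omega)
      (hs.card_Y_layer hs2 hy hyl.1 hyP (by omega) (by omega) (Or.inr (by omega)))
    rw [l1, l2] at this
    linarith [min_le_left (w * #A / 2) (#((P ∩ layer A lam j) \ X) : ℝ)]
  push Not at hx hy
  have e1 : (#(X ∩ layer A lam j) : ℝ) + #((P ∩ layer A lam j) \ X) ≤ #(P ∩ layer A lam j) := by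
    norm_cast
    rw [← card_union_of_disjoint]
    · refine card_le_card fun v hv => ?_
      simp only [mem_union, mem_inter, mem_sdiff] at hv ⊢
      rcases hv with hv | hv
      · exact ⟨hx v hv.1 hv.2, hv.2⟩
      · exact hv.1
    · exact disjoint_sdiff_self_right.mono_left inter_subset_left
  have e2 : (#(Y ∩ layer A lam (j + 1)) : ℝ) ≤ #(P' ∩ layer A lam (j + 1)) := by
    exact_mod_cast card_le_card fun v hv => by
      rw [mem_inter] at hv ⊢
      exact ⟨hy v hv.1 hv.2, hv.2⟩
  linarith [min_le_right (w * #A / 2) (#((P ∩ layer A lam j) \ X) : ℝ)]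

lemma Lay.card_add_le_of_zero (h : Lay D A P P' t lam w κ μ) {X Y : Finset α}
    (hXY : ∀ x ∈ X, ∀ y ∈ Y, ¬ Allowed D A P P' t lam x y)
    (hXA : Disjoint X A) (hYA : Disjoint Y A)
    (hx : ∃ x ∈ X, x ∉ P ∧ lam x = 0) : (#X : ℝ) + #Y ≤ Fintype.card α := by
  obtain ⟨x, hx, hxP, hx0⟩ := hx
  have hxA := Finset.disjoint_left.1 hXA hx
  have hp : ∀ i ∈ range (t - 1), (#(X ∩ layer A lam (i + 1)) : ℝ) +
      #(Y ∩ layer A lam (i + 2)) + w * #A / 2 ≤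
      #(P ∩ layer A lam (i + 1)) + #(P' ∩ layer A lam (i + 2)) := by
    intro i hi
    rw [mem_range] at hi
    exact h.pair_slack hXY (by omega) (by omega)
      (h.card_Y_layer hXY hx hxA hxP (by omega) (by omega) (Or.inl hx0))
  have hs := sum_le_sum hp
  simp only [sum_add_distrib, sum_const, card_range, nsmul_eq_mul] at hs
  rw [Nat.cast_sub h.t_pos, Nat.cast_one] at hs
  have d1 := (h.card_decomp hXA).2
  have d2 := (h.card_decomp hYA).1
  have d3 := (h.card_decomp h.hP).2
  have d4 := (h.card_decomp h.hP').1
  have d5 : (#P + #P' : ℝ) = Fintype.card α := by exact_mod_cast h.card_add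
  have e0 : (0 : ℝ) < #A := by exact_mod_cast h.A_pos
  have e1 : (#A : ℝ) / 4 ≤ (t - 1) * (w * #A / 2) := by nlinarith [h.t_w]
  have e2 := h.card_first
  have e3 := h.fwd.card_last
  have e4 := h.fwd.card_layer 1 le_rfl h.t_pos
  have e5 := h.fwd.card_layer t h.t_pos le_rfl
  have e6 := h.w_le
  have e7 := h.w_pos
  have e8 : w * (Fintype.card α - #A + κ) ≤ w * Fintype.card α := by
    rw [h.κ_eq]; nlinarith
  have f1 := card_inter_le_card X (layer A lam 0)
  have f2 := card_inter_le_card X (layer A lam t)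
  have f3 := card_inter_le_card X (layer A lam (t + 1))
  have f4 := card_inter_le_card Y (layer A lam 0)
  have f5 := card_inter_le_card Y (layer A lam 1)
  have f6 := card_inter_le_card Y (layer A lam (t + 1))
  have g1 : (0 : ℝ) ≤ #(P ∩ layer A lam 0) := by positivity
  have g2 : (0 : ℝ) ≤ #(P ∩ layer A lam t) := by positivity
  have g3 : (0 : ℝ) ≤ #(P ∩ layer A lam (t + 1)) := by positivity
  have g4 : (0 : ℝ) ≤ #(P' ∩ layer A lam 0) := by positivity
  have g5 : (0 : ℝ) ≤ #(P' ∩ layer A lam 1) := by positivity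
  have g6 : (0 : ℝ) ≤ #(P' ∩ layer A lam (t + 1)) := by positivity
  linarith

lemma card_inter_add_sdiff_le {S T X : Finset α} (hS : X ∩ T ⊆ S) :
    (#(X ∩ T) : ℝ) + #((S ∩ T) \ X) ≤ #(S ∩ T) := by
  norm_cast
  rw [← card_union_of_disjoint]
  · exact card_le_card (union_subset (subset_inter hS inter_subset_right) sdiff_subset)
  · exact disjoint_sdiff_self_right.mono_left inter_subset_left

lemma Lay.card_add_core (h : Lay D A P P' t lam w κ μ) {X Y : Finset α}
    (hXY : ∀ x ∈ X, ∀ y ∈ Y, ¬ Allowed D A P P' t lam x y)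
    (hXA : Disjoint X A) (hYA : Disjoint Y A)
    (hx0 : ∀ x ∈ X, lam x = 0 → x ∈ P) (hy0 : ∀ y ∈ Y, lam y = t + 1 → y ∈ P') :
    (#X : ℝ) + #Y + ∑ i ∈ range (t - 1),
      min (w * #A / 2) (#((P ∩ layer A lam (i + 1)) \ X) : ℝ) +
      #((P ∩ layer A lam 0) \ X) + #((P' ∩ layer A lam (t + 1)) \ Y) +
      (#(P ∩ layer A lam t) - #(X ∩ layer A lam t)) +
      (#(P' ∩ layer A lam 1) - #(Y ∩ layer A lam 1)) ≤ Fintype.card α := by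
  have hs := sum_le_sum (s := range (t - 1)) fun i hi => h.pair_min hXY (j := i + 1) (by omega)
    (by rw [mem_range] at hi; omega)
  simp only [sum_add_distrib] at hs
  have d1 := (h.card_decomp hXA).2
  have d2 := (h.card_decomp hYA).1
  have d3 := (h.card_decomp h.hP).2
  have d4 := (h.card_decomp h.hP').1
  have d5 : (#P + #P' : ℝ) = Fintype.card α := by exact_mod_cast h.card_add
  have e1 : (#(X ∩ layer A lam 0) : ℝ) + #((P ∩ layer A lam 0) \ X) ≤ #(P ∩ layer A lam 0) :=
    card_inter_add_sdiff_le fun v hv => by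
      rw [mem_inter, mem_layer] at hv; exact hx0 v hv.1 hv.2.2
  have e2 : (#(X ∩ layer A lam (t + 1)) : ℝ) + #((P ∩ layer A lam (t + 1)) \ X) ≤
      #(P ∩ layer A lam (t + 1)) :=
    card_inter_add_sdiff_le fun v hv => by
      rw [mem_inter, mem_layer] at hv; exact h.fwd.last_sub v hv.2.1 hv.2.2
  have e3 : (#(Y ∩ layer A lam (t + 1)) : ℝ) + #((P' ∩ layer A lam (t + 1)) \ Y) ≤
      #(P' ∩ layer A lam (t + 1)) :=
    card_inter_add_sdiff_le fun v hv => by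
      rw [mem_inter, mem_layer] at hv; exact hy0 v hv.1 hv.2.2
  have e4 : (#(Y ∩ layer A lam 0) : ℝ) + #((P' ∩ layer A lam 0) \ Y) ≤
      #(P' ∩ layer A lam 0) :=
    card_inter_add_sdiff_le fun v hv => by
      rw [mem_inter, mem_layer] at hv
      exact h.bwd.last_sub v hv.2.1 (by have := hv.2.2; omega)
  have g2 : (0 : ℝ) ≤ #((P ∩ layer A lam (t + 1)) \ X) := by positivity
  have g4 : (0 : ℝ) ≤ #((P' ∩ layer A lam 0) \ Y) := by positivity
  linarith

lemma Lay.card_mul_le_slack (h : Lay D A P P' t lam w κ μ)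
    {N X : Finset α} (hNP : N ⊆ P) (hNt : ∀ p ∈ N, lam p + 1 ≤ t)
    (hNX : ∀ p ∈ N, p ∉ X) :
    (#A : ℝ) / (4 * Fintype.card α) * #N ≤
      ∑ i ∈ range (t - 1), min (w * #A / 2) (#((P ∩ layer A lam (i + 1)) \ X) : ℝ) +
      #((P ∩ layer A lam 0) \ X) := by
  have e0 : (0 : ℝ) < #A := by exact_mod_cast h.A_pos
  have hm : (#A : ℝ) ≤ Fintype.card α := by exact_mod_cast card_le_univ A
  have e7 := h.w_pos
  have e8 : w * (Fintype.card α - #A + κ) ≤ w * Fintype.card α := by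
    rw [h.κ_eq]; nlinarith
  have e9 : 0 < w * #A := by positivity
  have d := (h.card_decomp (h.hP.mono_left hNP)).2
  have z1 : #(N ∩ layer A lam t) = 0 := by
    rw [card_eq_zero, eq_empty_iff_forall_notMem]
    intro v hv
    rw [mem_inter, mem_layer] at hv
    have := hNt v hv.1
    omega
  have z2 : #(N ∩ layer A lam (t + 1)) = 0 := by
    rw [card_eq_zero, eq_empty_iff_forall_notMem]
    intro v hv
    rw [mem_inter, mem_layer] at hv
    have := hNt v hv.1
    omega
  have hsub : ∀ j, (#(N ∩ layer A lam j) : ℝ) ≤ #((P ∩ layer A lam j) \ X) := by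
    intro j
    exact_mod_cast card_le_card fun v hv => by
      rw [mem_inter] at hv
      exact mem_sdiff.2 ⟨mem_inter.2 ⟨hNP hv.1, hv.2⟩, hNX v hv.1⟩
  have hm0 : (0 : ℝ) < Fintype.card α := by linarith
  have hc0 : 0 ≤ (#A : ℝ) / (4 * Fintype.card α) := by positivity
  have hc : (#A : ℝ) / (4 * Fintype.card α) ≤ 1 := by
    rw [div_le_one (by positivity)]; linarith
  have hterm : ∀ i ∈ range (t - 1), (#A : ℝ) / (4 * Fintype.card α) *
      #(N ∩ layer A lam (i + 1)) ≤
      min (w * #A / 2) (#((P ∩ layer A lam (i + 1)) \ X) : ℝ) := by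
    intro i hi
    rw [mem_range] at hi
    have hs := hsub (i + 1)
    refine le_min ?_ ?_
    · have b1 := h.fwd.card_layer (i + 1) (by omega) (by omega)
      have b2 := card_inter_le_card N (layer A lam (i + 1))
      have b3 : (#(N ∩ layer A lam (i + 1)) : ℝ) ≤ w * Fintype.card α := by linarith
      calc (#A : ℝ) / (4 * Fintype.card α) * #(N ∩ layer A lam (i + 1))
          ≤ (#A : ℝ) / (4 * Fintype.card α) * (w * Fintype.card α) := by gcongr
        _ = w * #A / 4 := by field_simp
        _ ≤ w * #A / 2 := by nlinarith
    · have : (0 : ℝ) ≤ #(N ∩ layer A lam (i + 1)) := by positivity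
      nlinarith
  have hsum := sum_le_sum hterm
  rw [← mul_sum] at hsum
  rw [z1, z2] at d
  push_cast at d
  have h00 := hsub 0
  have hn0 : (0 : ℝ) ≤ #(N ∩ layer A lam 0) := by positivity
  rw [d]; nlinarith

lemma Lay.card_add_le_of_last (h : Lay D A P P' t lam w κ μ) {X Y : Finset α}
    (hXY : ∀ x ∈ X, ∀ y ∈ Y, ¬ Allowed D A P P' t lam x y)
    (hXA : Disjoint X A) (hYA : Disjoint Y A)
    (hx0 : ∀ x ∈ X, lam x = 0 → x ∈ P) (hy0 : ∀ y ∈ Y, lam y = t + 1 → y ∈ P')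
    (hx : ∃ x ∈ X, x ∉ P ∧ lam x = t) : (#X : ℝ) + #Y ≤ Fintype.card α := by
  classical
  obtain ⟨x, hx, hxP, hxt⟩ := hx
  have hxA := Finset.disjoint_left.1 hXA hx
  have hcore := h.card_add_core hXY hXA hYA hx0 hy0
  have e0 : (0 : ℝ) < #A := by exact_mod_cast h.A_pos
  have hm : (#A : ℝ) ≤ Fintype.card α := by exact_mod_cast card_le_univ A
  have e7 := h.w_pos
  have e8 : w * (Fintype.card α - #A + κ) ≤ w * Fintype.card α := by
    rw [h.κ_eq]; nlinarith
  have e9 : 0 < w * Fintype.card α := by nlinarith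
  have e4 := h.fwd.card_layer 1 le_rfl h.t_pos
  have e5 := h.fwd.card_layer t h.t_pos le_rfl
  have f2 := card_inter_le_card X (layer A lam t)
  have f5 := card_inter_le_card Y (layer A lam 1)
  have g2 : (0 : ℝ) ≤ #(P ∩ layer A lam t) := by positivity
  have g5 : (0 : ℝ) ≤ #(P' ∩ layer A lam 1) := by positivity
  have g0 : (0 : ℝ) ≤ #((P ∩ layer A lam 0) \ X) := by positivity
  have g1 : (0 : ℝ) ≤ #((P' ∩ layer A lam (t + 1)) \ Y) := by positivity
  have gs : ∀ i ∈ range (t - 1), 0 ≤ min (w * #A / 2)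
      (#((P ∩ layer A lam (i + 1)) \ X) : ℝ) := fun i _ => by positivity
  have gs' := sum_nonneg gs
  rcases h.fwd.out_t x hxA hxP hxt with h1 | ⟨G, hG, h1, h2⟩
  · have h3 : (#{y ∈ P' ∩ layer A lam (t + 1) | D x y} : ℝ) ≤
        #((P' ∩ layer A lam (t + 1)) \ Y) := by
      exact_mod_cast card_le_card fun y hy => by
        rw [mem_filter] at hy
        refine mem_sdiff.2 ⟨hy.1, fun hyY => hXY x hx y hyY ⟨hy.2, Or.inr (Or.inr ⟨hxA, ?_⟩)⟩⟩
        have := mem_layer.1 (mem_inter.1 hy.1).2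
        exact ⟨this.1, Or.inr (Or.inr ⟨hxt.le, this.2⟩)⟩
    linarith
  · by_cases hGY : ∃ y ∈ G, y ∈ Y
    · obtain ⟨y, hyG, hyY⟩ := hGY
      have hyl := mem_layer.1 (mem_inter.1 (hG hyG)).2
      have h3 := h2 y hyG
      set N : Finset α := {p ∈ P | lam p + 1 ≤ t ∧ D p y} with hN
      have hNX : ∀ p ∈ N, p ∉ X := fun p hp hpX => by
        rw [hN, mem_filter] at hp
        exact hXY p hpX y hyY ⟨hp.2.2, Or.inr (Or.inr ⟨Finset.disjoint_left.1 h.hP hp.1,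
          hyl.1, Or.inr (Or.inr ⟨by omega, hyl.2⟩)⟩)⟩
      have := h.card_mul_le_slack (X := X) (filter_subset _ _)
        (fun p hp => (mem_filter.1 hp).2.1) hNX
      linarith
    · push Not at hGY
      have h3 : (#G : ℝ) ≤ #((P' ∩ layer A lam (t + 1)) \ Y) := by
        exact_mod_cast card_le_card fun y hy => mem_sdiff.2 ⟨hG hy, hGY y hy⟩
      linarith

lemma Lay.card_add_le (h : Lay D A P P' t lam w κ μ) {X Y : Finset α}
    (hXY : ∀ x ∈ X, ∀ y ∈ Y, ¬ Allowed D A P P' t lam x y)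
    : #X + #Y ≤ Fintype.card α := by
  have hs := h.symm
  have hs2 := h.symm_hXY hXY
  have hgoal : (#X : ℝ) + #Y ≤ Fintype.card α := by
    by_cases hXA : Disjoint X A
    · by_cases hYA : Disjoint Y A
      · by_cases hx : ∃ x ∈ X, x ∉ P ∧ lam x = 0
        · exact h.card_add_le_of_zero hXY hXA hYA hx
        by_cases hy : ∃ y ∈ Y, y ∉ P' ∧ lam y = t + 1
        · have := hs.card_add_le_of_zero hs2 hYA hXA (by
            obtain ⟨y, hy, hyP, hyl⟩ := hy
            exact ⟨y, hy, hyP, by omega⟩)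
          linarith
        push Not at hx hy
        have hx0 : ∀ x ∈ X, lam x = 0 → x ∈ P := fun x hxX h0 => by
          by_contra hc; exact hx x hxX hc h0
        have hy0 : ∀ y ∈ Y, lam y = t + 1 → y ∈ P' := fun y hyX h0 => by
          by_contra hc; exact hy y hyX hc h0
        by_cases hx1 : ∃ x ∈ X, x ∉ P ∧ lam x = t
        · exact h.card_add_le_of_last hXY hXA hYA hx0 hy0 hx1
        by_cases hy1 : ∃ y ∈ Y, y ∉ P' ∧ lam y = 1
        · have := hs.card_add_le_of_last hs2 hYA hXA
            (fun y hyY h0 => hy0 y hyY (by have := h.lam_le y; omega))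
            (fun x hxX h0 => hx0 x hxX (by omega)) (by
            obtain ⟨y, hy, hyP, hyl⟩ := hy1
            exact ⟨y, hy, hyP, by omega⟩)
          linarith
        push Not at hx1 hy1
        have hcore := h.card_add_core hXY hXA hYA hx0 hy0
        have e1 : (#(X ∩ layer A lam t) : ℝ) ≤ #(P ∩ layer A lam t) := by
          exact_mod_cast card_le_card fun v hv => by
            rw [mem_inter] at hv ⊢
            refine ⟨?_, hv.2⟩
            by_contra hc
            exact hx1 v hv.1 hc (mem_layer.1 hv.2).2
        have e2 : (#(Y ∩ layer A lam 1) : ℝ) ≤ #(P' ∩ layer A lam 1) := by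
          exact_mod_cast card_le_card fun v hv => by
            rw [mem_inter] at hv ⊢
            refine ⟨?_, hv.2⟩
            by_contra hc
            exact hy1 v hv.1 hc (mem_layer.1 hv.2).2
        have g0 : (0 : ℝ) ≤ #((P ∩ layer A lam 0) \ X) := by positivity
        have g1 : (0 : ℝ) ≤ #((P' ∩ layer A lam (t + 1)) \ Y) := by positivity
        have e7 := h.w_pos
        have gs : ∀ i ∈ range (t - 1), 0 ≤ min (w * #A / 2)
            (#((P ∩ layer A lam (i + 1)) \ X) : ℝ) := fun i _ => by positivity
        have gs' := sum_nonneg gs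
        linarith
      · have := hs.card_layer_of_C1 hs2 (not_disjoint_iff_nonempty_inter.1 hYA) hXA
        linarith
    · by_cases hYA : Disjoint Y A
      · exact h.card_layer_of_C1 hXY (not_disjoint_iff_nonempty_inter.1 hXA) hYA
      · exact h.card_add_le_of_both hXY (not_disjoint_iff_nonempty_inter.1 hXA)
          (not_disjoint_iff_nonempty_inter.1 hYA)
  exact_mod_cast hgoal

/-- Hall's theorem gives a permutation along allowed edges. -/
lemma Lay.exists_perm (h : Lay D A P P' t lam w κ μ)
    : ∃ π : Equiv.Perm α, ∀ x, Allowed D A P P' t lam x (π x) := by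
  classical
  have hall := (Finset.all_card_le_biUnion_card_iff_exists_injective
    (fun x => ({y | Allowed D A P P' t lam x y} : Finset α))).1 (by
    intro X
    have := h.card_add_le (X := X)
      (Y := univ \ X.biUnion fun x => ({y | Allowed D A P P' t lam x y} : Finset α)) (by
      intro x hx y hy hxy
      simp only [mem_sdiff, mem_univ, true_and, mem_biUnion, not_exists, not_and,
        mem_filter] at hy
      exact hy x hx hxy)
    rw [card_sdiff_of_subset (subset_univ _), card_univ] at this
    have h2 := card_le_univ (X.biUnion fun x => ({y | Allowed D A P P' t lam x y} : Finset α))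
    omega)
  obtain ⟨f, hf, hf2⟩ := hall
  exact ⟨Equiv.ofBijective f (Finite.injective_iff_bijective.1 hf), fun x => by
    simpa using hf2 x⟩

/-- Every cycle of a permutation along allowed edges meets `A`. -/
lemma Lay.exists_mem_sameCycle (h : Lay D A P P' t lam w κ μ)
    {π : Equiv.Perm α}
    (hπ : ∀ x, Allowed D A P P' t lam x (π x)) (x : α) : ∃ b ∈ A, π.SameCycle x b := by
  by_contra! hcon
  have hmono : ∀ i : ℕ, i ≤ lam ((π ^ i) x) := by
    intro i
    induction i with
    | zero => simp
    | succ i ih =>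
      have h1 : (π ^ i) x ∉ A := fun hA => hcon _ hA ⟨i, by simp⟩
      have h2 : (π ^ (i + 1)) x ∉ A := fun hA => hcon _ hA ⟨(i + 1 : ℕ), by rw [zpow_natCast]⟩
      have h3 := (hπ ((π ^ i) x)).2
      rw [pow_succ', Equiv.Perm.mul_apply] at h2 ⊢
      unfold LayerStep at h3
      have := h.t_pos
      rcases h3 with h3 | h3 | ⟨-, -, h3⟩
      · exact absurd h3.1 h1
      · exact absurd h3.2 h2
      · omega
  have h1 := hmono (t + 2)
  have h2 := h.lam_le ((π ^ (t + 2)) x)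
  omega

end Layering

section Merging

set_option linter.unusedSectionVars false

open Equiv

variable {α : Type*} [Fintype α] [DecidableEq α]

lemma sameCycle_of_forall_apply {π τ : Perm α} (h : ∀ x, τ.SameCycle x (π x)) {x y : α}
    (hxy : π.SameCycle x y) : τ.SameCycle x y := by
  obtain ⟨i, -, -, rfl⟩ := hxy.exists_pow_eq''
  clear hxy
  induction i with
  | zero => exact Perm.SameCycle.refl _ _
  | succ i ih =>
    rw [pow_succ', Perm.mul_apply]
    exact ih.trans (h _)

lemma sameCycle_mul_swap_mono {π : Perm α} {a b x y : α} (hab : ¬ π.SameCycle a b)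
    (hxy : π.SameCycle x y) : (π * swap a b).SameCycle x y := by
  refine sameCycle_of_forall_apply (fun z => ?_) hxy
  have h1 : (π * swap a b).SameCycle a b := sameCycle_mul_swap_of_right hab (Perm.SameCycle.refl _ _)
  have hstep : ∀ z, (π * swap a b).SameCycle z ((π * swap a b) z) := fun z =>
    Perm.sameCycle_apply_right.2 (Perm.SameCycle.refl _ _)
  rcases eq_or_ne z a with rfl | hza
  · have := hstep b
    rw [Perm.mul_apply, swap_apply_right] at this
    exact h1.trans this
  rcases eq_or_ne z b with rfl | hzb
  · have := hstep a
    rw [Perm.mul_apply, swap_apply_left] at this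
    exact h1.symm.trans this
  have := hstep z
  rwa [Perm.mul_apply, swap_apply_of_ne_of_ne hza hzb] at this

open Classical in
/-- Cycles of a one-factor that all meet `A` can be merged into a single cycle. -/
lemma exists_single_cycle {D : α → α → Prop} {A P' : Finset α} {π₀ : Perm α}
    (hD : ∀ x, D x (π₀ x)) (hA : ∀ a ∈ A, π₀ a ∈ P') (hc : ∀ x, ∃ b ∈ A, π₀.SameCycle x b)
    (hout : ∀ a ∈ A, 10 * #{y ∈ P' | ¬ D a y} < #A)
    (hin : ∀ y ∈ P', 10 * #{a ∈ A | ¬ D a y} ≤ 4 * #A) :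
    ∃ π : Perm α, (∀ x, D x (π x)) ∧ ∀ x y, π.SameCycle x y := by
  rcases isEmpty_or_nonempty α with hemp | ⟨⟨x0⟩⟩
  · exact ⟨π₀, fun x => hemp.elim x, fun x => hemp.elim x⟩
  obtain ⟨a0, ha0, -⟩ := hc x0
  let good : Finset (Perm α) := {π | (∀ x, D x (π x)) ∧ (∀ a ∈ A, π a ∈ P') ∧
    ∀ x, ∃ b ∈ A, π.SameCycle x b}
  obtain ⟨π, hπ, hmax⟩ := good.exists_max_image
    (fun π => #(({y | π.SameCycle a0 y} : Finset α))) ⟨π₀, by simp [good]; exact ⟨hD, hA, hc⟩⟩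
  simp only [good, mem_filter, mem_univ, true_and] at hπ hmax
  obtain ⟨h1, h2, h3⟩ := hπ
  refine ⟨π, h1, ?_⟩
  by_contra! hcon
  obtain ⟨x, y, hxy⟩ := hcon
  have hA2 : ∃ b ∈ A, ¬ π.SameCycle a0 b := by
    by_contra! hall
    obtain ⟨b, hb, hxb⟩ := h3 x
    obtain ⟨c, hc, hyc⟩ := h3 y
    exact hxy (hxb.trans ((hall b hb).symm.trans ((hall c hc).trans hyc.symm)))
  have hbad1 : ∀ a ∈ A, 10 * #{b ∈ A | ¬ D a (π b)} < #A := fun a ha => by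
    refine lt_of_le_of_lt ?_ (hout a ha)
    refine Nat.mul_le_mul_left _ (card_le_card_of_injOn π ?_ π.injective.injOn)
    intro b hb
    simp only [coe_filter, Set.mem_ofPred_eq] at hb ⊢
    exact ⟨h2 b hb.1, hb.2⟩
  have hbad2 : ∀ a ∈ A, 10 * #{b ∈ A | ¬ D b (π a)} ≤ 4 * #A := fun a ha => hin _ (h2 a ha)
  have hpick : ∀ S ⊆ A, #A ≤ 2 * #S → ∀ a ∈ A, ∃ b ∈ S, D a (π b) ∧ D b (π a) := by
    intro S hS hcard a ha
    by_contra! hno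
    have : S ⊆ {b ∈ A | ¬ D a (π b)} ∪ {b ∈ A | ¬ D b (π a)} := fun b hb => by
      simp only [mem_union, mem_filter]
      by_cases hb2 : D a (π b)
      · exact Or.inr ⟨hS hb, hno b hb hb2⟩
      · exact Or.inl ⟨hS hb, hb2⟩
    have h4 := (card_le_card this).trans (card_union_le _ _)
    have h5 := hbad1 a ha
    have h6 := hbad2 a ha
    omega
  have hpair : ∃ a ∈ A, ∃ b ∈ A, π.SameCycle a0 a ∧ ¬ π.SameCycle a0 b ∧
      D a (π b) ∧ D b (π a) := by
    have hsum := card_filter_add_card_filter_not (s := A) (fun b => π.SameCycle a0 b)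
    by_cases hhalf : #A ≤ 2 * #{b ∈ A | ¬ π.SameCycle a0 b}
    · obtain ⟨b, hb, hb'⟩ := hpick _ (filter_subset _ _) hhalf a0 ha0
      rw [mem_filter] at hb
      exact ⟨a0, ha0, b, hb.1, Perm.SameCycle.refl _ _, hb.2, hb'⟩
    · obtain ⟨b, hb, hb2⟩ := hA2
      obtain ⟨a, ha, ha'⟩ := hpick {b ∈ A | π.SameCycle a0 b} (filter_subset _ _) (by omega) b hb
      rw [mem_filter] at ha
      exact ⟨a, ha.1, b, hb, ha.2, hb2, ha'.2, ha'.1⟩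
  obtain ⟨a, ha, b, hb, hsa, hsb, hDab, hDba⟩ := hpair
  have hns : ¬ π.SameCycle a b := fun h => hsb (hsa.trans h)
  have hnew := hmax (π * swap a b) ⟨?_, ?_, ?_⟩
  · refine absurd hnew (not_le.2 (card_lt_card ?_))
    rw [Finset.ssubset_iff_of_subset]
    · refine ⟨b, ?_, ?_⟩
      · simp only [mem_filter, mem_univ, true_and]
        exact (sameCycle_mul_swap_mono hns hsa).trans
          (sameCycle_mul_swap_of_right hns (Perm.SameCycle.refl _ _))
      · simpa using hsb
    · intro z hz
      simp only [mem_filter, mem_univ, true_and] at hz ⊢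
      exact sameCycle_mul_swap_mono hns hz
  · intro z
    rcases eq_or_ne z a with rfl | hza
    · simpa using hDab
    rcases eq_or_ne z b with rfl | hzb
    · simpa using hDba
    rw [Perm.mul_apply, swap_apply_of_ne_of_ne hza hzb]
    exact h1 z
  · intro z hz
    rw [Perm.mul_apply]
    refine h2 _ ?_
    rcases eq_or_ne z a with rfl | hza
    · simpa using hb
    rcases eq_or_ne z b with rfl | hzb
    · simpa using ha
    rwa [swap_apply_of_ne_of_ne hza hzb]
  · intro z
    obtain ⟨c, hc, hzc⟩ := h3 z
    exact ⟨c, hc, sameCycle_mul_swap_mono hns hzc⟩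

open Classical in
/-- A layered digraph has a Hamilton cycle. -/
theorem Lay.exists_hamilton {D : α → α → Prop} {A P P' : Finset α} {t : ℕ} {lam : α → ℕ}
    {w κ μ : ℝ} (h : Lay D A P P' t lam w κ μ)
    (hin : ∀ y ∈ P', 10 * #{a ∈ A | ¬ D a y} ≤ 4 * #A) :
    ∃ π : Perm α, (∀ x, D x (π x)) ∧ ∀ x y, π.SameCycle x y := by
  obtain ⟨π, hπ⟩ := h.exists_perm
  refine exists_single_cycle (fun x => (hπ x).1) (fun a ha => ?_) (h.exists_mem_sameCycle hπ)
    (fun a ha => ?_) hin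
  · rcases (hπ a).2 with h2 | h2 | h2
    · exact h2.2
    · exact absurd ha (Finset.disjoint_left.1 h.hP h2.1)
    · exact absurd ha h2.1
  · have h1 := h.fwd.out_A a ha
    have h2 := h.μ_le
    have h3 : (0 : ℝ) < #A := by exact_mod_cast h.A_pos
    have : (10 * #{y ∈ P' | ¬ D a y} : ℝ) < #A := by linarith
    exact_mod_cast this

end Merging

section Spreading

set_option linter.unusedSectionVars false

variable {α : Type*} [Fintype α] [DecidableEq α]

/-- The colourings `J` and `q` (by columns and rows) distribute the set `S` evenly. -/
structure Spread (t : ℕ) (w z u : ℝ) (J q : α → ℕ) (S : Finset α) : Prop where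
  col : ∀ j, 1 ≤ j → j ≤ t → |(#{v ∈ S | J v = j} : ℝ) - w * #S| ≤ w * u
  row : ∀ r < 2, |(#{v ∈ S | q v = r} : ℝ) - z * #S| ≤ z * u
  cell : ∀ j, 1 ≤ j → j ≤ t → w * (#S - 7 * u) ≤ #{v ∈ S | J v = j ∧ 2 ≤ q v}

/-- Exchange the first two rows. -/
def flipRow (r : ℕ) : ℕ := if r = 0 then 1 else if r = 1 then 0 else r

lemma flipRow_eq_zero {r : ℕ} : flipRow r = 0 ↔ r = 1 := by
  unfold flipRow; split_ifs <;> simp_all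
lemma flipRow_eq_one {r : ℕ} : flipRow r = 1 ↔ r = 0 := by
  unfold flipRow; split_ifs <;> simp_all
lemma two_le_flipRow {r : ℕ} : 2 ≤ flipRow r ↔ 2 ≤ r := by unfold flipRow; split_ifs <;> omega

variable {t : ℕ} {w z u : ℝ} {J q : α → ℕ} {S : Finset α}

lemma Spread.symm (h : Spread t w z u J q S) (hJ : ∀ v, 1 ≤ J v ∧ J v ≤ t) :
    Spread t w z u (fun v => t + 1 - J v) (fun v => flipRow (q v)) S where
  col j h1 h2 := by
    have e : ∀ v, t + 1 - J v = j ↔ J v = t + 1 - j := fun v => by have := hJ v; omega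
    simp only [e]
    exact h.col _ (by omega) (by omega)
  row r hr := by
    interval_cases r
    · simp only [flipRow_eq_zero]
      exact h.row 1 (by omega)
    · simp only [flipRow_eq_one]
      exact h.row 0 (by omega)
  cell j h1 h2 := by
    have e : ∀ v, t + 1 - J v = j ↔ J v = t + 1 - j := fun v => by have := hJ v; omega
    simp only [e, two_le_flipRow]
    exact h.cell _ (by omega) (by omega)

/-- The layer function obtained from the colourings `J` and `q`. -/
def layerFn (P P' M M' : Finset α) (t : ℕ) (J q : α → ℕ) (v : α) : ℕ :=
  if q v = 0 ∧ v ∈ P then t + 1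
  else if q v = 1 ∧ v ∈ P' then 0
  else if J v = t ∧ v ∈ M then t - 1
  else if J v = 1 ∧ v ∈ M' then 2
  else J v

lemma layerFn_symm {P P' M M' : Finset α} (ht : 4 ≤ t) (hJ : ∀ v, 1 ≤ J v ∧ J v ≤ t) :
    (fun v => t + 1 - layerFn P P' M M' t J q v) =
      layerFn P' P M' M t (fun v => t + 1 - J v) (fun v => flipRow (q v)) := by
  funext v
  have h1 := hJ v
  have e1 : t + 1 - J v = t ↔ J v = 1 := by omega
  have e2 : t + 1 - J v = 1 ↔ J v = t := by omega
  simp only [layerFn, flipRow_eq_zero, flipRow_eq_one, e1, e2]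
  by_cases c1 : q v = 0 ∧ v ∈ P
  · rw [if_pos c1, if_neg (by omega), if_pos c1]
    omega
  by_cases c2 : q v = 1 ∧ v ∈ P'
  · rw [if_neg c1, if_pos c2, if_pos c2]
    omega
  rw [if_neg c1, if_neg c2, if_neg c2, if_neg c1]
  by_cases c3 : J v = t ∧ v ∈ M
  · rw [if_pos c3, if_neg (by omega), if_pos c3]
    omega
  by_cases c4 : J v = 1 ∧ v ∈ M'
  · rw [if_neg c3, if_pos c4, if_pos c4]
    omega
  rw [if_neg c3, if_neg c4, if_neg c4, if_neg c3]

open Classical in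
/-- The degree conditions concerning out-neighbourhoods for the uncoloured problem. -/
structure HalfDeg (D : α → α → Prop) (A P P' : Finset α) (μ : ℝ) : Prop where
  out_A : ∀ x ∈ A, (#{y ∈ P' | ¬ D x y} : ℝ) ≤ μ * Fintype.card α
  out_P : ∀ x ∈ P, (#A : ℝ) / 4 ≤ #{y ∈ A | D x y}
  out_W : ∀ x ∉ A, (Fintype.card α / 2 - μ * Fintype.card α : ℝ) ≤ #{y | D x y}
  out_C3 : ∀ x ∉ A, x ∉ P → ∀ y ∈ A, ¬ D x y
  disj : Disjoint P A
  card_P : (Fintype.card α / 2 - μ * Fintype.card α : ℝ) ≤ #P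

set_option maxHeartbeats 1000000 in
open Classical in
lemma HalfDeg.halfLay {D : α → α → Prop} {A P P' M M' : Finset α} {μ : ℝ}
    (h : HalfDeg D A P P' μ) (ht : 4 ≤ t) (hJ : ∀ v, 1 ≤ J v ∧ J v ≤ t)
    (hw : 0 < w) (hz : 0 < z) (hu : 0 < u)
    (hzm : z * Fintype.card α = 5 / 2 * u) (hwm : w * Fintype.card α = 40 * (z * u))
    (hwu : w * Fintype.card α ≤ u) (hau : 10000 * u ≤ #A) (hμ : μ * Fintype.card α ≤ u / 10)
    (hMc : (#M : ℝ) ≤ 100 * u)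
    (hMc' : (#M' : ℝ) ≤ 100 * u)
    (hMw : ∀ x ∉ A, x ∉ P → x ∉ M →
      2500 * u ≤ #{y ∈ P ∩ P' | D x y} ∨
      ∃ G ⊆ P ∩ P', (#A : ℝ) / 2 ≤ #G ∧ Spread t w z u J q G ∧
        ∀ y ∈ G, 25 * u ≤ #{p ∈ P | D p y})
    (s_univ : Spread t w z u J q univ) (s_W : Spread t w z u J q Aᶜ)
    (s_P : Spread t w z u J q P) (s_M : Spread t w z u J q M) (s_M' : Spread t w z u J q M')
    (s_outW : ∀ x, Spread t w z u J q {y ∈ Aᶜ | D x y})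
    (s_outP : ∀ x, Spread t w z u J q {y ∈ P | D x y})
    (s_outPP : ∀ x, Spread t w z u J q {y ∈ P ∩ P' | D x y}) :
    HalfLay D A P P' t (layerFn P P' M M' t J q) w (#A / 20) μ := by
  have hm0 : (0 : ℝ) < Fintype.card α := by
    have : (#A : ℝ) ≤ Fintype.card α := by exact_mod_cast card_le_univ A
    linarith
  have hwz : 0 < w * u := by positivity
  have hzu : 0 < z * u := by positivity
  have hwa : w * (10000 * u) ≤ w * #A := by gcongr
  have hza : z * (10000 * u) ≤ z * #A := by gcongr
  have hwμ : w * (μ * Fintype.card α) ≤ w * (u / 10) := by gcongr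
  have hM1 : ∀ j, 1 ≤ j → j ≤ t → (#{v ∈ M | J v = j} : ℝ) ≤ w * (101 * u) := fun j h1 h2 => by
    have := (abs_le.1 (s_M.col j h1 h2)).2
    nlinarith
  have hM1' : ∀ j, 1 ≤ j → j ≤ t → (#{v ∈ M' | J v = j} : ℝ) ≤ w * (101 * u) :=
    fun j h1 h2 => by
    have := (abs_le.1 (s_M'.col j h1 h2)).2
    nlinarith
  have hrow : ∀ r < 2, (#({v | q v = r} : Finset α) : ℝ) ≤ 5 / 2 * u + z * u := fun r hr => by
    have := (abs_le.1 (s_univ.row r hr)).2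
    rw [card_univ] at this
    linarith
  have hz1 : z ≤ 1 := by
    have : (#A : ℝ) ≤ Fintype.card α := by exact_mod_cast card_le_univ A
    nlinarith
  have hzu1 : z * u ≤ u := by nlinarith
  have hcell : ∀ S : Finset α, Disjoint S A → Spread t w z u J q S → ∀ j, 1 ≤ j → j ≤ t →
      w * (#S - 209 * u) ≤ #(S ∩ layer A (layerFn P P' M M' t J q) j) := by
    intro S hSA hS j h1 h2
    have e1 := hS.cell j h1 h2
    have e2 : #{v ∈ S | J v = j ∧ 2 ≤ q v} ≤ #(S ∩ layer A (layerFn P P' M M' t J q) j) +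
        #{v ∈ M | J v = j} + #{v ∈ M' | J v = j} := by
      refine le_trans (card_le_card ?_) ((card_union_le _ _).trans
        (Nat.add_le_add_right (card_union_le _ _) _))
      intro v hv
      simp only [mem_filter, mem_union, mem_inter, mem_layer] at hv ⊢
      have hvA := Finset.disjoint_left.1 hSA hv.1
      by_cases hvM : v ∈ M
      · exact Or.inl (Or.inr ⟨hvM, hv.2.1⟩)
      by_cases hvM' : v ∈ M'
      · exact Or.inr ⟨hvM', hv.2.1⟩
      refine Or.inl (Or.inl ⟨hv.1, hvA, ?_⟩)
      unfold layerFn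
      rw [if_neg (by omega), if_neg (by omega), if_neg (by tauto), if_neg (by tauto)]
      exact hv.2.1
    have e2' : (#{v ∈ S | J v = j ∧ 2 ≤ q v} : ℝ) ≤
      #(S ∩ layer A (layerFn P P' M M' t J q) j) + #{v ∈ M | J v = j} + #{v ∈ M' | J v = j} := by
      exact_mod_cast e2
    have := hM1 j h1 h2
    have := hM1' j h1 h2
    nlinarith
  have hWc : ((#Aᶜ : ℕ) : ℝ) = Fintype.card α - #A := by
    rw [card_compl, Nat.cast_sub (card_le_univ A)]
  have hJlast : ∀ v, layerFn P P' M M' t J q v = t + 1 ↔ q v = 0 ∧ v ∈ P := by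
    intro v
    have := hJ v
    unfold layerFn
    split_ifs with h1 h2 h3 h4 <;> first | (simp [h1]; done) | (simp only [h1, iff_false]; omega)
  have hlast : ∀ S ⊆ P, S ∩ layer A (layerFn P P' M M' t J q) (t + 1) = {v ∈ S | q v = 0} := by
    intro S hS
    ext v
    simp only [mem_inter, mem_layer, mem_filter, hJlast]
    constructor
    · rintro ⟨h1, -, h2, -⟩
      exact ⟨h1, h2⟩
    · rintro ⟨h1, h2⟩
      exact ⟨h1, Finset.disjoint_left.1 h.disj (hS h1), h2, hS h1⟩
  have houtW : ∀ x ∉ A, (Fintype.card α / 2 - μ * Fintype.card α - #A : ℝ) ≤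
      #{y ∈ Aᶜ | D x y} := by
    intro x hx
    have e1 := h.out_W x hx
    have e2 : #{y | D x y} ≤ #{y ∈ Aᶜ | D x y} + #A := by
      refine le_trans (card_le_card ?_) (card_union_le _ _)
      intro v hv
      simp only [mem_filter, mem_univ, true_and, mem_union, mem_compl] at hv ⊢
      tauto
    have e2' : (#{y | D x y} : ℝ) ≤ #{y ∈ Aᶜ | D x y} + #A := by exact_mod_cast e2
    linarith
  have houtC3 : ∀ x ∉ A, x ∉ P → (Fintype.card α / 2 - μ * Fintype.card α : ℝ) ≤
      #{y ∈ Aᶜ | D x y} := by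
    intro x hx hxP
    refine (h.out_W x hx).trans ?_
    exact_mod_cast card_le_card fun v hv => by
      simp only [mem_filter, mem_univ, true_and, mem_compl] at hv ⊢
      exact ⟨fun hvA => h.out_C3 x hx hxP v hvA hv, hv⟩
  have hfl : ∀ (x : α) j, {y ∈ layer A (layerFn P P' M M' t J q) j | D x y} =
      ({y ∈ Aᶜ | D x y} : Finset α) ∩ layer A (layerFn P P' M M' t J q) j := by
    intro x j
    ext v
    simp only [mem_filter, mem_inter, mem_layer, mem_compl]
    tauto
  have hdW : ∀ x, Disjoint ({y ∈ Aᶜ | D x y} : Finset α) A := fun x =>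
    disjoint_compl_left.mono_left (filter_subset _ _)
  refine ⟨h.out_A, h.out_P, ?_, ?_, ?_, ?_, ?_, ?_, ?_, ?_, ?_⟩
  · intro v _ hv
    exact ((hJlast v).1 hv).2
  · intro j h1 h2
    have e1 : #(layer A (layerFn P P' M M' t J q) j) ≤ #{v ∈ Aᶜ | J v = j} +
        #{v ∈ M | J v = t} + #{v ∈ M' | J v = 1} := by
      refine le_trans (card_le_card ?_) ((card_union_le _ _).trans
        (Nat.add_le_add_right (card_union_le _ _) _))
      intro v hv
      simp only [mem_filter, mem_union, mem_layer, mem_compl] at hv ⊢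
      obtain ⟨hvA, hv⟩ := hv
      unfold layerFn at hv
      split_ifs at hv with h3 h4 h5 h6
      · omega
      · omega
      · exact Or.inl (Or.inr ⟨h5.2, h5.1⟩)
      · exact Or.inr ⟨h6.2, h6.1⟩
      · exact Or.inl (Or.inl ⟨hvA, hv⟩)
    have e1' : (#(layer A (layerFn P P' M M' t J q) j) : ℝ) ≤ #{v ∈ Aᶜ | J v = j} +
        #{v ∈ M | J v = t} + #{v ∈ M' | J v = 1} := by exact_mod_cast e1
    have e2 := (abs_le.1 (s_W.col j h1 h2)).2
    rw [hWc] at e2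
    have e3 := hM1 t (by omega) le_rfl
    have e4 := hM1' 1 le_rfl (by omega)
    nlinarith
  · intro j h1 h2
    have e1 := hcell P h.disj s_P j h1 h2
    have e2 := h.card_P
    nlinarith
  · have : (#(layer A (layerFn P P' M M' t J q) (t + 1)) : ℝ) ≤ #({v | q v = 0} : Finset α) := by
      exact_mod_cast card_le_card fun v hv => by
        simp only [mem_layer, hJlast] at hv
        simpa using hv.2.1
    have := hrow 0 (by omega)
    linarith
  · intro x hx hxP j h1 h2
    rw [hfl]
    have e1 := hcell _ (hdW x) (s_outW x) j h1 h2
    have e2 := houtC3 x hx hxP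
    nlinarith
  · intro x hx j h1 h2
    rw [hfl]
    have e1 := hcell _ (hdW x) (s_outW x) j h1 h2
    have e2 := houtW x hx
    nlinarith
  · intro x hx hxP
    have e0 : {y ∈ layer A (layerFn P P' M M' t J q) (t + 1) | D x y} =
        ({v ∈ ({y ∈ P | D x y} : Finset α) | q v = 0} : Finset α) := by
      rw [← hlast _ (filter_subset _ _)]
      ext v
      simp only [mem_filter, mem_inter, mem_layer, hJlast]
      tauto
    rw [e0]
    have e1 := (abs_le.1 ((s_outP x).row 0 (by omega))).1
    have e2 := houtC3 x hx hxP
    have e3 : #{y ∈ Aᶜ | D x y} + (#P + #A) ≤ #{y ∈ P | D x y} + Fintype.card α := by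
      rw [← card_union_of_disjoint h.disj, ← card_univ,
        ← card_union_add_card_inter ({y ∈ Aᶜ | D x y} : Finset α) (P ∪ A), add_comm]
      refine Nat.add_le_add (card_le_card fun v hv => ?_) (card_le_univ _)
      simp only [mem_inter, mem_filter, mem_compl, mem_union] at hv ⊢
      tauto
    have e3' : (#{y ∈ Aᶜ | D x y} + (#P + #A) : ℝ) ≤ #{y ∈ P | D x y} + Fintype.card α := by
      exact_mod_cast e3
    have e4 := h.card_P
    have e5 : (9998 * u : ℝ) ≤ #{y ∈ P | D x y} := by linarith
    have e6 : z * (9998 * u) ≤ z * #{y ∈ P | D x y} := by gcongr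
    nlinarith
  · intro x hx hxP hl0
    have e2 := houtC3 x hx hxP
    have e3 : #{y ∈ Aᶜ | D x y} ≤ #{y | y ∉ A ∧ 1 ≤ layerFn P P' M M' t J q y ∧ D x y} +
        #({v | q v = 1} : Finset α) := by
      refine le_trans (card_le_card ?_) (card_union_le _ _)
      intro v hv
      simp only [mem_filter, mem_univ, true_and, mem_union, mem_compl] at hv ⊢
      by_cases hq : q v = 1
      · exact Or.inr hq
      · refine Or.inl ⟨hv.1, ?_, hv.2⟩
        have := hJ v
        unfold layerFn
        split_ifs <;> omega
    have e3' : (#{y ∈ Aᶜ | D x y} : ℝ) ≤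
        #{y | y ∉ A ∧ 1 ≤ layerFn P P' M M' t J q y ∧ D x y} +
        #({v | q v = 1} : Finset α) := by exact_mod_cast e3
    have := hrow 1 (by omega)
    linarith
  · intro x hx hxP hlt
    have hxM : x ∉ M := by
      intro hxM
      have := hJ x
      unfold layerFn at hlt
      split_ifs at hlt with h1 h2 h3 h4
      · omega
      · omega
      · omega
      · omega
      · exact h3 ⟨hlt, hxM⟩
    have hPP : P' ∩ layer A (layerFn P P' M M' t J q) (t + 1) =
        {v ∈ P ∩ P' | q v = 0} := by
      rw [← hlast _ inter_subset_left]
      ext v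
      simp only [mem_inter, mem_layer, hJlast]
      tauto
    rw [hPP]
    rcases hMw x hx hxP hxM with h1 | ⟨G, hG, hGc, sG, hGd⟩
    · left
      have e1 := (abs_le.1 ((s_outPP x).row 0 (by omega))).1
      have e2 : ({y ∈ ({v ∈ P ∩ P' | q v = 0} : Finset α) | D x y} : Finset α) =
          {v ∈ ({y ∈ P ∩ P' | D x y} : Finset α) | q v = 0} := filter_comm _ _ _
      rw [e2]
      have e6 : z * (2500 * u) ≤ z * #{y ∈ P ∩ P' | D x y} := by gcongr
      nlinarith
    · right
      refine ⟨{v ∈ G | q v = 0}, filter_subset_filter _ hG, ?_, ?_⟩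
      · have e1 := (abs_le.1 (sG.row 0 (by omega))).1
        have e6 : z * (#A / 2) ≤ z * #G := by gcongr
        nlinarith
      · intro y hy
        rw [mem_filter] at hy
        have e1 := hGd y hy.1
        have e2 : #{p ∈ P | D p y} ≤
            #{p ∈ P | layerFn P P' M M' t J q p + 1 ≤ t ∧ D p y} +
            #({v | q v = 0} : Finset α) + #({v | J v = t} : Finset α) := by
          refine le_trans (card_le_card ?_) ((card_union_le _ _).trans
            (Nat.add_le_add_right (card_union_le _ _) _))
          intro v hv
          simp only [mem_filter, mem_union, mem_univ, true_and] at hv ⊢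
          by_cases hq : q v = 0
          · exact Or.inl (Or.inr hq)
          by_cases hjt : J v = t
          · exact Or.inr hjt
          refine Or.inl (Or.inl ⟨hv.1, ?_, hv.2⟩)
          have := hJ v
          unfold layerFn
          split_ifs <;> omega
        have e2' : (#{p ∈ P | D p y} : ℝ) ≤
            #{p ∈ P | layerFn P P' M M' t J q p + 1 ≤ t ∧ D p y} +
            #({v | q v = 0} : Finset α) + #({v | J v = t} : Finset α) := by exact_mod_cast e2
        have e3 := hrow 0 (by omega)
        have e4 := (abs_le.1 (s_univ.col t (by omega) le_rfl)).2
        rw [card_univ] at e4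
        have hw1 : w ≤ 1 := by nlinarith
        have hwu1 : w * u ≤ u := by nlinarith
        have e5 : 10 * u ≤ #{p ∈ P | layerFn P P' M M' t J q p + 1 ≤ t ∧ D p y} := by linarith
        have e6 : 1000 * z ≤ (#A : ℝ) / (4 * Fintype.card α) := by
          rw [le_div_iff₀ (by positivity)]
          nlinarith
        calc 6 * (w * Fintype.card α) ≤ 1000 * z * (10 * u) := by rw [hwm]; nlinarith
          _ ≤ _ := by gcongr

end Spreading

section Colouring
set_option linter.unusedSectionVars false
variable {α : Type*} [Fintype α] [DecidableEq α]

lemma exists_equal_colouring (m N : ℕ) (hN : 0 < N) :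
    ∃ b : Fin m → ℕ, (∀ v, b v < N) ∧ ∀ j < N, |(#{v | b v = j} : ℝ) - m / N| ≤ 1 := by
  refine ⟨fun v => v % N, fun v => Nat.mod_lt _ hN, fun j hj => ?_⟩
  have e : #{v : Fin m | (v : ℕ) % N = j} = Nat.count (· ≡ j [MOD N]) m := by
    rw [Nat.count_eq_card_filter_range, card_filter, card_filter,
      Fin.sum_univ_eq_sum_range (fun v => if v % N = j then 1 else 0)]
    refine sum_congr rfl fun v _ => ?_
    simp only [Nat.ModEq, Nat.mod_eq_of_lt hj]
  have hN' : (0 : ℝ) < N := by exact_mod_cast hN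
  have hm : (N : ℝ) * (m / N : ℕ) + (m % N : ℕ) = m := by exact_mod_cast Nat.div_add_mod m N
  have hr : ((m % N : ℕ) : ℝ) < N := by exact_mod_cast Nat.mod_lt _ hN
  have hr0 : (0 : ℝ) ≤ (m % N : ℕ) := by positivity
  have h1 : ((m / N : ℕ) : ℝ) ≤ m / N := Nat.cast_div_le
  have h2 : (m : ℝ) / N ≤ (m / N : ℕ) + 1 := by
    rw [div_le_iff₀ hN']; nlinarith
  rw [e, Nat.count_modEq_card _ hN]
  push_cast
  split_ifs <;> rw [abs_le] <;> constructor <;> linarith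

lemma exists_uniform_colouring {ι : Type*} [Fintype ι] (F : ι → Finset α) (N : ℕ) (hN : 0 < N)
    {η : ℝ} (hη : 0 < η)
    (hcard : 3 * (Fintype.card ι * N : ℝ) < η ^ 4 * (Fintype.card α : ℝ) ^ 2) :
    ∃ c : α → ℕ, (∀ v, c v < N) ∧ ∀ i, ∀ j < N,
      |(#{v ∈ F i | c v = j} : ℝ) - #(F i) / N| ≤ η * Fintype.card α + 1 := by
  obtain ⟨b, hb, hbj⟩ := exists_equal_colouring (Fintype.card α) N hN
  let ρ := Fintype.equivFin α
  obtain ⟨σ, hσ⟩ := exists_perm_abs_permDev_le (ι := ι × Fin N)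
    (fun i x y => if x ∈ F i.1 ∧ b (ρ y) = i.2 then (1 : ℝ) else 0)
    (fun i x y => by split_ifs <;> simp) (fun i x y => by split_ifs <;> simp) hη
    (by simpa using hcard)
  refine ⟨fun v => b (ρ (σ v)), fun v => hb _, fun i j hj => ?_⟩
  have h1 := hσ (i, ⟨j, hj⟩)
  unfold permDev at h1
  have e1 : ∑ a, (if a ∈ F i ∧ b (ρ (σ a)) = j then (1 : ℝ) else 0) =
      #{v ∈ F i | b (ρ (σ v)) = j} := by
    rw [sum_boole]
    congr 2
    ext v; simp
  have e2 : ∑ a, ∑ y, (if a ∈ F i ∧ b (ρ y) = j then (1 : ℝ) else 0) =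
      #(F i) * #{v | b v = j} := by
    have : ∀ a, ∑ y, (if a ∈ F i ∧ b (ρ y) = j then (1 : ℝ) else 0) =
        if a ∈ F i then (#{v | b v = j} : ℝ) else 0 := fun a => by
      split_ifs with h
      · simp only [h, true_and]
        rw [Equiv.sum_comp ρ (fun v => if b v = j then (1 : ℝ) else 0), sum_boole]
      · simp [h]
    simp only [this]
    rw [sum_ite_mem, univ_inter, sum_const, nsmul_eq_mul]
  simp only [e1, e2] at h1
  rcases Nat.eq_zero_or_pos (Fintype.card α) with h0 | hm
  · have : F i = ∅ := card_eq_zero.1 (Nat.le_zero.1 (h0 ▸ card_le_univ (F i)))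
    simp [this, h0]
  have hm' : (0 : ℝ) < Fintype.card α := by exact_mod_cast hm
  have hN' : (0 : ℝ) < N := by exact_mod_cast hN
  have hFm : (#(F i) : ℝ) ≤ Fintype.card α := by exact_mod_cast card_le_univ (F i)
  have h2 : |(#(F i) : ℝ) * #{v | b v = j} / Fintype.card α - #(F i) / N| ≤ 1 := by
    have : (#(F i) : ℝ) * #{v | b v = j} / Fintype.card α - #(F i) / N =
      #(F i) / Fintype.card α * (#{v | b v = j} - Fintype.card α / N) := by
      field_simp
    rw [this, abs_mul, abs_of_nonneg (by positivity)]
    have h3 : (#(F i) : ℝ) / Fintype.card α ≤ 1 := by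
      rw [div_le_one hm']; exact hFm
    exact mul_le_one₀ h3 (abs_nonneg _) (hbj j hj)
  calc |(#{v ∈ F i | b (ρ (σ v)) = j} : ℝ) - #(F i) / N| ≤ _ := abs_sub_le _ _ _
    _ ≤ _ := add_le_add h1 h2

lemma spread_of_colouring {c : α → ℕ} {t s : ℕ} {β u : ℝ} (ht : 0 < t) (hs : 2 ≤ s)
    {S : Finset α}
    (hc : ∀ j < t * s, |(#{v ∈ S | c v = j} : ℝ) - #S / (t * s : ℕ)| ≤ β)
    (hcl : ∀ v, c v < t * s)
    (hβ : t * s * β ≤ u) (hS : (2 / s : ℝ) * #S ≤ 6 * u) :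
    Spread t (1 / t) (1 / s) u (fun v => c v % t + 1) (fun v => c v / t) S := by
  have ht' : (0 : ℝ) < t := by exact_mod_cast ht
  have hs' : (0 : ℝ) < s := by exact_mod_cast (by omega : 0 < s)
  have key : ∀ (S' : Finset α) (T : Finset ℕ), T ⊆ range (t * s) →
      S' = {v ∈ S | c v ∈ T} → |(#S' : ℝ) - #T * (#S / (t * s))| ≤ #T * β := by
    intro S' T hT hS'
    have e : (#S' : ℝ) = ∑ j ∈ T, (#{v ∈ S | c v = j} : ℝ) := by
      rw [hS']
      have := card_eq_sum_card_fiberwise (s := {v ∈ S | c v ∈ T}) (t := T) (f := c)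
        (fun v hv => by simpa using (mem_filter.1 hv).2)
      rw [this]
      push_cast
      refine sum_congr rfl fun j hj => ?_
      congr 2
      ext v
      simp only [mem_filter]
      constructor
      · rintro ⟨⟨h1, -⟩, h3⟩
        exact ⟨h1, h3⟩
      · rintro ⟨h1, h3⟩
        exact ⟨⟨h1, h3 ▸ hj⟩, h3⟩
    have e2 : (#T : ℝ) * (#S / (t * s)) = ∑ j ∈ T, (#S / (t * s : ℕ) : ℝ) := by
      rw [sum_const, nsmul_eq_mul]; push_cast; rfl
    rw [e, e2, ← sum_sub_distrib, ← nsmul_eq_mul, ← sum_const]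
    exact (abs_sum_le_sum_abs _ _).trans
      (sum_le_sum fun j hj => hc j (mem_range.1 (hT hj)))
  have inj : ∀ i, Function.Injective (fun r : ℕ => i + t * r) := fun i a b h => by
    simpa [ht.ne'] using h
  have hle : ∀ i < t, ∀ r < s, i + t * r < t * s := fun i hi r hr => by
    calc i + t * r < t * (r + 1) := by rw [mul_add]; omega
      _ ≤ t * s := Nat.mul_le_mul_left _ hr
  have hdiv : ∀ i < t, ∀ r, (i + t * r) / t = r := fun i hi r => by
    rw [Nat.add_mul_div_left _ _ ht, Nat.div_eq_of_lt hi, zero_add]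
  have hmod : ∀ i < t, ∀ r, (i + t * r) % t = i := fun i hi r => by
    rw [Nat.add_mul_mod_self_left, Nat.mod_eq_of_lt hi]
  have hcs : ∀ v, c v / t < s := fun v => Nat.div_lt_of_lt_mul (hcl v)
  have hdm : ∀ v, c v % t + t * (c v / t) = c v := fun v => Nat.mod_add_div _ _
  refine ⟨?_, ?_, ?_⟩
  · intro j h1 h2
    have := key {v ∈ S | c v % t + 1 = j} ((range s).image fun r => (j - 1) + t * r) ?_ ?_
    · rw [card_image_of_injective _ (inj _), card_range] at this
      have e : (1 / t : ℝ) * #S = s * (#S / (t * s)) := by field_simp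
      rw [e]
      refine this.trans ?_
      rw [one_div, inv_mul_eq_div, le_div_iff₀ ht']
      linarith
    · intro x hx
      simp only [mem_image, mem_range] at hx ⊢
      obtain ⟨r, hr, rfl⟩ := hx
      exact hle _ (by omega) _ hr
    · ext v
      simp only [mem_filter, mem_image, mem_range, and_congr_right_iff]
      refine fun _ => ⟨fun h => ⟨c v / t, hcs v, ?_⟩, ?_⟩
      · have := hdm v; omega
      · rintro ⟨r, hr, h⟩
        rw [← h, hmod _ (by omega)]
        omega
  · intro r hr
    have := key {v ∈ S | c v / t = r} ((range t).image fun i => t * r + i) ?_ ?_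
    · rw [card_image_of_injective _ (fun a b h => by simpa using h), card_range] at this
      have e : (1 / s : ℝ) * #S = t * (#S / (t * s)) := by field_simp
      rw [e]
      refine this.trans ?_
      rw [one_div, inv_mul_eq_div, le_div_iff₀ hs']
      linarith
    · intro x hx
      simp only [mem_image, mem_range] at hx ⊢
      obtain ⟨i, hi, rfl⟩ := hx
      rw [add_comm]
      exact hle _ hi _ (by omega)
    · ext v
      simp only [mem_filter, mem_image, mem_range, and_congr_right_iff]
      refine fun _ => ⟨fun h => ⟨c v % t, Nat.mod_lt _ ht, ?_⟩, ?_⟩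
      · have := hdm v; rw [h] at this; omega
      · rintro ⟨i, hi, h⟩
        rw [← h, add_comm, hdiv _ hi]
  · intro j h1 h2
    have := key {v ∈ S | c v % t + 1 = j ∧ 2 ≤ c v / t}
      ((Ico 2 s).image fun r => (j - 1) + t * r) ?_ ?_
    · rw [card_image_of_injective _ (inj _), Nat.card_Ico, Nat.cast_sub hs] at this
      have h3 := (abs_le.1 this).1
      have hβ0 : 0 ≤ β := (abs_nonneg _).trans (hc 0 (by positivity))
      rw [one_div, inv_mul_eq_div, div_le_iff₀ ht']
      have e : ((s : ℝ) - 2) * (#S / (t * s)) * t = #S - 2 / s * #S := by field_simp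
      push_cast at h3
      have h4 : -(((s : ℝ) - 2) * β) * t ≤
        (#{v ∈ S | c v % t + 1 = j ∧ 2 ≤ c v / t} - ((s : ℝ) - 2) * (#S / (t * s))) * t := by
        gcongr
      nlinarith [mul_nonneg ht'.le hβ0]
    · intro x hx
      simp only [mem_image, mem_range, mem_Ico] at hx ⊢
      obtain ⟨r, hr, rfl⟩ := hx
      exact hle _ (by omega) _ hr.2
    · ext v
      simp only [mem_filter, mem_image, mem_Ico, and_congr_right_iff]
      refine fun _ => ⟨fun h => ⟨c v / t, ⟨h.2, hcs v⟩, ?_⟩, ?_⟩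
      · have := hdm v; omega
      · rintro ⟨r, hr, h⟩
        rw [← h, hmod _ (by omega), hdiv _ (by omega)]
        omega
end Colouring

section Spreading

set_option linter.unusedSectionVars false

lemma exists_spread (E K : ℕ) (hE : 1 ≤ E) : ∃ m₀ : ℕ, 1 ≤ m₀ ∧ ∀ (α : Type) [Fintype α]
    [DecidableEq α], m₀ ≤ Fintype.card α → ∀ F : Fin K → α → Finset α,
    ∃ J q : α → ℕ, (∀ v, 1 ≤ J v ∧ J v ≤ 1000000 * E ^ 2) ∧ ∀ i x,
      Spread (1000000 * E ^ 2) (1 / (1000000 * E ^ 2 : ℕ)) (1 / (4000 * E : ℕ))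
        (Fintype.card α / (10000 * E)) J q (F i x) := by
  set t := 1000000 * E ^ 2 with ht
  set s := 4000 * E with hs
  set N := t * s with hN
  have hE' : (1 : ℝ) ≤ E := by exact_mod_cast hE
  have ht0 : 0 < t := by positivity
  have hs0 : 0 < s := by positivity
  have hN0 : 0 < N := by positivity
  have hN' : (0 : ℝ) < N := by exact_mod_cast hN0
  set η : ℝ := 1 / (20000 * E * N) with hη
  have hη0 : 0 < η := by positivity
  obtain ⟨m₁, hm₁⟩ := exists_nat_gt (3 * (K * N : ℝ) / η ^ 4)
  refine ⟨m₁ + 20000 * E * N + 1, by omega, fun α _ _ hm F => ?_⟩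
  have hm' : (m₁ + 20000 * E * N + 1 : ℝ) ≤ Fintype.card α := by exact_mod_cast hm
  have hmp : (0 : ℝ) < Fintype.card α := by
    have : (0 : ℝ) ≤ m₁ + 20000 * E * N := by positivity
    linarith
  have hc : 3 * (Fintype.card (Fin K × α) * N : ℝ) < η ^ 4 * (Fintype.card α : ℝ) ^ 2 := by
    rw [div_lt_iff₀ (by positivity)] at hm₁
    have h1 : 3 * (K * N : ℝ) < η ^ 4 * Fintype.card α := by
      refine hm₁.trans_le ?_
      rw [mul_comm]
      gcongr
      omega
    simp only [Fintype.card_prod, Fintype.card_fin]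
    push_cast
    nlinarith
  obtain ⟨c, hcN, hcF⟩ := exists_uniform_colouring (fun i : Fin K × α => F i.1 i.2) N hN0 hη0 hc
  refine ⟨fun v => c v % t + 1, fun v => c v / t, fun v => ⟨Nat.le_add_left _ _, Nat.mod_lt _ ht0⟩,
    fun i x => ?_⟩
  refine spread_of_colouring ht0 (by omega) (hcF (i, x)) hcN ?_ ?_
  · have e1 : (t * s : ℝ) = N := by rw [hN]; push_cast; ring
    have e2 : (N : ℝ) * (η * Fintype.card α) = Fintype.card α / (20000 * E) := by
      rw [hη]; field_simp
    have e3 : (N : ℝ) ≤ Fintype.card α / (20000 * E) := by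
      rw [le_div_iff₀ (by positivity)]
      have : (0 : ℝ) ≤ m₁ := by positivity
      nlinarith
    have e4 : (Fintype.card α : ℝ) / (10000 * E) = 2 * (Fintype.card α / (20000 * E)) := by
      field_simp; norm_num
    rw [e1, mul_add, e2, e4]
    linarith
  · have h1 : (#(F i x) : ℝ) ≤ Fintype.card α := by exact_mod_cast card_le_univ _
    have e5 : (2 / s : ℝ) * Fintype.card α = 5 * (Fintype.card α / (10000 * E)) := by
      rw [hs]; push_cast; field_simp; norm_num
    have e6 : (2 / s : ℝ) * #(F i x) ≤ (2 / s : ℝ) * Fintype.card α := by gcongr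
    have : (0 : ℝ) ≤ Fintype.card α / (10000 * E) := by positivity
    linarith

variable {α : Type} [Fintype α] [DecidableEq α]

open Classical in
lemma HalfDeg.exists_good {D : α → α → Prop} {A P P' : Finset α} {μ u : ℝ}
    (h : HalfDeg D A P P' μ) (h' : HalfDeg (fun x y => D y x) A P' P μ)
    (hcard : #P + #P' = Fintype.card α) (hu : 0 < u) (hau : 10000 * u ≤ #A)
    (hμ : μ * Fintype.card α ≤ u / 10)
    (hbig : (100 * u : ℝ) < #{x | x ∉ A ∧ x ∉ P ∧ (#{y ∈ P ∩ P' | D x y} : ℝ) < 2500 * u}) :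
    (#A : ℝ) / 2 ≤ #{y ∈ P ∩ P' | 25 * u ≤ (#{p ∈ P | D p y} : ℝ)} := by
  set T : Finset α := {x | x ∉ A ∧ x ∉ P ∧ (#{y ∈ P ∩ P' | D x y} : ℝ) < 2500 * u} with hT
  set B : Finset α := {y ∈ P ∩ P' | ¬ 25 * u ≤ (#{p ∈ P | D p y} : ℝ)} with hB
  have h1 : ∀ y ∈ B, (#T : ℝ) / 2 ≤ #{x ∈ T | D x y} := by
    intro y hy
    rw [hB, mem_filter, mem_inter, not_le] at hy
    have e1 := h'.out_W y (Finset.disjoint_left.1 h'.disj hy.1.2)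
    set X : Finset α := {x | D x y ∧ x ∉ A ∧ x ∉ P} with hX
    have e2 : #{x | D x y} ≤ #A + #{p ∈ P | D p y} + #X := by
      refine le_trans (card_le_card ?_) ((card_union_le _ _).trans
        (Nat.add_le_add_right (card_union_le _ _) _))
      intro v hv
      simp only [hX, mem_filter, mem_union, mem_univ, true_and] at hv ⊢
      tauto
    have e3 : #T + #X ≤ #{x ∈ T | D x y} + (A ∪ P)ᶜ.card := by
      rw [← card_union_add_card_inter, add_comm]
      refine Nat.add_le_add (card_le_card fun v hv => ?_) (card_le_card fun v hv => ?_)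
      · simp only [hX, mem_filter, mem_inter, mem_univ, true_and] at hv ⊢
        tauto
      · simp only [hX, hT, mem_filter, mem_union, mem_univ, true_and, mem_compl] at hv ⊢
        tauto
    have e4 : (A ∪ P)ᶜ.card + (#A + #P) = Fintype.card α := by
      rw [← card_union_of_disjoint h.disj.symm, card_compl_add_card]
    have e2' : (#{x | D x y} : ℝ) ≤ #A + #{p ∈ P | D p y} + #X := by exact_mod_cast e2
    have e3' : (#T + #X : ℝ) ≤ #{x ∈ T | D x y} + (A ∪ P)ᶜ.card := by exact_mod_cast e3
    have e4' : ((A ∪ P)ᶜ.card + (#A + #P) : ℝ) = Fintype.card α := by exact_mod_cast e4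
    have := h.card_P
    linarith [hy.2]
  have h2 : (#B : ℝ) * (#T / 2) ≤ #T * (2500 * u) := by
    calc (#B : ℝ) * (#T / 2) = ∑ y ∈ B, (#T / 2 : ℝ) := by rw [sum_const, nsmul_eq_mul]
      _ ≤ ∑ y ∈ B, (#{x ∈ T | D x y} : ℝ) := sum_le_sum h1
      _ = ∑ x ∈ T, (#{y ∈ B | D x y} : ℝ) := by
        exact_mod_cast (sum_card_bipartiteAbove_eq_sum_card_bipartiteBelow D).symm
      _ ≤ ∑ x ∈ T, 2500 * u := by
        refine sum_le_sum fun x hx => ?_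
        rw [hT, mem_filter] at hx
        refine le_trans ?_ hx.2.2.2.le
        exact_mod_cast card_le_card (filter_subset_filter _ (filter_subset _ _))
      _ = _ := by rw [sum_const, nsmul_eq_mul]
  have hT0 : (0 : ℝ) < #T := by linarith
  have h3 : (#B : ℝ) ≤ 5000 * u := by nlinarith
  have h4 : #A ≤ #(P ∩ P') := by
    have e1 := card_union_add_card_inter P P'
    have e2 : #(P ∪ P') + #A ≤ Fintype.card α := by
      rw [← card_union_of_disjoint (disjoint_union_left.2 ⟨h.disj, h'.disj⟩)]
      exact card_le_univ _
    omega
  have h5 := card_filter_add_card_filter_not (s := P ∩ P')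
    (fun y => 25 * u ≤ (#{p ∈ P | D p y} : ℝ))
  have h4' : (#A : ℝ) ≤ #(P ∩ P') := by exact_mod_cast h4
  have h5' : (#{y ∈ P ∩ P' | 25 * u ≤ (#{p ∈ P | D p y} : ℝ)} + #B : ℝ) = #(P ∩ P') := by
    exact_mod_cast h5
  linarith

open Classical in
/-- The vertices outside `A ∪ P` sending few edges to `P ∩ P'`, if there are not too many. -/
noncomputable def lowSet (D : α → α → Prop) (A P P' : Finset α) (u : ℝ) : Finset α :=
  if (#{x | x ∉ A ∧ x ∉ P ∧ (#{y ∈ P ∩ P' | D x y} : ℝ) < 2500 * u} : ℝ) ≤ 100 * u then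
    ({x | x ∉ A ∧ x ∉ P ∧ (#{y ∈ P ∩ P' | D x y} : ℝ) < 2500 * u} : Finset α)
  else ∅

lemma card_lowSet_le (D : α → α → Prop) (A P P' : Finset α) {u : ℝ} (hu : 0 < u) :
    (#(lowSet D A P P' u) : ℝ) ≤ 100 * u := by
  unfold lowSet
  split_ifs with h
  · exact h
  · simp; positivity

open Classical in
lemma HalfDeg.exists_of_notMem_lowSet {D : α → α → Prop} {A P P' : Finset α} {μ u : ℝ}
    (h : HalfDeg D A P P' μ) (h' : HalfDeg (fun x y => D y x) A P' P μ)
    (hcard : #P + #P' = Fintype.card α) (hu : 0 < u) (hau : 10000 * u ≤ #A)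
    (hμ : μ * Fintype.card α ≤ u / 10) {x : α} (hA : x ∉ A) (hP : x ∉ P)
    (hx : x ∉ lowSet D A P P' u) :
    2500 * u ≤ #{y ∈ P ∩ P' | D x y} ∨
      (#A : ℝ) / 2 ≤ #{y ∈ P ∩ P' | 25 * u ≤ (#{p ∈ P | D p y} : ℝ)} := by
  unfold lowSet at hx
  split_ifs at hx with hc
  · left
    simpa [hA, hP] using hx
  · exact Or.inr (h.exists_good h' hcard hu hau hμ (not_le.1 hc))

open Classical in
/-- The uncoloured Hamilton cycle statement with a balanced vertex partition. -/
theorem exists_hamilton_of_halfDeg (E : ℕ) (hE : 1 ≤ E) : ∃ m₀ : ℕ, ∀ (α : Type) [Fintype α]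
    [DecidableEq α], m₀ ≤ Fintype.card α → ∀ (D : α → α → Prop) (A P P' : Finset α),
    HalfDeg D A P P' (1 / (100000 * E)) → HalfDeg (fun x y => D y x) A P' P (1 / (100000 * E)) →
    #P + #P' = Fintype.card α → Fintype.card α ≤ E * #A →
    (∀ y ∈ P', 10 * #{a ∈ A | ¬ D a y} ≤ 4 * #A) →
    ∃ π : Equiv.Perm α, (∀ x, D x (π x)) ∧ ∀ x y, π.SameCycle x y := by
  obtain ⟨m₀, hm₀, hsp⟩ := exists_spread E 14 hE
  refine ⟨m₀, fun α _ _ hm D A P P' h h' hcard hA hin => ?_⟩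
  have hE' : (1 : ℝ) ≤ E := by exact_mod_cast hE
  have hmp : (1 : ℝ) ≤ Fintype.card α := by exact_mod_cast hm₀.trans hm
  have hne : Nonempty α := Fintype.card_pos_iff.1 (hm₀.trans hm)
  set u : ℝ := Fintype.card α / (10000 * E) with hu
  have hu0 : 0 < u := by positivity
  have hA' : (Fintype.card α : ℝ) ≤ E * #A := by exact_mod_cast hA
  have hau : 10000 * u ≤ #A := by
    rw [hu, mul_div_assoc', div_le_iff₀ (by positivity)]
    linarith
  have hμ : 1 / (100000 * E) * (Fintype.card α : ℝ) ≤ u / 10 := by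
    apply le_of_eq
    rw [hu]
    field_simp
    norm_num
  set G : Finset α := {y ∈ P ∩ P' | 25 * u ≤ (#{p ∈ P | D p y} : ℝ)} with hG
  set G' : Finset α := {y ∈ P' ∩ P | 25 * u ≤ (#{p ∈ P' | D y p} : ℝ)} with hG'
  set M := lowSet D A P P' u with hM
  set M' := lowSet (fun x y => D y x) A P' P u with hM'
  obtain ⟨J, q, hJ, hF⟩ := hsp α hm ![fun _ => univ, fun _ => Aᶜ, fun _ => P, fun _ => P',
    fun _ => M, fun _ => M', fun _ => G, fun _ => G',
    fun x => {y ∈ Aᶜ | D x y}, fun x => {y ∈ P | D x y}, fun x => {y ∈ P ∩ P' | D x y},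
    fun x => {y ∈ Aᶜ | D y x}, fun x => {y ∈ P' | D y x}, fun x => {y ∈ P' ∩ P | D y x}]
  set t := 1000000 * E ^ 2 with ht
  have ht4 : 4 ≤ t := by have : 0 < E ^ 2 := by positivity
                         omega
  obtain ⟨x₀⟩ := hne
  have hw : (0 : ℝ) < 1 / (1000000 * E ^ 2 : ℕ) := by positivity
  have hz : (0 : ℝ) < 1 / (4000 * E : ℕ) := by positivity
  have hzm : 1 / (4000 * E : ℕ) * (Fintype.card α : ℝ) = 5 / 2 * u := by
    rw [hu]; push_cast; field_simp; norm_num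
  have hwm : 1 / (1000000 * E ^ 2 : ℕ) * (Fintype.card α : ℝ) =
      40 * (1 / (4000 * E : ℕ) * u) := by
    rw [hu]; push_cast; field_simp; norm_num
  have hwu : 1 / (1000000 * E ^ 2 : ℕ) * (Fintype.card α : ℝ) ≤ u := by
    rw [hwm]
    have : (1 / (4000 * E : ℕ) : ℝ) ≤ 1 / 4000 := by
      gcongr
      norm_cast
      omega
    nlinarith
  have fwd := h.halfLay (t := t) (J := J) (q := q) (M := M) (M' := M') ht4 hJ hw hz hu0 hzm hwm
    hwu hau hμ (card_lowSet_le _ _ _ _ hu0) (card_lowSet_le _ _ _ _ hu0)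
    (fun x hA hP hx => (h.exists_of_notMem_lowSet h' hcard hu0 hau hμ hA hP hx).imp_right
      fun hc => ⟨G, filter_subset _ _, hc, hF 6 x₀, fun y hy => (mem_filter.1 hy).2⟩)
    (hF 0 x₀) (hF 1 x₀) (hF 2 x₀) (hF 4 x₀) (hF 5 x₀) (hF 8) (hF 9) (hF 10)
  have hcard' : #P' + #P = Fintype.card α := by rw [add_comm]; exact hcard
  have bwd := h'.halfLay (t := t) (J := fun v => t + 1 - J v) (q := fun v => flipRow (q v))
    (M := M') (M' := M) ht4
    (fun v => by have := hJ v; omega) hw hz hu0 hzm hwm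
    hwu hau hμ (card_lowSet_le _ _ _ _ hu0) (card_lowSet_le _ _ _ _ hu0)
    (fun x hA hP hx => (h'.exists_of_notMem_lowSet h hcard' hu0 hau hμ hA hP hx).imp_right
      fun hc => ⟨G', filter_subset _ _, hc, (hF 7 x₀).symm hJ, fun y hy => (mem_filter.1 hy).2⟩)
    ((hF 0 x₀).symm hJ) ((hF 1 x₀).symm hJ) ((hF 3 x₀).symm hJ) ((hF 5 x₀).symm hJ)
    ((hF 4 x₀).symm hJ) (fun x => (hF 11 x).symm hJ) (fun x => (hF 12 x).symm hJ)
    (fun x => (hF 13 x).symm hJ)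
  rw [← layerFn_symm ht4 hJ] at bwd
  refine Lay.exists_hamilton ⟨fwd, bwd, h.disj, h'.disj, fun v => ?_, hcard, h.card_P, h'.card_P,
    by omega, hw, by linarith, ?_, rfl, by positivity, by linarith, ?_⟩ hin
  · have := hJ v
    unfold layerFn
    split_ifs <;> omega
  · have : (1000000 : ℝ) ≤ 1000000 * E ^ 2 := by nlinarith
    push_cast
    rw [ht, mul_one_div, le_div_iff₀ (by positivity)]
    push_cast
    linarith
  · have : (0 : ℝ) < #A := by linarith
    exact_mod_cast this

end Spreading

section Fixing

set_option linter.unusedSectionVars false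

variable {α β : Type} [Fintype α] [DecidableEq α] [Fintype β] [DecidableEq β]

open Classical in
lemma exists_equiv_forall_not (Bad : α → β → Prop)
    (h : ∀ a b, #{b | Bad a b} + #{a | Bad a b} < Fintype.card α) (k : ℕ) :
    ∀ σ : α ≃ β, #{a | Bad a (σ a)} ≤ k →
      ∃ σ' : α ≃ β, (∀ a, ¬ Bad a (σ' a)) ∧ #{a | σ' a ≠ σ a} ≤ 2 * k := by
  induction k with
  | zero =>
    intro σ hσ
    refine ⟨σ, fun a ha => ?_, by simp⟩
    have := card_eq_zero.1 (Nat.le_zero.1 hσ)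
    exact notMem_empty a (this ▸ by simpa using ha)
  | succ k ih =>
    intro σ hσ
    by_cases hex : ∃ a, Bad a (σ a)
    swap
    · push Not at hex
      exact ⟨σ, hex, by simp⟩
    obtain ⟨a, ha⟩ := hex
    obtain ⟨b, hb1, hb2⟩ : ∃ b, ¬ Bad a (σ b) ∧ ¬ Bad b (σ a) := by
      by_contra! hcon
      have h1 : Fintype.card α ≤ #{b | Bad a (σ b)} + #{b | Bad b (σ a)} := by
        rw [← card_univ]
        refine le_trans (card_le_card fun b _ => ?_) (card_union_le _ _)
        simp only [mem_union, mem_filter, mem_univ, true_and]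
        by_cases hb : Bad a (σ b)
        · exact Or.inl hb
        · exact Or.inr (hcon b hb)
      have h2 : #{b | Bad a (σ b)} = #{c | Bad a c} := by
        rw [← card_map σ.toEmbedding]
        congr 1
        ext c
        simp
      have := h a (σ a)
      omega
    have hab : a ≠ b := fun hab => hb2 (hab ▸ ha)
    obtain ⟨τ, hτ⟩ : ∃ τ : α ≃ β, ∀ x, τ x = σ (Equiv.swap a b x) :=
      ⟨(Equiv.swap a b).trans σ, fun _ => rfl⟩
    obtain ⟨σ', h1, h2⟩ := ih τ (by
      have : #{x | Bad x (τ x)} < #{x | Bad x (σ x)} := by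
        refine card_lt_card ((ssubset_iff_of_subset fun x hx => ?_).2 ⟨a, by simpa using ha, ?_⟩)
        · rw [mem_filter, hτ] at hx
          rw [mem_filter]
          refine ⟨mem_univ _, ?_⟩
          by_cases hxa : x = a
          · rwa [hxa]
          by_cases hxb : x = b
          · rw [hxb, Equiv.swap_apply_right] at hx
            exact absurd hx.2 hb2
          rw [Equiv.swap_apply_of_ne_of_ne hxa hxb] at hx
          exact hx.2
        · rw [mem_filter, hτ, Equiv.swap_apply_left]
          tauto
      omega)
    refine ⟨σ', h1, ?_⟩
    calc #{x | σ' x ≠ σ x} ≤ #(({x | σ' x ≠ τ x} : Finset α) ∪ {a, b}) := by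
          refine card_le_card fun x hx => ?_
          simp only [mem_filter, mem_univ, true_and, mem_union, mem_insert,
            mem_singleton] at hx ⊢
          by_contra! hcon
          rw [hτ, Equiv.swap_apply_of_ne_of_ne hcon.2.1 hcon.2.2] at hcon
          exact hx hcon.1
      _ ≤ 2 * k + 2 := (card_union_le _ _).trans (Nat.add_le_add h2 card_le_two)
      _ = 2 * (k + 1) := by ring

open Classical in
lemma exists_equiv_count {ι : Type} [Fintype ι] (hcard : Fintype.card α = Fintype.card β)
    (R : ι → α → β → Prop) {η : ℝ} (hη : 0 < η)
    (hm : 3 * (Fintype.card ι : ℝ) < η ^ 4 * (Fintype.card α : ℝ) ^ 2) :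
    ∃ σ : α ≃ β, ∀ i, (#{a | R i a (σ a)} : ℝ) ≤
      (∑ b, (#{a | R i a b} : ℝ)) / Fintype.card α + η * Fintype.card α := by
  let ρ := Fintype.equivOfCardEq hcard
  obtain ⟨σ, hσ⟩ := exists_perm_abs_permDev_le
    (fun i x y => if R i x (ρ y) then (1 : ℝ) else 0)
    (fun i x y => by split_ifs <;> simp) (fun i x y => by split_ifs <;> simp) hη hm
  refine ⟨σ.trans ρ, fun i => ?_⟩
  have h1 := (abs_le.1 (hσ i)).2
  unfold permDev at h1
  have e2 : ∑ a, ∑ y, (if R i a (ρ y) then (1 : ℝ) else 0) = ∑ b, (#{a | R i a b} : ℝ) := by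
    rw [sum_comm, ← Equiv.sum_comp ρ]
    simp
  rw [e2, sum_boole] at h1
  have h2 : (#{a | R i a ((σ.trans ρ) a)} : ℝ) - (∑ b, (#{a | R i a b} : ℝ)) / Fintype.card α ≤
      η * Fintype.card α := h1
  linarith

open Classical in
lemma exists_equiv_fixed {ι : Type} [Fintype ι] (hcard : Fintype.card α = Fintype.card β)
    (R : ι → α → β → Prop) (Bad : α → β → Prop) {η : ℝ} (hη : 0 < η)
    (hm : 3 * (Fintype.card ι + 1 : ℝ) < η ^ 4 * (Fintype.card α : ℝ) ^ 2) (k : ℕ)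
    (hb1 : ∀ a, 2 * #{b | Bad a b} ≤ Fintype.card α) (hb2 : ∀ b, #{a | Bad a b} ≤ k)
    (hk : 2 * k < Fintype.card α) (τ : ι → ℝ)
    (hτ : ∀ i, ∑ b, (#{a | R i a b} : ℝ) ≤ τ i * Fintype.card α) :
    ∃ σ : α ≃ β, (∀ a, ¬ Bad a (σ a)) ∧ ∀ i, (#{a | R i a (σ a)} : ℝ) ≤
      τ i + 3 * (η * Fintype.card α) + 2 * k := by
  have hm0 : (0 : ℝ) < Fintype.card α := by
    have : 0 < Fintype.card α := by omega
    exact_mod_cast this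
  obtain ⟨σ, hσ⟩ := exists_equiv_count (ι := Option ι) hcard
    (fun i => i.elim Bad R) hη (by simpa using hm)
  have h0 : (#{a | Bad a (σ a)} : ℝ) ≤
      (∑ b, (#{a | Bad a b} : ℝ)) / Fintype.card α + η * Fintype.card α := hσ none
  have h1 : (∑ b, (#{a | Bad a b} : ℝ)) / Fintype.card α ≤ k := by
    rw [div_le_iff₀ hm0]
    calc ∑ b, (#{a | Bad a b} : ℝ) ≤ ∑ b : β, (k : ℝ) :=
          sum_le_sum fun b _ => by exact_mod_cast hb2 b
      _ = k * Fintype.card α := by rw [sum_const, nsmul_eq_mul, card_univ, hcard, mul_comm]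
  obtain ⟨σ', h2, h3⟩ := exists_equiv_forall_not Bad
    (fun a b => by have := hb1 a; have := hb2 b; omega) _ σ le_rfl
  refine ⟨σ', h2, fun i => ?_⟩
  have h4 : (#{a | R i a (σ a)} : ℝ) ≤
      (∑ b, (#{a | R i a b} : ℝ)) / Fintype.card α + η * Fintype.card α := hσ (some i)
  have h5 : (∑ b, (#{a | R i a b} : ℝ)) / Fintype.card α ≤ τ i := by
    rw [div_le_iff₀ hm0]; exact hτ i
  have h6 : #{a | R i a (σ' a)} ≤ #{a | R i a (σ a)} + #{a | σ' a ≠ σ a} := by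
    refine le_trans (card_le_card fun a ha => ?_) (card_union_le _ _)
    simp only [mem_filter, mem_univ, true_and, mem_union] at ha ⊢
    by_cases hs : σ' a = σ a
    · exact Or.inl (hs ▸ ha)
    · exact Or.inr hs
  have h6' : (#{a | R i a (σ' a)} : ℝ) ≤ #{a | R i a (σ a)} + #{a | σ' a ≠ σ a} := by
    exact_mod_cast h6
  have h3' : (#{a | σ' a ≠ σ a} : ℝ) ≤ 2 * #{a | Bad a (σ a)} := by exact_mod_cast h3
  linarith

lemma card_filter_subtype_univ {γ : Type} [DecidableEq γ] (s : Finset γ) (p : γ → Prop)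
    [DecidablePred p] [DecidablePred fun a : s => p a] :
    #{a : s | p a} = #{a ∈ s | p a} := by
  rw [← card_map (Function.Embedding.subtype _)]
  congr 1
  ext a
  simp [and_comm]

end Fixing

section Balanced

open Classical in
set_option maxHeartbeats 1000000 in
theorem hamSys_of_balanced (E : ℕ) (hE : 1 ≤ E) : ∃ m₀ : ℕ, ∀ (V C : Type) [Fintype V]
    [DecidableEq V] [DecidableEq C] (D : C → V → V → Prop) (I L : Finset V) (e : V → V)
    (K : Finset C) (C2 P P' : Finset V) (d : ℕ),
    m₀ ≤ #I → #I ≤ E * #{u ∈ I | u ∈ C2} → 100000000 * E * d ≤ #I → Fintype.card V ≤ #I + d →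
    Set.InjOn e I → I.image e = L → #K = #I →
    (∀ z ∈ I, z ∈ C2 → e z = z) → (∀ z ∈ I, e z ∈ C2 → z ∈ C2) →
    Disjoint C2 P → Disjoint C2 P' →
    (∀ i ∈ K, ∀ v, Fintype.card V ≤ 2 * #{y | D i v y}) →
    (∀ i ∈ K, ∀ v, Fintype.card V ≤ 2 * #{y | D i y v}) →
    (∀ i ∈ K, ∀ u ∈ C2, #{y ∈ P' | ¬ D i u y} ≤ d) →
    (∀ i ∈ K, ∀ u ∈ C2, #{y ∈ P | ¬ D i y u} ≤ d) →
    (∀ i ∈ K, ∀ u ∈ C2, ∀ y ∉ C2, y ∉ P' → ¬ D i u y) →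
    (∀ i ∈ K, ∀ u ∈ C2, ∀ y ∉ C2, y ∉ P → ¬ D i y u) →
    (∀ x ∈ L, x ∈ P → 10 * ∑ i ∈ K, #{u ∈ I | u ∈ C2 ∧ ¬ D i x u} ≤
      3 * (#K * #{u ∈ I | u ∈ C2})) →
    (∀ y ∈ I, y ∈ P' → 10 * ∑ i ∈ K, #{u ∈ I | u ∈ C2 ∧ ¬ D i u y} ≤
      3 * (#K * #{u ∈ I | u ∈ C2})) →
    #{x ∈ L | x ∈ P} + #{y ∈ I | y ∈ P'} = #I →
    Fintype.card V ≤ 2 * #P → Fintype.card V ≤ 2 * #P' → HamSys D I e K := by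
  obtain ⟨m₁, hm₁⟩ := exists_hamilton_of_halfDeg E hE
  have hE' : (1 : ℝ) ≤ E := by exact_mod_cast hE
  set μ : ℝ := 1 / (100000 * E) with hμ
  have hμ0 : 0 < μ := by positivity
  set η : ℝ := μ / 100 with hη
  have hη0 : 0 < η := by positivity
  obtain ⟨m₂, hm₂⟩ := exists_nat_gt (15 / η ^ 4)
  refine ⟨m₁ + m₂ + 1, ?_⟩
  intro V C _ _ _ D I L e K C2 P P' d hm hIA hd hV he heL hKI heA heA' hCP hCP' hout hin houtA hinA
    hC1 hC3 hWL hWR hbal hP hP'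
  set a := #{u ∈ I | u ∈ C2} with ha
  set m := #I with hmI
  have hm1 : 1 ≤ m := by omega
  have hm1' : (1 : ℝ) ≤ m := by exact_mod_cast hm1
  have ha1 : 1 ≤ a := by
    by_contra! h
    have : a = 0 := by omega
    rw [this] at hIA
    omega
  have ha1' : (1 : ℝ) ≤ a := by exact_mod_cast ha1
  have hIA' : (m : ℝ) ≤ E * a := by exact_mod_cast hIA
  have hd' : 100000000 * E * d ≤ (m : ℝ) := by exact_mod_cast hd
  have hV' : (Fintype.card V : ℝ) ≤ m + d := by exact_mod_cast hV
  have hdμ : 1000 * d ≤ μ * m := by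
    rw [hμ, one_div, inv_mul_eq_div, le_div_iff₀ (by positivity)]
    linarith
  have hμa : 100000 * (μ * m) ≤ a := by
    have : 100000 * (μ * m) = m / E := by rw [hμ]; field_simp
    rw [this, div_le_iff₀ (by positivity)]
    linarith
  have hcα : Fintype.card I = m := by simp [hmI]
  have hcβ : Fintype.card K = m := by simp [hKI]
  have heIL : ∀ z ∈ I, e z ∈ L := fun z hz => heL ▸ mem_image_of_mem e hz
  -- counting over the subtype
  have hcount₀ : ∀ p : V → Prop, #{x : I | p (e x)} = #{x ∈ L | p x} := by
    intro p
    rw [card_filter_subtype_univ I (fun x => p (e x)), ← heL, filter_image, card_image_of_injOn]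
    exact he.mono fun x hx => (mem_filter.1 (Finset.mem_coe.1 hx)).1
  have hcountI₀ : ∀ p : V → Prop, #{x : I | p x} = #{x ∈ I | p x} := fun p =>
    card_filter_subtype_univ I p
  have hdiffI : ∀ p : V → Prop, #{x | p x} ≤ #{x ∈ I | p x} + d := fun p => by
    have h1 : #{x | p x} ≤ #{x ∈ I | p x} + #Iᶜ := by
      refine le_trans (card_le_card fun x hx => ?_) (card_union_le _ _)
      simp only [mem_filter, mem_univ, true_and, mem_union, mem_compl] at hx ⊢
      tauto
    have := card_compl_add_card I
    omega
  have hLm : #L = m := by rw [← heL, card_image_of_injOn he]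
  have hdiffL : ∀ p : V → Prop, #{x | p x} ≤ #{x ∈ L | p x} + d := fun p => by
    have h1 : #{x | p x} ≤ #{x ∈ L | p x} + #Lᶜ := by
      refine le_trans (card_le_card fun x hx => ?_) (card_union_le _ _)
      simp only [mem_filter, mem_univ, true_and, mem_union, mem_compl] at hx ⊢
      tauto
    have := card_compl_add_card L
    omega
  obtain ⟨Bad, hBad⟩ : ∃ Bad : I → K → Prop, ∀ x c, Bad x c ↔
      e x ∈ P ∧ 4 * #{u ∈ I | u ∈ C2 ∧ D c (e x) u} < a := ⟨_, fun _ _ => Iff.rfl⟩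
  have hBadMiss : ∀ x c, Bad x c → 3 * a ≤ 4 * #{u ∈ I | u ∈ C2 ∧ ¬ D c (e x) u} := by
    intro x c hx
    have h1 : #{u ∈ I | u ∈ C2 ∧ D c (e x) u} + #{u ∈ I | u ∈ C2 ∧ ¬ D c (e x) u} = a := by
      rw [← filter_filter, ← filter_filter, card_filter_add_card_filter_not]
    have := ((hBad x c).1 hx).2
    omega
  have hb1 : ∀ x, 2 * #{c | Bad x c} ≤ Fintype.card I := by
    intro x
    by_cases hxP : e x ∈ P
    swap
    · simp [hBad, hxP]
    have h1 := hWL _ (heIL x x.2) hxP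
    have h2 : #{c | Bad x c} * (3 * a) ≤ 4 * ∑ i ∈ K, #{u ∈ I | u ∈ C2 ∧ ¬ D i (e x) u} := by
      rw [← smul_eq_mul, ← sum_const, mul_sum, ← sum_coe_sort K]
      exact (sum_le_sum fun c hc => hBadMiss x c (mem_filter.1 hc).2).trans
        (sum_le_sum_of_subset (subset_univ _))
    rw [hKI] at h1
    have h3 : (#{c | Bad x c} * 30) * a ≤ (12 * m) * a := by nlinarith
    have := Nat.le_of_mul_le_mul_right h3 ha1
    omega
  have hb2 : ∀ c, #{x | Bad x c} ≤ 2 * d := by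
    intro c
    have h2 : #{x | Bad x c} * (3 * a) ≤ 4 * (a * d) := by
      calc #{x | Bad x c} * (3 * a) ≤ ∑ x ∈ {x | Bad x c}, 4 * #{u ∈ I | u ∈ C2 ∧ ¬ D c (e x) u} := by
            rw [← smul_eq_mul, ← sum_const]
            exact sum_le_sum fun x hx => hBadMiss x c (mem_filter.1 hx).2
        _ = 4 * ∑ u ∈ {u ∈ I | u ∈ C2}, #(Finset.filter (fun x : I => ¬ D c (e x) u) {x | Bad x c}) := by
            rw [← mul_sum]
            congr 1
            refine Eq.trans (sum_congr rfl fun x _ => ?_)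
              (sum_card_bipartiteAbove_eq_sum_card_bipartiteBelow
                (fun (x : I) u => ¬ D c (e x) u))
            rw [bipartiteAbove, filter_filter]
        _ ≤ 4 * ∑ u ∈ {u ∈ I | u ∈ C2}, d := by
            gcongr with u hu
            refine le_trans ?_ (hinA c c.2 u (mem_filter.1 hu).2)
            have h1 : #{x : I | e x ∈ P ∧ ¬ D c (e x) u} = #{x ∈ L | x ∈ P ∧ ¬ D c x u} :=
              by convert hcount₀ fun x => x ∈ P ∧ ¬ D c x u
            have h2 : #(Finset.filter (fun x : I => ¬ D c (e x) u) {x | Bad x c}) ≤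
                #{x : I | e x ∈ P ∧ ¬ D c (e x) u} := by
              refine card_le_card fun x hx => ?_
              simp only [hBad, mem_filter, mem_univ, true_and] at hx ⊢
              tauto
            refine (h2.trans h1.le).trans (card_le_card fun x hx => ?_)
            simp only [mem_filter] at hx ⊢
            tauto
        _ = 4 * (a * d) := by rw [sum_const, smul_eq_mul]
    have h3 : (#{x | Bad x c} * 3) * a ≤ (4 * d) * a := by nlinarith
    have := Nat.le_of_mul_le_mul_right h3 ha1
    omega
  obtain ⟨R, hRd0, hRd1, hRd2⟩ : ∃ R : Fin 3 × I → I → K → Prop,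
      (∀ b x c, R (0, b) x c ↔ e x ∈ P ∧ (b : V) ∈ C2 ∧ ¬ D c (e x) b) ∧
      (∀ b x c, R (1, b) x c ↔ (x : V) ∈ C2 ∧ (b : V) ∈ P' ∧ ¬ D c x b) ∧
      (∀ b x c, R (2, b) x c ↔ ¬ D c (e x) b) :=
    ⟨fun i x c => ![e x ∈ P ∧ (i.2 : V) ∈ C2 ∧ ¬ D c (e x) i.2,
      (x : V) ∈ C2 ∧ (i.2 : V) ∈ P' ∧ ¬ D c x i.2, ¬ D c (e x) i.2] i.1,
      fun _ _ _ => Iff.rfl, fun _ _ _ => Iff.rfl, fun _ _ _ => Iff.rfl⟩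
  let τ : Fin 3 × I → ℝ := fun i => ![(d : ℝ), 3 / 10 * a, (m + d) / 2] i.1
  have hR0 : ∀ b c, (#{x | R (0, b) x c} : ℝ) ≤ d := by
    intro b c
    norm_cast
    by_cases hb : (b : V) ∈ C2
    swap
    · simp [hRd0, hb]
    have h1 : #{x : I | e x ∈ P ∧ ¬ D c (e x) b} = #{x ∈ L | x ∈ P ∧ ¬ D c x b} :=
      by convert hcount₀ fun x => x ∈ P ∧ ¬ D c x b
    have h2 : #{x | R (0, b) x c} = #{x : I | e x ∈ P ∧ ¬ D c (e x) b} := by simp [hRd0, hb]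
    refine ((h2.trans h1).le.trans (card_le_card fun x hx => ?_)).trans (hinA c c.2 b hb)
    simp only [mem_filter] at hx ⊢
    tauto
  have hR2 : ∀ b c, (#{x | R (2, b) x c} : ℝ) ≤ (m + d) / 2 := by
    intro b c
    have h1 : #{x | R (2, b) x c} = #{x ∈ L | ¬ D c x b} := by
      simp only [hRd2]
      convert hcount₀ fun x => ¬ D c x b
    have h2 : #{x ∈ L | ¬ D c x b} ≤ #{x | ¬ D c x b} :=
      card_le_card (filter_subset_filter _ (subset_univ _))
    have h3 : #{x | D c x b} + #{x | ¬ D c x b} = Fintype.card V := by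
      rw [card_filter_add_card_filter_not, card_univ]
    have h4 := hin c c.2 b
    have h5 : 2 * #{x | R (2, b) x c} ≤ m + d := by omega
    have h5' : (2 * #{x | R (2, b) x c} : ℝ) ≤ m + d := by exact_mod_cast h5
    linarith
  have hτ : ∀ i, ∑ c, (#{x | R i x c} : ℝ) ≤ τ i * Fintype.card I := by
    have hconst : ∀ r : ℝ, ∑ _c : K, r = r * Fintype.card I := fun r => by
      rw [sum_const, nsmul_eq_mul, card_univ, hcα, hcβ, mul_comm]
    rintro ⟨i, b⟩
    fin_cases i
    · exact (sum_le_sum fun c _ => hR0 b c).trans (hconst _).le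
    · have e1 : ∀ c, (#{x | R (1, b) x c} : ℝ) = #{x : I | (x : V) ∈ C2 ∧ (b : V) ∈ P' ∧ ¬ D c x b} :=
        fun c => by simp only [hRd1]
      suffices h : ∑ c : K, (#{x : I | (x : V) ∈ C2 ∧ (b : V) ∈ P' ∧ ¬ D c x b} : ℝ) ≤
        3 / 10 * a * Fintype.card I from (sum_congr rfl fun c _ => e1 c).trans_le h
      by_cases hb : (b : V) ∈ P'
      swap
      · simp only [hb, false_and, and_false, filter_false, card_empty, Nat.cast_zero, sum_const_zero]
        positivity
      have h1 := hWR b b.2 hb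
      have h2 : ∑ c : K, #{x : I | (x : V) ∈ C2 ∧ (b : V) ∈ P' ∧ ¬ D c x b} =
          ∑ i ∈ K, #{u ∈ I | u ∈ C2 ∧ ¬ D i u b} := by
        rw [← sum_coe_sort K]
        refine sum_congr rfl fun c _ => ?_
        have := hcountI₀ fun u => u ∈ C2 ∧ ¬ D c u b
        simp only [hb, true_and]
        convert this
      rw [← h2, hKI] at h1
      have h1' : 10 * ∑ c : K, (#{x : I | (x : V) ∈ C2 ∧ (b : V) ∈ P' ∧ ¬ D c x b} : ℝ) ≤
        3 * (m * a) := by exact_mod_cast h1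
      rw [hcα]
      linarith
    · exact (sum_le_sum fun c _ => hR2 b c).trans (hconst _).le
  obtain ⟨σ, hσB, hσR⟩ := exists_equiv_fixed (hcα.trans hcβ.symm) R Bad hη0 (by
      rw [Fintype.card_prod, Fintype.card_fin, hcα]
      have h1 : (m₂ : ℝ) ≤ m := by
        have : m₂ ≤ m := by omega
        exact_mod_cast this
      have h2 : 15 < η ^ 4 * m := by
        rw [div_lt_iff₀ (by positivity)] at hm₂
        refine hm₂.trans_le ?_
        rw [mul_comm]
        gcongr
      push_cast
      nlinarith) (2 * d) hb1 hb2 (by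
      rw [hcα]
      have : 100000000 * 1 * d ≤ 100000000 * E * d := by gcongr
      omega) τ hτ
  rw [hcα] at hσR
  obtain ⟨D', hD'⟩ : ∃ D' : I → I → Prop, ∀ x y, D' x y ↔ D (σ x) (e x) y :=
    ⟨_, fun _ _ => Iff.rfl⟩
  have hηm : η * m = μ * m / 100 := by rw [hη]; ring
  have hσ0 : ∀ b, (#{x | R (0, b) x (σ x)} : ℝ) ≤ μ * m := fun b => by
    have : (#{x | R (0, b) x (σ x)} : ℝ) ≤ d + 3 * (η * m) + 2 * (2 * d : ℕ) := hσR (0, b)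
    push_cast at this
    linarith
  have hσ1 : ∀ b, (10 * #{x | R (1, b) x (σ x)} : ℝ) ≤ 4 * a := fun b => by
    have : (#{x | R (1, b) x (σ x)} : ℝ) ≤ 3 / 10 * a + 3 * (η * m) + 2 * (2 * d : ℕ) :=
      hσR (1, b)
    push_cast at this
    linarith
  have hσ2 : ∀ b, (#{x | R (2, b) x (σ x)} : ℝ) ≤ m / 2 + μ * m := fun b => by
    have : (#{x | R (2, b) x (σ x)} : ℝ) ≤ (m + d) / 2 + 3 * (η * m) + 2 * (2 * d : ℕ) :=
      hσR (2, b)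
    push_cast at this
    linarith
  set A : Finset I := {x | (x : V) ∈ C2} with hA
  set PL : Finset I := {x | e x ∈ P} with hPL
  set PR : Finset I := {x | (x : V) ∈ P'} with hPR
  have hAa : #A = a := by convert hcountI₀ fun x => x ∈ C2
  have hAe : ∀ x : I, e x ∈ C2 ↔ x ∈ A := fun x => by
    rw [hA, mem_filter]
    refine ⟨fun h => ⟨mem_univ _, heA' x x.2 h⟩, fun h => ?_⟩
    rw [heA x x.2 h.2]
    exact h.2
  have hdPL : Disjoint PL A := by
    rw [Finset.disjoint_left]
    intro x hx hxA
    exact Finset.disjoint_left.1 hCP ((hAe x).2 hxA) (mem_filter.1 hx).2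
  have hdPR : Disjoint PR A := by
    rw [Finset.disjoint_left]
    intro x hx hxA
    exact Finset.disjoint_left.1 hCP' (mem_filter.1 hxA).2 (mem_filter.1 hx).2
  have hhalf : ∀ k : ℕ, Fintype.card V ≤ 2 * (k + d) → (m / 2 - μ * m : ℝ) ≤ k := fun k hk => by
    have h1 : #I ≤ Fintype.card V := card_le_univ I
    have h2 : m ≤ 2 * (k + d) := by omega
    have h2' : (m : ℝ) ≤ 2 * (k + d) := by exact_mod_cast h2
    linarith
  have hcPL : #PL = #{x ∈ L | x ∈ P} := by convert hcount₀ fun x => x ∈ P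
  have hcPR : #PR = #{x ∈ I | x ∈ P'} := by convert hcountI₀ fun x => x ∈ P'
  have hinD : ∀ y ∈ PR, 10 * #{x ∈ A | ¬ D' x y} ≤ 4 * #A := by
    intro y hy
    have h1 := hσ1 y
    have h2 : #{x ∈ A | ¬ D' x y} ≤ #{x | R (1, y) x (σ x)} := by
      refine card_le_card fun x hx => ?_
      rw [mem_filter] at hx ⊢
      refine ⟨mem_univ _, (hRd1 _ _ _).2 ⟨(mem_filter.1 hx.1).2, (mem_filter.1 hy).2, ?_⟩⟩
      have := hx.2
      simp only [hD', heA x x.2 (mem_filter.1 hx.1).2] at this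
      exact this
    rw [hAa]
    have h1' : 10 * #{x | R (1, y) x (σ x)} ≤ 4 * a := by exact_mod_cast h1
    omega
  have fwd : HalfDeg D' A PL PR μ := by
    refine ⟨?_, ?_, ?_, ?_, hdPL, ?_⟩
    · intro x hx
      rw [hcα]
      have h1 : #{y ∈ PR | ¬ D' x y} ≤ d := by
        refine le_trans ?_ (houtA (σ x) (σ x).2 (e x) ((hAe x).2 hx))
        calc #{y ∈ PR | ¬ D' x y} = #{y : I | (y : V) ∈ P' ∧ ¬ D (σ x) (e x) y} := by
              simp only [hPR, filter_filter, hD']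
          _ = #{y ∈ I | y ∈ P' ∧ ¬ D (σ x) (e x) y} := by
              convert hcountI₀ fun y => y ∈ P' ∧ ¬ D (σ x) (e x) y
          _ ≤ _ := card_le_card fun x hx => by
              simp only [mem_filter] at hx ⊢
              tauto
      have h1' : (#{y ∈ PR | ¬ D' x y} : ℝ) ≤ d := by exact_mod_cast h1
      have : (0 : ℝ) ≤ d := by positivity
      linarith
    · intro x hx
      have h1 := hσB x
      have h2 : a ≤ 4 * #{u ∈ I | u ∈ C2 ∧ D (σ x) (e x) u} := by
        by_contra! hcon
        exact h1 ((hBad _ _).2 ⟨(mem_filter.1 hx).2, hcon⟩)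
      have h3 : #{u ∈ I | u ∈ C2 ∧ D (σ x) (e x) u} = #{y ∈ A | D' x y} := by
        simp only [hA, filter_filter, hD']
        convert (hcountI₀ fun y => y ∈ C2 ∧ D (σ x) (e x) y).symm
      rw [h3] at h2
      have h2' : (a : ℝ) ≤ 4 * #{y ∈ A | D' x y} := by exact_mod_cast h2
      rw [hAa]
      linarith
    · intro x _
      rw [hcα]
      have h1 : #{y | D' x y} = #{y ∈ I | D (σ x) (e x) y} := by
        simp only [hD']
        convert hcountI₀ fun y => D (σ x) (e x) y
      rw [h1]
      apply hhalf
      have := hout (σ x) (σ x).2 (e x)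
      have := hdiffI fun y => D (σ x) (e x) y
      omega
    · intro x hx hxP y hy
      rw [hD']
      exact hC3 (σ x) (σ x).2 y (mem_filter.1 hy).2 _ (fun h => hx ((hAe x).1 h))
        (fun h => hxP (mem_filter.2 ⟨mem_univ _, h⟩))
    · rw [hcα]
      apply hhalf
      rw [hcPL]
      have h1 : #P ≤ #{x ∈ L | x ∈ P} + #Lᶜ := by
        refine le_trans (card_le_card fun x hx => ?_) (card_union_le _ _)
        simp only [mem_filter, mem_union, mem_compl]
        tauto
      have := card_compl_add_card L
      omega
  have bwd : HalfDeg (fun x y => D' y x) A PR PL μ := by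
    refine ⟨?_, ?_, ?_, ?_, hdPR, ?_⟩
    · intro y hy
      rw [hcα]
      refine le_trans ?_ (hσ0 y)
      have : #{x ∈ PL | ¬ D' x y} ≤ #{x | R (0, y) x (σ x)} := by
        refine card_le_card fun x hx => ?_
        rw [mem_filter] at hx ⊢
        exact ⟨mem_univ _, (hRd0 _ _ _).2 ⟨(mem_filter.1 hx.1).2, (mem_filter.1 hy).2,
          fun h => hx.2 ((hD' _ _).2 h)⟩⟩
      exact_mod_cast this
    · intro y hy
      have h1 := hinD y hy
      have h2 := card_filter_add_card_filter_not (s := A) (fun x => D' x y)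
      have h3 : #A ≤ 4 * #{x ∈ A | D' x y} := by omega
      have h3' : (#A : ℝ) ≤ 4 * #{x ∈ A | D' x y} := by exact_mod_cast h3
      linarith
    · intro y _
      rw [hcα]
      have h1 := hσ2 y
      have h2 : #{x | D' x y} + #{x | R (2, y) x (σ x)} = m := by
        have := card_filter_add_card_filter_not (s := (univ : Finset I)) (fun x => D' x y)
        rw [card_univ, hcα] at this
        simpa only [hRd2, hD'] using this
      have h2' : (#{x | D' x y} + #{x | R (2, y) x (σ x)} : ℝ) = m := by exact_mod_cast h2
      linarith
    · intro y hy hyP x hx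
      rw [hD']
      exact hC1 (σ x) (σ x).2 (e x) ((hAe x).2 hx) _
        (fun h => hy (mem_filter.2 ⟨mem_univ _, h⟩)) (fun h => hyP (mem_filter.2 ⟨mem_univ _, h⟩))
    · rw [hcα]
      apply hhalf
      rw [hcPR]
      have h1 : #P' ≤ #{x ∈ I | x ∈ P'} + #Iᶜ := by
        refine le_trans (card_le_card fun x hx => ?_) (card_union_le _ _)
        simp only [mem_filter, mem_union, mem_compl]
        tauto
      have := card_compl_add_card I
      omega
  obtain ⟨π, hπ, hπc⟩ := hm₁ I (by rw [hcα]; omega) D' A PL PR fwd bwd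
    (by rw [hcPL, hcPR, hcα, hbal]) (by rw [hcα, hAa]; exact hIA) hinD
  obtain ⟨z₀, hz₀⟩ : I.Nonempty := card_pos.1 (by omega)
  refine ⟨Equiv.Perm.ofSubtype π, fun x hx => Equiv.Perm.ofSubtype_apply_of_not_mem π hx, ?_,
    fun v => if h : v ∈ I then σ ⟨v, h⟩ else σ ⟨z₀, hz₀⟩, ?_, ?_⟩
  · intro x hx y hy
    obtain ⟨i, hi⟩ := hπc ⟨x, hx⟩ ⟨y, hy⟩
    refine ⟨i, ?_⟩
    rw [← map_zpow]
    have := Equiv.Perm.ofSubtype_apply_coe (π ^ i) ⟨x, hx⟩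
    rw [hi] at this
    exact this
  · intro x hx y hy hxy
    have hx' : x ∈ I := hx
    have hy' : y ∈ I := hy
    simp only [hx', hy', dif_pos] at hxy
    exact congrArg Subtype.val (σ.injective (Subtype.ext hxy))
  · intro x hx
    simp only [hx, dif_pos]
    refine ⟨(σ ⟨x, hx⟩).2, ?_⟩
    have := (hD' _ _).1 (hπ ⟨x, hx⟩)
    have h2 := Equiv.Perm.ofSubtype_apply_coe π ⟨x, hx⟩
    rw [show Equiv.Perm.ofSubtype π x = _ from h2]
    exact this

end Balanced

section Extremal

set_option linter.unusedSectionVars false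

open scoped Classical

variable {V C : Type} [Fintype V] [Fintype C] [DecidableEq V] [DecidableEq C]

/-- Digraphs of minimum semidegree at least half the order, in which, apart from the exceptional
colours `Bad`, vertices of `C2` send edges only into `P'` and receive edges only from `P`; the
sets `P` and `P'` exceed half of the vertex set by `s` and `r` vertices. -/
structure FourPart (D : C → V → V → Prop) (C2 P P' : Finset V) (Bad : Finset C) (s r : ℕ) : Prop where
  out : ∀ i v, (Fintype.card V + 1) / 2 ≤ #{y | D i v y}
  inn : ∀ i v, (Fintype.card V + 1) / 2 ≤ #{y | D i y v}
  loopless : ∀ i v, ¬ D i v v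
  disj : Disjoint C2 P
  disj' : Disjoint C2 P'
  card_P : #P = (Fintype.card V + 1) / 2 + s
  card_P' : #P' = (Fintype.card V + 1) / 2 + r
  good_out : ∀ i ∉ Bad, ∀ u ∈ C2, ∀ y, D i u y → y ∈ P'
  good_in : ∀ i ∉ Bad, ∀ u ∈ C2, ∀ x, D i x u → x ∈ P

namespace FourPart

variable {D : C → V → V → Prop} {C2 P P' : Finset V} {Bad : Finset C} {s r : ℕ}

lemma symm (h : FourPart D C2 P P' Bad s r) : FourPart (fun i x y => D i y x) C2 P' P Bad r s :=
  ⟨h.inn, h.out, h.loopless, h.disj', h.disj, h.card_P', h.card_P, h.good_in, h.good_out⟩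

lemma card_miss (h : FourPart D C2 P P' Bad s r) {i : C} (hi : i ∉ Bad) {u : V} (hu : u ∈ C2) :
    #{y ∈ P' | ¬ D i u y} ≤ r := by
  have h1 := h.out i u
  have h2 : #{y | D i u y} ≤ #{y ∈ P' | D i u y} := card_le_card fun y hy => by
    rw [mem_filter] at hy ⊢
    exact ⟨h.good_out i hi u hu y hy.2, hy.2⟩
  have h3 := card_filter_add_card_filter_not (s := P') (fun y => D i u y)
  have := h.card_P'
  omega

lemma le_card_out (h : FourPart D C2 P P' Bad s r) (i : C) (x : V) :
    r + Fintype.card V % 2 ≤ #{y ∈ P' | D i x y} := by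
  have h1 := h.out i x
  have h2 : #{y | D i x y} ≤ #{y ∈ P' | D i x y} + #P'ᶜ := by
    refine le_trans (card_le_card fun y hy => ?_) (card_union_le _ _)
    simp only [mem_filter, mem_univ, true_and, mem_union, mem_compl] at hy ⊢
    tauto
  have h3 := card_compl_add_card P'
  have := h.card_P'
  omega

lemma lt_card_out (h : FourPart D C2 P P' Bad s r) (i : C) {x : V} (hx : x ∉ P') :
    r + Fintype.card V % 2 < #{y ∈ P' | D i x y} := by
  have h1 := h.out i x
  have h2 : #{y | D i x y} ≤ #{y ∈ P' | D i x y} + #(P'ᶜ.erase x) := by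
    refine le_trans (card_le_card fun y hy => ?_) (card_union_le _ _)
    simp only [mem_filter, mem_univ, true_and, mem_union, mem_erase, mem_compl] at hy ⊢
    by_cases hyP : y ∈ P'
    · exact Or.inl ⟨hyP, hy⟩
    · exact Or.inr ⟨fun e => h.loopless i x (e ▸ hy), hyP⟩
  have h3 := card_compl_add_card P'
  have h4 := card_erase_add_one (mem_compl.2 hx)
  have := h.card_P'
  omega

/-- Total number of missing edges from `P` to a set of vertices of `C2`. -/
lemma sum_miss (h : FourPart D C2 P P' Bad s r) {G : Finset C} (hG : Disjoint G Bad) {H : Finset V}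
    (hH : H ⊆ C2) : ∑ v ∈ P, #{c ∈ G ×ˢ H | ¬ D c.1 v c.2} ≤ s * (#G * #H) := by
  calc ∑ v ∈ P, #{c ∈ G ×ˢ H | ¬ D c.1 v c.2} = ∑ c ∈ G ×ˢ H, #{v ∈ P | ¬ D c.1 v c.2} :=
        sum_card_bipartiteAbove_eq_sum_card_bipartiteBelow (fun v (c : C × V) => ¬ D c.1 v c.2)
    _ ≤ ∑ c ∈ G ×ˢ H, s := by
        refine sum_le_sum fun c hc => ?_
        rw [mem_product] at hc
        exact h.symm.card_miss (Finset.disjoint_left.1 hG hc.1) (hH hc.2)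
    _ = s * (#G * #H) := by rw [sum_const, card_product, smul_eq_mul, mul_comm]

end FourPart

/-- A rainbow matching from all but `s` vertices of `S`. -/
lemma exists_rainbow_matching (D : C → V → V → Prop) (G : Finset C) (H : Finset V) (s b : ℕ)
    (hb : b * (#G + #H) < #G * #H) (S : Finset V) (hS : #S ≤ b)
    (hsum : ∑ v ∈ S, #{c ∈ G ×ˢ H | ¬ D c.1 v c.2} ≤ s * (#G * #H)) :
    ∃ T ⊆ S, #(S \ T) ≤ s ∧ (s ≤ #S → #(S \ T) = s) ∧ ∃ (f : V → C) (g : V → V),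
      Set.InjOn f T ∧ Set.InjOn g T ∧ ∀ v ∈ T, f v ∈ G ∧ g v ∈ H ∧ D (f v) v (g v) := by
  induction hn : #S generalizing S with
  | zero =>
    have hS0 : S = ∅ := card_eq_zero.1 hn
    subst hS0
    obtain ⟨i₀, hi₀⟩ : G.Nonempty := by
      rw [nonempty_iff_ne_empty]
      rintro rfl
      simp at hb
    refine ⟨∅, by simp, by simp, fun h => by simp at h ⊢; omega, fun _ => i₀, id, by simp, by simp,
      by simp⟩
  | succ k ih =>
    by_cases hks : k + 1 ≤ s
    · obtain ⟨i₀, hi₀⟩ : G.Nonempty := by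
        rw [nonempty_iff_ne_empty]
        rintro rfl
        simp at hb
      refine ⟨∅, by simp, by simpa [hn] using hks, fun h => by simp; omega, fun _ => i₀, id,
        by simp, by simp, by simp⟩
    push Not at hks
    obtain ⟨v, hv, hmin⟩ := S.exists_min_image (fun v => #{c ∈ G ×ˢ H | ¬ D c.1 v c.2})
      (card_pos.1 (by omega))
    have hc : #(S.erase v) = k := by rw [card_erase_of_mem hv]; omega
    obtain ⟨T, hTS, -, hT2, f, g, hf, hg, hfg⟩ := ih (S.erase v) (by omega)
      ((sum_le_sum_of_subset (erase_subset _ _)).trans hsum) hc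
    have hT2 := hT2 (by omega)
    have hTc : #T + s = k := by
      have := card_sdiff_add_card_eq_card hTS
      omega
    have hvT : v ∉ T := fun h => by simpa using hTS h
    -- availability of `v`
    have havail : ∃ c ∈ G ×ˢ H, c.1 ∉ T.image f ∧ c.2 ∉ T.image g ∧ D c.1 v c.2 := by
      by_contra! hno
      have h1 : #(G ×ˢ H) ≤ #{c ∈ G ×ˢ H | ¬ D c.1 v c.2} + (#(T.image f ×ˢ H) +
          #(G ×ˢ T.image g)) := by
        refine le_trans (card_le_card fun c hc => ?_) ((card_union_le _ _).trans
          (Nat.add_le_add_left (card_union_le _ _) _))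
        have := hno c hc
        rw [mem_product] at hc
        simp only [mem_union, mem_filter, mem_product]
        tauto
      have h2 : (k + 1) * #{c ∈ G ×ˢ H | ¬ D c.1 v c.2} ≤ s * (#G * #H) := by
        refine le_trans ?_ hsum
        rw [← hn, ← smul_eq_mul]
        exact card_nsmul_le_sum _ _ _ hmin
      simp only [card_product] at h1
      have h3 : #(T.image f) ≤ #T := card_image_le
      have h4 : #(T.image g) ≤ #T := card_image_le
      have h5 : #G * #H ≤ #{c ∈ G ×ˢ H | ¬ D c.1 v c.2} + #T * (#G + #H) := by
        calc _ ≤ _ := h1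
          _ ≤ #{c ∈ G ×ˢ H | ¬ D c.1 v c.2} + (#T * #H + #G * #T) := by gcongr
          _ = _ := by ring
      set g' := #G * #H
      generalize #{c ∈ G ×ˢ H | ¬ D c.1 v c.2} = w at h2 h5
      have h6 : (k + 1) * g' ≤ s * g' + (k + 1) * (#T * (#G + #H)) := by
        have := Nat.mul_le_mul_left (k + 1) h5
        rw [mul_add] at this
        omega
      have h7 : (k + 1) * (#T * (#G + #H)) ≤ #T * g' := by
        calc (k + 1) * (#T * (#G + #H)) = #T * ((k + 1) * (#G + #H)) := by ring
          _ ≤ #T * (b * (#G + #H)) := by gcongr; omega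
          _ ≤ #T * g' := by gcongr
      have h8 : (k + 1) * g' ≤ (s + #T) * g' := by linarith
      have := Nat.le_of_mul_le_mul_right h8 (by omega)
      omega
    obtain ⟨⟨i, u⟩, hiu, hif, hug, hD⟩ := havail
    rw [mem_product] at hiu
    refine ⟨insert v T, insert_subset hv (hTS.trans (erase_subset _ _)), ?_, ?_,
      Function.update f v i, Function.update g v u, ?_, ?_, ?_⟩
    · rw [sdiff_insert, ← erase_sdiff_comm]
      exact hT2.le
    · intro _
      rw [sdiff_insert, ← erase_sdiff_comm]
      exact hT2
    · rw [coe_insert, Set.injOn_insert (by simpa using hvT)]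
      refine ⟨fun x hx y hy h => ?_, ?_⟩
      · rw [Function.update_of_ne (by rintro rfl; exact hvT hx),
          Function.update_of_ne (by rintro rfl; exact hvT hy)] at h
        exact hf hx hy h
      · rw [Function.update_self]
        rintro ⟨x, hx, h⟩
        rw [Function.update_of_ne (by rintro rfl; exact hvT hx)] at h
        exact hif (mem_image.2 ⟨x, hx, h⟩)
    · rw [coe_insert, Set.injOn_insert (by simpa using hvT)]
      refine ⟨fun x hx y hy h => ?_, ?_⟩
      · rw [Function.update_of_ne (by rintro rfl; exact hvT hx),
          Function.update_of_ne (by rintro rfl; exact hvT hy)] at h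
        exact hg hx hy h
      · rw [Function.update_self]
        rintro ⟨x, hx, h⟩
        rw [Function.update_of_ne (by rintro rfl; exact hvT hx)] at h
        exact hug (mem_image.2 ⟨x, hx, h⟩)
    · intro x hx
      rcases mem_insert.1 hx with rfl | hxT
      · simpa using ⟨hiu.1, hiu.2, hD⟩
      · have : x ≠ v := by rintro rfl; exact hvT hxT
        simpa [Function.update_of_ne this] using hfg x hxT

lemma card_filter_product_eq_sum {α β : Type} (G : Finset α) (H : Finset β) (p : α → β → Prop)
    [∀ i u, Decidable (p i u)] : #{c ∈ G ×ˢ H | p c.1 c.2} = ∑ i ∈ G, #{u ∈ H | p i u} := by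
  simp only [card_filter]
  exact sum_product _ _ _

namespace FourPart

variable {D : C → V → V → Prop} {C2 P P' : Finset V} {Bad : Finset C} {s r : ℕ}

/-- The vertices of `P` missing many edges to `C2`. -/
noncomputable def low (D : C → V → V → Prop) (C2 P : Finset V) (G : Finset C) : Finset V :=
  {v ∈ P | #G * #C2 < 8 * #{c ∈ G ×ˢ C2 | ¬ D c.1 v c.2}}

/-- The vertices of `P` sending many edges to `P'`. -/
noncomputable def rich (D : C → V → V → Prop) (C2 P P' : Finset V) (G : Finset C) : Finset V :=
  {v ∈ P | #C2 * Fintype.card V ≤ 400 * #{c ∈ G ×ˢ P' | D c.1 v c.2}}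

lemma card_low (h : FourPart D C2 P P' Bad s r) {G : Finset C} (hG : Disjoint G Bad)
    (h0 : 0 < #G * #C2) : #(low D C2 P G) ≤ 8 * s := by
  have h1 : #(low D C2 P G) * (#G * #C2) ≤ 8 * (s * (#G * #C2)) := by
    calc _ = ∑ _v ∈ low D C2 P G, #G * #C2 := by rw [sum_const, smul_eq_mul]
      _ ≤ ∑ v ∈ low D C2 P G, 8 * #{c ∈ G ×ˢ C2 | ¬ D c.1 v c.2} :=
          sum_le_sum fun v hv => (mem_filter.1 hv).2.le
      _ ≤ ∑ v ∈ P, 8 * #{c ∈ G ×ˢ C2 | ¬ D c.1 v c.2} :=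
          sum_le_sum_of_subset (filter_subset _ _)
      _ ≤ _ := by
          rw [← mul_sum]
          exact Nat.mul_le_mul_left _ (h.sum_miss hG subset_rfl)
  rw [← mul_assoc 8] at h1
  exact Nat.le_of_mul_le_mul_right h1 h0

lemma low_subset_rich (h : FourPart D C2 P P' Bad s r) {G : Finset C}
    (hG : Fintype.card V ≤ 50 * #G) : low D C2 P G ⊆ rich D C2 P P' G := by
  intro v hv
  obtain ⟨hvP, hv⟩ := mem_filter.1 hv
  refine mem_filter.2 ⟨hvP, ?_⟩
  have h1 : #{c ∈ G ×ˢ C2 | ¬ D c.1 v c.2} ≤ #{c ∈ G ×ˢ P' | D c.1 v c.2} := by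
    rw [card_filter_product_eq_sum G C2 fun i u => ¬ D i v u,
      card_filter_product_eq_sum G P' fun i u => D i v u]
    refine sum_le_sum fun i _ => ?_
    have h2 := h.out i v
    have h3 : #{y | D i v y} ≤ #{y ∈ P' | D i v y} + (#{y ∈ C2 | D i v y} + #(C2 ∪ P')ᶜ) := by
      refine le_trans (card_le_card fun y hy => ?_) ((card_union_le _ _).trans
        (Nat.add_le_add_left (card_union_le _ _) _))
      simp only [mem_filter, mem_univ, true_and, mem_union, mem_compl] at hy ⊢
      tauto
    have h4 := card_compl_add_card (C2 ∪ P')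
    rw [card_union_of_disjoint h.disj'] at h4
    have h5 := card_filter_add_card_filter_not (s := C2) (fun y => D i v y)
    have := h.card_P'
    omega
  have h6 : Fintype.card V * #C2 ≤ 50 * #G * #C2 := Nat.mul_le_mul_right _ hG
  nlinarith

lemma exists_fresh_out (h : FourPart D C2 P P' Bad s r) {K G : Finset C} {U : Finset V} {t : ℕ}
    (hU : #U ≤ t) (hK : Fintype.card C ≤ #K + t) (hG : Disjoint G Bad) (hGt : t < #G)
    (ht : t < (Fintype.card V + 1) / 2) {u : V} (hu : u ∈ C2) :
    ∃ i ∈ K, i ∈ G ∧ ∃ y ∈ P', y ∉ U ∧ D i u y := by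
  obtain ⟨i, hi⟩ : (G \ Kᶜ).Nonempty := by
    rw [← card_pos]
    have := le_card_sdiff Kᶜ G
    have := card_compl_add_card K
    omega
  simp only [mem_sdiff, mem_compl, not_not] at hi
  refine ⟨i, hi.2, hi.1, ?_⟩
  by_contra! hno
  have h1 := h.card_miss (Finset.disjoint_left.1 hG hi.1) hu
  have h2 : #P' ≤ #{y ∈ P' | ¬ D i u y} + #U := by
    refine le_trans (card_le_card fun y hy => ?_) (card_union_le _ _)
    have := hno y hy
    simp only [mem_filter, mem_union]
    tauto
  have := h.card_P'
  omega

lemma exists_fresh_of_rich {K G : Finset C} {U : Finset V} {t : ℕ}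
    (hVC : Fintype.card C = Fintype.card V)
    (hU : #U ≤ t) (hK : Fintype.card C ≤ #K + t)
    (ht : 800 * t < #C2) {v : V} (hv : v ∈ rich D C2 P P' G) :
    ∃ i ∈ K, i ∈ G ∧ ∃ y ∈ P', y ∉ U ∧ D i v y := by
  by_contra! hno
  have hv := (mem_filter.1 hv).2
  have h1 : #{c ∈ G ×ˢ P' | D c.1 v c.2} ≤ #(Kᶜ ×ˢ P') + #(G ×ˢ U) := by
    refine le_trans (card_le_card fun c hc => ?_) (card_union_le _ _)
    simp only [mem_filter, mem_product, mem_union, mem_compl] at hc ⊢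
    have := fun h1 h2 => hno c.1 h1 hc.1.1 c.2 hc.1.2 h2
    tauto
  simp only [card_product] at h1
  have h2 := card_compl_add_card K
  have h3 : #Kᶜ ≤ t := by omega
  have h4 : #G ≤ Fintype.card V := hVC ▸ card_le_univ G
  have h5 : #P' ≤ Fintype.card V := card_le_univ P'
  have h6 : #Kᶜ * #P' + #G * #U ≤ t * Fintype.card V + Fintype.card V * t := by gcongr
  have hn : 0 < Fintype.card V := by
    have : #C2 ≤ Fintype.card V := card_le_univ C2
    omega
  nlinarith

lemma exists_edge_of_deficit (h : FourPart D C2 P P' Bad s r) {K G : Finset C} {A B U : Finset V}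
    {β : ℕ} (hβ : 1 ≤ β) (hB : β + #B ≤ r + Fintype.card V % 2)
    (hrich : rich (fun i x y => D i y x) C2 P' P G ⊆ B) (hU : #U ≤ 4 * β)
    (hG : Fintype.card V ≤ 2 * #(G ∩ K)) (hM : Fintype.card V ≤ 4 * #((P \ A) \ U))
    (hn : 0 < Fintype.card V) :
    ∃ i ∈ K, i ∈ G ∧ ∃ x ∈ P, x ∉ A ∧ x ∉ U ∧ ∃ y ∈ P', y ∉ B ∧ y ∉ U ∧ D i x y := by
  by_contra! hno
  set M := (P \ A) \ U with hMdef
  set W := (U ∩ P') \ B with hW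
  have h1 : #((G ∩ K) ×ˢ M) * β ≤ ∑ y ∈ W, #{c ∈ G ×ˢ P | D c.1 c.2 y} := by
    calc #((G ∩ K) ×ˢ M) * β = ∑ _c ∈ (G ∩ K) ×ˢ M, β := by rw [sum_const, smul_eq_mul]
      _ ≤ ∑ c ∈ (G ∩ K) ×ˢ M, #{y ∈ W | D c.1 c.2 y} := by
          refine sum_le_sum fun c hc => ?_
          simp only [mem_product, mem_inter, hMdef, mem_sdiff] at hc
          have h2 := h.le_card_out c.1 c.2
          have h3 : #{y ∈ P' | D c.1 c.2 y} ≤ #{y ∈ W | D c.1 c.2 y} + #B := by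
            refine le_trans (card_le_card fun y hy => ?_) (card_union_le _ _)
            rw [mem_filter] at hy
            have := hno c.1 hc.1.2 hc.1.1 c.2 hc.2.1.1 hc.2.1.2 hc.2.2 y hy.1
            simp only [hW, mem_filter, mem_union, mem_sdiff, mem_inter]
            tauto
          omega
      _ = ∑ y ∈ W, #{c ∈ (G ∩ K) ×ˢ M | D c.1 c.2 y} :=
          sum_card_bipartiteAbove_eq_sum_card_bipartiteBelow (fun (c : C × V) y => D c.1 c.2 y)
      _ ≤ _ := by
          gcongr with y hy
          · exact inter_subset_left
          · exact sdiff_subset.trans sdiff_subset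
  have h2 : 400 * ∑ y ∈ W, #{c ∈ G ×ˢ P | D c.1 c.2 y} ≤ #W * (#C2 * Fintype.card V) := by
    rw [mul_sum, ← smul_eq_mul #W, ← sum_const]
    refine sum_le_sum fun y hy => ?_
    by_contra! hcon
    simp only [hW, mem_sdiff, mem_inter] at hy
    exact hy.2 (hrich (mem_filter.2 ⟨hy.1.2, hcon.le⟩))
  have h3 : #W * (#C2 * Fintype.card V) ≤ (4 * β) * (Fintype.card V * Fintype.card V) := by
    gcongr
    · exact (card_le_card (sdiff_subset.trans inter_subset_left)).trans hU
    · exact card_le_univ C2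
  rw [card_product] at h1
  have h4 : Fintype.card V * Fintype.card V ≤ (2 * #(G ∩ K)) * (4 * #M) := by gcongr
  have h5 : 50 * (β * (Fintype.card V * Fintype.card V)) ≤ 400 * (#(G ∩ K) * #M * β) := by
    calc _ ≤ 50 * (β * ((2 * #(G ∩ K)) * (4 * #M))) := by gcongr
      _ = _ := by ring
  have h6 : 0 < β * (Fintype.card V * Fintype.card V) := by positivity
  nlinarith

/-- The colour `j` has no edges between `P` and the complement of `P'` or vice versa, apart from
those at a small set of vertices. -/
def Poor (D : C → V → V → Prop) (P P' : Finset V) (N : ℕ) (j : C) : Prop :=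
  ∃ U₀ : Finset V, #U₀ ≤ N ∧ ∀ x ∉ U₀, ∀ y ∉ U₀, D j x y → (x ∈ P ↔ y ∈ P')

lemma exists_poor_edge (h : FourPart D C2 P P' Bad s r) {N : ℕ} {j : C} (hj : Poor D P P' N j)
    {U S : Finset V} (hU : #U ≤ N) (hN : 2 * N < (Fintype.card V + 1) / 2) (hS : 2 * N < #S) :
    ∃ x ∈ S, x ∉ U ∧ ∃ y ∉ U, D j x y ∧ (x ∈ P ↔ y ∈ P') := by
  obtain ⟨U₀, hU₀, hj⟩ := hj
  have h0 := card_union_le U U₀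
  obtain ⟨x, hx⟩ : (S \ (U ∪ U₀)).Nonempty := by
    rw [← card_pos]
    have := le_card_sdiff (U ∪ U₀) S
    omega
  obtain ⟨y, hy⟩ : (({y | D j x y} : Finset V) \ (U ∪ U₀)).Nonempty := by
    rw [← card_pos]
    have := le_card_sdiff (U ∪ U₀) ({y | D j x y} : Finset V)
    have := h.out j x
    omega
  simp only [mem_sdiff, mem_union, not_or, mem_filter, mem_univ, true_and] at hx hy
  exact ⟨x, hx.1, hx.2.1, y, hy.2.1, hy.1, hj x hx.2.2 y hy.2.2 hy.1⟩

end FourPart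

end Extremal

section Stages

set_option linter.unusedSectionVars false

open scoped Classical

variable {V C : Type} [Fintype V] [Fintype C] [DecidableEq V] [DecidableEq C]

/-- A partially built path system after at most `t` vertices have been touched. The touched
vertices of `C2 ∪ ML` still lacking an out-edge form `XL`, those of `C2 ∪ MR` still lacking an
in-edge form `XR`; the vertices of `H` are untouched and the colours of `G` unused, `J` is the set
of unused exceptional colours, and `b` is the number of edges from `P` to `P'` to be added in
excess of those between the complements. -/
structure Stage (D : C → V → V → Prop) (C2 P P' : Finset V) (Bad : Finset C) (ML MR : Finset V)
    (t : ℕ) (b : ℤ) (XL XR H : Finset V) (J G : Finset C) (I L : Finset V) (K : Finset C)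
    (U : Finset V) : Prop where
  path : PathState D I L K U
  card_U : #U ≤ t
  card_K : Fintype.card C ≤ #K + t
  bal : (#{x ∈ L | x ∈ P} : ℤ) + #{y ∈ I | y ∈ P'} = #I + b
  ML_sub : ML ⊆ U
  MR_sub : MR ⊆ U
  mem_XL : ∀ z, z ∈ XL ↔ z ∈ U ∧ z ∈ L ∧ (z ∈ C2 ∨ z ∈ ML)
  mem_XR : ∀ z, z ∈ XR ↔ z ∈ U ∧ z ∈ I ∧ (z ∈ C2 ∨ z ∈ MR)
  mem_J : ∀ j, j ∈ J ↔ j ∈ K ∧ j ∈ Bad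
  disj_H : Disjoint H U
  G_sub : G ⊆ K

/-- Some stage with the given parameters can be reached. -/
def Reach (D : C → V → V → Prop) (C2 P P' : Finset V) (Bad : Finset C) (ML MR : Finset V)
    (t : ℕ) (b : ℤ) (XL XR H : Finset V) (J G : Finset C) : Prop :=
  ∃ I L K U, Stage D C2 P P' Bad ML MR t b XL XR H J G I L K U

variable {D : C → V → V → Prop} {C2 P P' : Finset V} {Bad : Finset C} {ML MR : Finset V}
  {t : ℕ} {b : ℤ} {XL XR H : Finset V} {J G : Finset C} {I L : Finset V} {K : Finset C}
  {U : Finset V}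

set_option maxHeartbeats 1000000 in
lemma Stage.step (S : Stage D C2 P P' Bad ML MR t b XL XR H J G I L K U) {x y : V} {i : C}
    (hx : x ∈ L) (hy : y ∈ I) (hxy : x ≠ y) (hf : x ∉ U ∨ y ∉ U) (hi : i ∈ K) (hD : D i x y)
    {b' : ℤ} {XL' XR' H' : Finset V} {J' G' : Finset C}
    (hb : b' = b + 1 - (if x ∈ P then 1 else 0) - (if y ∈ P' then 1 else 0))
    (hXL : ∀ z, z ∈ XL' ↔ z ≠ x ∧ (z ∈ XL ∨ z = y ∧ y ∈ C2 ∧ y ∈ L))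
    (hXR : ∀ z, z ∈ XR' ↔ z ≠ y ∧ (z ∈ XR ∨ z = x ∧ x ∈ C2 ∧ x ∈ I))
    (hJ : J' = J.erase i) (hH : ∀ z ∈ H', z ∈ H ∧ z ≠ x ∧ z ≠ y)
    (hG : ∀ j ∈ G', j ∈ G ∧ j ≠ i) :
    Stage D C2 P P' Bad ML MR (t + 2) b' XL' XR' H' J' G' (I.erase y) (L.erase x) (K.erase i)
      (U ∪ {x, y}) where
  path := S.path.step hx hy hxy hf hi hD
  card_U := (card_union_le _ _).trans (add_le_add S.card_U card_le_two)
  card_K := by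
    have := S.card_K
    have := card_erase_add_one hi
    omega
  bal := by
    have h0 := S.bal
    have h1 : (#{z ∈ L.erase x | z ∈ P} : ℤ) = #{z ∈ L | z ∈ P} - (if x ∈ P then 1 else 0) := by
      rw [filter_erase]
      split_ifs with h
      · have := card_erase_add_one (s := {z ∈ L | z ∈ P}) (mem_filter.2 ⟨hx, h⟩)
        omega
      · rw [erase_eq_of_notMem (by simp [h])]
        omega
    have h2 : (#{z ∈ I.erase y | z ∈ P'} : ℤ) =
        #{z ∈ I | z ∈ P'} - (if y ∈ P' then 1 else 0) := by
      rw [filter_erase]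
      split_ifs with h
      · have := card_erase_add_one (s := {z ∈ I | z ∈ P'}) (mem_filter.2 ⟨hy, h⟩)
        omega
      · rw [erase_eq_of_notMem (by simp [h])]
        omega
    have h3 := card_erase_add_one hy
    rw [h1, h2, hb]
    split_ifs <;> omega
  ML_sub := S.ML_sub.trans subset_union_left
  MR_sub := S.MR_sub.trans subset_union_left
  mem_XL := fun z => by
    rw [hXL, S.mem_XL]
    have := @S.ML_sub z
    simp only [mem_union, mem_erase, mem_insert, mem_singleton]
    constructor
    · rintro ⟨h1, h2 | ⟨rfl, h2, h3⟩⟩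
      · tauto
      · tauto
    · rintro ⟨h1 | h1 | rfl, h2, h3⟩ <;> tauto
  mem_XR := fun z => by
    rw [hXR, S.mem_XR]
    have := @S.MR_sub z
    simp only [mem_union, mem_erase, mem_insert, mem_singleton]
    constructor
    · rintro ⟨h1, h2 | ⟨rfl, h2, h3⟩⟩
      · tauto
      · tauto
    · rintro ⟨h1 | rfl | h1, h2, h3⟩ <;> tauto
  mem_J := fun j => by
    rw [hJ, mem_erase, mem_erase, S.mem_J]
    tauto
  disj_H := by
    rw [Finset.disjoint_left]
    intro z hz
    have h1 := hH z hz
    have h2 := Finset.disjoint_left.1 S.disj_H h1.1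
    simp only [mem_union, mem_insert, mem_singleton]
    tauto
  G_sub := fun j hj => by
    have := hG j hj
    exact mem_erase.2 ⟨this.2, S.G_sub this.1⟩

lemma Reach.out_fresh {v : V} (hv : v ∉ XL) {b' : ℤ} (hb : b' = b - if v ∈ P then 1 else 0)
    (hP' : Disjoint C2 P') (hH : H ⊆ C2) (hHv : v ∉ H)
    (hex : ∀ (K : Finset C) (U : Finset V), #U ≤ t → Fintype.card C ≤ #K + t →
      ∃ i ∈ K, i ∉ Bad ∧ i ∉ G ∧ ∃ y ∈ P', y ∉ U ∧ D i v y)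
    (hR : Reach D C2 P P' Bad ML MR t b (insert v XL) XR H J G) :
    Reach D C2 P P' Bad ML MR (t + 2) b' XL XR H J G := by
  obtain ⟨I, L, K, U, S⟩ := hR
  obtain ⟨i, hi, hiB, hiG, y, hyP, hyU, hD⟩ := hex K U S.card_U S.card_K
  have hvU := (S.mem_XL v).1 (mem_insert_self _ _)
  have hyC : y ∉ C2 := fun h => Finset.disjoint_left.1 hP' h hyP
  refine ⟨_, _, _, _, S.step hvU.2.1 (S.path.mem_left hyU) (by rintro rfl; exact hyU hvU.1)
    (Or.inr hyU) hi hD (by simp [hb, hyP]; ring) ?_ ?_ ?_ ?_ ?_⟩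
  · intro z
    rw [mem_insert]
    constructor
    · intro hz
      exact ⟨by rintro rfl; exact hv hz, Or.inl (Or.inr hz)⟩
    · rintro ⟨h1, (h2 | h2) | ⟨rfl, h2, -⟩⟩
      · exact absurd h2 h1
      · exact h2
      · exact absurd h2 hyC
  · intro z
    constructor
    · intro hz
      exact ⟨by rintro rfl; exact hyU ((S.mem_XR z).1 hz).1, Or.inl hz⟩
    · rintro ⟨h1, h2 | ⟨rfl, h2, h3⟩⟩
      · exact h2
      · exact (S.mem_XR z).2 ⟨hvU.1, h3, Or.inl h2⟩
  · rw [erase_eq_of_notMem fun h => hiB ((S.mem_J i).1 h).2]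
  · exact fun z hz => ⟨hz, by rintro rfl; exact hHv hz, by rintro rfl; exact hyC (hH hz)⟩
  · exact fun j hj => ⟨hj, by rintro rfl; exact hiG hj⟩

lemma Reach.in_fresh {v : V} (hv : v ∉ XR) {b' : ℤ} (hb : b' = b - if v ∈ P' then 1 else 0)
    (hP : Disjoint C2 P) (hH : H ⊆ C2) (hHv : v ∉ H)
    (hex : ∀ (K : Finset C) (U : Finset V), #U ≤ t → Fintype.card C ≤ #K + t →
      ∃ i ∈ K, i ∉ Bad ∧ i ∉ G ∧ ∃ x ∈ P, x ∉ U ∧ D i x v)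
    (hR : Reach D C2 P P' Bad ML MR t b XL (insert v XR) H J G) :
    Reach D C2 P P' Bad ML MR (t + 2) b' XL XR H J G := by
  obtain ⟨I, L, K, U, S⟩ := hR
  obtain ⟨i, hi, hiB, hiG, x, hxP, hxU, hD⟩ := hex K U S.card_U S.card_K
  have hvU := (S.mem_XR v).1 (mem_insert_self _ _)
  have hxC : x ∉ C2 := fun h => Finset.disjoint_left.1 hP h hxP
  refine ⟨_, _, _, _, S.step (S.path.mem_right hxU) hvU.2.1 (by rintro rfl; exact hxU hvU.1)
    (Or.inl hxU) hi hD (by simp [hb, hxP]) ?_ ?_ ?_ ?_ ?_⟩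
  · intro z
    constructor
    · intro hz
      exact ⟨by rintro rfl; exact hxU ((S.mem_XL z).1 hz).1, Or.inl hz⟩
    · rintro ⟨h1, h2 | ⟨rfl, h2, h3⟩⟩
      · exact h2
      · exact (S.mem_XL z).2 ⟨hvU.1, h3, Or.inl h2⟩
  · intro z
    rw [mem_insert]
    constructor
    · intro hz
      exact ⟨by rintro rfl; exact hv hz, Or.inl (Or.inr hz)⟩
    · rintro ⟨h1, (h2 | h2) | ⟨rfl, h2, -⟩⟩
      · exact absurd h2 h1
      · exact h2
      · exact absurd h2 hxC
  · rw [erase_eq_of_notMem fun h => hiB ((S.mem_J i).1 h).2]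
  · exact fun z hz => ⟨hz, by rintro rfl; exact hxC (hH hz), by rintro rfl; exact hHv hz⟩
  · exact fun j hj => ⟨hj, by rintro rfl; exact hiG hj⟩

lemma Reach.clear_out {N : ℕ} {X : Finset V} (hP' : Disjoint C2 P') (hH : H ⊆ C2)
    (hX : Disjoint X H) (hex : ∀ v ∈ X, ∀ (K : Finset C) (U : Finset V), #U ≤ N →
      Fintype.card C ≤ #K + N → ∃ i ∈ K, i ∉ Bad ∧ i ∉ G ∧ ∃ y ∈ P', y ∉ U ∧ D i v y)
    (ht : t + 2 * #X ≤ N) (hR : Reach D C2 P P' Bad ML MR t b X XR H J G) :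
    Reach D C2 P P' Bad ML MR (t + 2 * #X) (b - #{v ∈ X | v ∈ P}) ∅ XR H J G := by
  induction X using Finset.induction_on generalizing t b with
  | empty => simpa using hR
  | insert v X hv ih =>
    rw [card_insert_of_notMem hv] at ht ⊢
    have h1 := hR.out_fresh hv rfl hP' hH (Finset.disjoint_left.1 hX (mem_insert_self _ _))
      fun K U hU hK => hex v (mem_insert_self _ _) K U (by omega) (by omega)
    have h2 := ih (disjoint_of_subset_left (subset_insert _ _) hX)
      (fun v hv => hex v (mem_insert_of_mem hv)) (by omega) h1
    convert h2 using 1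
    · ring
    · rw [filter_insert]
      split_ifs with h
      · rw [card_insert_of_notMem (by simp [hv])]
        push_cast
        ring
      · ring

lemma Reach.clear_in {N : ℕ} {X : Finset V} (hP : Disjoint C2 P) (hH : H ⊆ C2)
    (hX : Disjoint X H) (hex : ∀ v ∈ X, ∀ (K : Finset C) (U : Finset V), #U ≤ N →
      Fintype.card C ≤ #K + N → ∃ i ∈ K, i ∉ Bad ∧ i ∉ G ∧ ∃ x ∈ P, x ∉ U ∧ D i x v)
    (ht : t + 2 * #X ≤ N) (hR : Reach D C2 P P' Bad ML MR t b XL X H J G) :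
    Reach D C2 P P' Bad ML MR (t + 2 * #X) (b - #{v ∈ X | v ∈ P'}) XL ∅ H J G := by
  induction X using Finset.induction_on generalizing t b with
  | empty => simpa using hR
  | insert v X hv ih =>
    rw [card_insert_of_notMem hv] at ht ⊢
    have h1 := hR.in_fresh hv rfl hP hH (Finset.disjoint_left.1 hX (mem_insert_self _ _))
      fun K U hU hK => hex v (mem_insert_self _ _) K U (by omega) (by omega)
    have h2 := ih (disjoint_of_subset_left (subset_insert _ _) hX)
      (fun v hv => hex v (mem_insert_of_mem hv)) (by omega) h1
    convert h2 using 1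
    · ring
    · rw [filter_insert]
      split_ifs with h
      · rw [card_insert_of_notMem (by simp [hv])]
        push_cast
        ring
      · ring

/-- Giving a pending vertex of `P` an out-edge to a reserved vertex of `C2` in a reserved colour. -/
lemma Reach.out_match {v u : V} {i : C} (hv : v ∉ XL) (hvP : v ∈ P) (hu : u ∈ C2)
    (hP : Disjoint C2 P) (hP' : Disjoint C2 P') (hH : H ⊆ C2) (huH : u ∉ H) (hi : i ∉ G)
    (hiB : i ∉ Bad) (hD : D i v u)
    (hR : Reach D C2 P P' Bad ML MR t b (insert v XL) XR (insert u H) J (insert i G)) :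
    Reach D C2 P P' Bad ML MR (t + 2) b (insert u XL) XR H J G := by
  obtain ⟨I, L, K, U, S⟩ := hR
  have hvU := (S.mem_XL v).1 (mem_insert_self _ _)
  have huU : u ∉ U := Finset.disjoint_left.1 S.disj_H (mem_insert_self _ _)
  have huP : u ∉ P := fun h => Finset.disjoint_left.1 hP hu h
  have huP' : u ∉ P' := fun h => Finset.disjoint_left.1 hP' hu h
  have hvC : v ∉ C2 := fun h => Finset.disjoint_left.1 hP h hvP
  have huv : u ≠ v := by rintro rfl; exact huU hvU.1
  refine ⟨_, _, _, _, S.step hvU.2.1 (S.path.mem_left huU) huv.symm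
    (Or.inr huU) (S.G_sub (mem_insert_self _ _)) hD (by simp [hvP, huP']) ?_ ?_ ?_ ?_ ?_⟩
  · intro z
    rw [mem_insert, mem_insert]
    constructor
    · rintro (rfl | hz)
      · exact ⟨huv, Or.inr ⟨rfl, hu, S.path.mem_right huU⟩⟩
      · exact ⟨by rintro rfl; exact hv hz, Or.inl (Or.inr hz)⟩
    · rintro ⟨h1, (h2 | h2) | h2⟩
      · exact absurd h2 h1
      · exact Or.inr h2
      · exact Or.inl h2.1
  · intro z
    constructor
    · intro hz
      exact ⟨by rintro rfl; exact huU ((S.mem_XR z).1 hz).1, Or.inl hz⟩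
    · rintro ⟨h1, h2 | h2⟩
      · exact h2
      · exact absurd h2.2.1 hvC
  · rw [erase_eq_of_notMem fun h => hiB ((S.mem_J i).1 h).2]
  · exact fun z hz => ⟨mem_insert_of_mem hz, by rintro rfl; exact hvC (hH hz),
      by rintro rfl; exact huH hz⟩
  · exact fun j hj => ⟨mem_insert_of_mem hj, by rintro rfl; exact hi hj⟩

lemma Reach.in_match {v u : V} {i : C} (hv : v ∉ XR) (hvP : v ∈ P') (hu : u ∈ C2)
    (hP : Disjoint C2 P) (hP' : Disjoint C2 P') (hH : H ⊆ C2) (huH : u ∉ H) (hi : i ∉ G)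
    (hiB : i ∉ Bad) (hD : D i u v)
    (hR : Reach D C2 P P' Bad ML MR t b XL (insert v XR) (insert u H) J (insert i G)) :
    Reach D C2 P P' Bad ML MR (t + 2) b XL (insert u XR) H J G := by
  obtain ⟨I, L, K, U, S⟩ := hR
  have hvU := (S.mem_XR v).1 (mem_insert_self _ _)
  have huU : u ∉ U := Finset.disjoint_left.1 S.disj_H (mem_insert_self _ _)
  have huP : u ∉ P := fun h => Finset.disjoint_left.1 hP hu h
  have hvC : v ∉ C2 := fun h => Finset.disjoint_left.1 hP' h hvP
  have huv : u ≠ v := by rintro rfl; exact huU hvU.1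
  refine ⟨_, _, _, _, S.step (S.path.mem_right huU) hvU.2.1 huv
    (Or.inl huU) (S.G_sub (mem_insert_self _ _)) hD (by simp [hvP, huP]) ?_ ?_ ?_ ?_ ?_⟩
  · intro z
    constructor
    · intro hz
      exact ⟨by rintro rfl; exact huU ((S.mem_XL z).1 hz).1, Or.inl hz⟩
    · rintro ⟨h1, h2 | h2⟩
      · exact h2
      · exact absurd h2.2.1 hvC
  · intro z
    rw [mem_insert, mem_insert]
    constructor
    · rintro (rfl | hz)
      · exact ⟨huv, Or.inr ⟨rfl, hu, S.path.mem_left huU⟩⟩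
      · exact ⟨by rintro rfl; exact hv hz, Or.inl (Or.inr hz)⟩
    · rintro ⟨h1, (h2 | h2) | h2⟩
      · exact absurd h2 h1
      · exact Or.inr h2
      · exact Or.inl h2.1
  · rw [erase_eq_of_notMem fun h => hiB ((S.mem_J i).1 h).2]
  · exact fun z hz => ⟨mem_insert_of_mem hz, by rintro rfl; exact huH hz,
      by rintro rfl; exact hvC (hH hz)⟩
  · exact fun j hj => ⟨mem_insert_of_mem hj, by rintro rfl; exact hi hj⟩

lemma Reach.out_matching {T : Finset V} {f : V → C} {g : V → V} (hP : Disjoint C2 P)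
    (hP' : Disjoint C2 P') (hH : H ⊆ C2) (hTP : T ⊆ P) (hf : Set.InjOn f T) (hg : Set.InjOn g T)
    (hfG : ∀ v ∈ T, f v ∉ G ∧ f v ∉ Bad) (hgH : ∀ v ∈ T, g v ∉ H ∧ g v ∈ C2)
    (hD : ∀ v ∈ T, D (f v) v (g v)) (hX : Disjoint T XL)
    (hR : Reach D C2 P P' Bad ML MR t b (XL ∪ T) XR (H ∪ T.image g) J (G ∪ T.image f)) :
    Reach D C2 P P' Bad ML MR (t + 2 * #T) b (XL ∪ T.image g) XR H J G := by
  induction T using Finset.induction_on generalizing t XL with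
  | empty => simpa using hR
  | insert v T hv ih =>
    have hvm := mem_insert_self v T
    have hsub := subset_insert v T
    rw [coe_insert] at hf hg
    have hgv : g v ∉ T.image g := by
      rw [mem_image]
      rintro ⟨w, hw, h⟩
      exact hv (hg (Set.mem_insert_of_mem _ hw) (Set.mem_insert _ _) h ▸ hw)
    have hfv : f v ∉ T.image f := by
      rw [mem_image]
      rintro ⟨w, hw, h⟩
      exact hv (hf (Set.mem_insert_of_mem _ hw) (Set.mem_insert _ _) h ▸ hw)
    have hvX : v ∉ XL := Finset.disjoint_left.1 hX hvm
    rw [image_insert, image_insert, union_insert, union_insert, union_insert] at hR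
    have h1 := hR.out_match (by simp [hv, hvX]) (hTP hvm) (hgH v hvm).2 hP hP'
      (union_subset hH (image_subset_iff.2 fun w hw => (hgH w (hsub hw)).2))
      (by simpa [(hgH v hvm).1] using hgv) (by simpa [(hfG v hvm).1] using hfv) (hfG v hvm).2
      (hD v hvm)
    rw [← insert_union] at h1
    have h2 := ih (hsub.trans hTP) (hf.mono (Set.subset_insert _ _))
      (hg.mono (Set.subset_insert _ _)) (fun w hw => hfG w (hsub hw))
      (fun w hw => hgH w (hsub hw)) (fun w hw => hD w (hsub hw)) (by
        rw [disjoint_insert_right]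
        exact ⟨fun h => Finset.disjoint_left.1 hP (hgH v hvm).2 (hTP (hsub h)),
          disjoint_of_subset_left hsub hX⟩) h1
    convert h2 using 1
    · rw [card_insert_of_notMem hv]
      ring
    · rw [image_insert, union_insert, insert_union]

lemma Reach.in_matching {T : Finset V} {f : V → C} {g : V → V} (hP : Disjoint C2 P)
    (hP' : Disjoint C2 P') (hH : H ⊆ C2) (hTP : T ⊆ P') (hf : Set.InjOn f T) (hg : Set.InjOn g T)
    (hfG : ∀ v ∈ T, f v ∉ G ∧ f v ∉ Bad) (hgH : ∀ v ∈ T, g v ∉ H ∧ g v ∈ C2)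
    (hD : ∀ v ∈ T, D (f v) (g v) v) (hX : Disjoint T XR)
    (hR : Reach D C2 P P' Bad ML MR t b XL (XR ∪ T) (H ∪ T.image g) J (G ∪ T.image f)) :
    Reach D C2 P P' Bad ML MR (t + 2 * #T) b XL (XR ∪ T.image g) H J G := by
  induction T using Finset.induction_on generalizing t XR with
  | empty => simpa using hR
  | insert v T hv ih =>
    have hvm := mem_insert_self v T
    have hsub := subset_insert v T
    rw [coe_insert] at hf hg
    have hgv : g v ∉ T.image g := by
      rw [mem_image]
      rintro ⟨w, hw, h⟩
      exact hv (hg (Set.mem_insert_of_mem _ hw) (Set.mem_insert _ _) h ▸ hw)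
    have hfv : f v ∉ T.image f := by
      rw [mem_image]
      rintro ⟨w, hw, h⟩
      exact hv (hf (Set.mem_insert_of_mem _ hw) (Set.mem_insert _ _) h ▸ hw)
    have hvX : v ∉ XR := Finset.disjoint_left.1 hX hvm
    rw [image_insert, image_insert, union_insert, union_insert, union_insert] at hR
    have h1 := hR.in_match (by simp [hv, hvX]) (hTP hvm) (hgH v hvm).2 hP hP'
      (union_subset hH (image_subset_iff.2 fun w hw => (hgH w (hsub hw)).2))
      (by simpa [(hgH v hvm).1] using hgv) (by simpa [(hfG v hvm).1] using hfv) (hfG v hvm).2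
      (hD v hvm)
    rw [← insert_union] at h1
    have h2 := ih (hsub.trans hTP) (hf.mono (Set.subset_insert _ _))
      (hg.mono (Set.subset_insert _ _)) (fun w hw => hfG w (hsub hw))
      (fun w hw => hgH w (hsub hw)) (fun w hw => hD w (hsub hw)) (by
        rw [disjoint_insert_right]
        exact ⟨fun h => Finset.disjoint_left.1 hP' (hgH v hvm).2 (hTP (hsub h)),
          disjoint_of_subset_left hsub hX⟩) h1
    convert h2 using 1
    · rw [card_insert_of_notMem hv]
      ring
    · rw [image_insert, union_insert, insert_union]

end Stages

section Phases

set_option linter.unusedSectionVars false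

open scoped Classical

variable {V C : Type} [Fintype V] [Fintype C] [DecidableEq V] [DecidableEq C]
variable {D : C → V → V → Prop} {C2 P P' : Finset V} {Bad : Finset C} {ML MR : Finset V}
  {t : ℕ} {b : ℤ} {XL XR H : Finset V} {J G : Finset C} {I L : Finset V} {K : Finset C}
  {U : Finset V} {s r : ℕ}

lemma Reach.mono (hR : Reach D C2 P P' Bad ML MR t b XL XR H J G) {t' : ℕ} (ht : t ≤ t') :
    Reach D C2 P P' Bad ML MR t' b XL XR H J G := by
  obtain ⟨I, L, K, U, S⟩ := hR
  exact ⟨I, L, K, U, { S with card_U := S.card_U.trans ht, card_K := S.card_K.trans (by omega) }⟩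

lemma Stage.init (h : Fintype.card C = Fintype.card V)
    (hb : (#P + #P' : ℤ) = Fintype.card V + b) :
    Stage D C2 P P' Bad ∅ ∅ 0 b ∅ ∅ H Bad G univ univ univ ∅ where
  path := PathState.init h
  card_U := by simp
  card_K := by simp
  bal := by
    rw [card_univ, ← hb]
    congr 3 <;> ext <;> simp
  ML_sub := subset_rfl
  MR_sub := subset_rfl
  mem_XL := by simp
  mem_XR := by simp
  mem_J := by simp
  disj_H := disjoint_empty_right _
  G_sub := subset_univ _

/-- Using up an exceptional colour. -/
lemma Reach.use_bad (h : FourPart D C2 P P' Bad s r) {N : ℕ}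
    (hfo : ∀ u ∈ C2, ∀ (K : Finset C) (U : Finset V), #U ≤ N →
      Fintype.card C ≤ #K + N → ∃ i ∈ K, i ∉ Bad ∧ ∃ y ∈ P', y ∉ U ∧ D i u y)
    (hfi : ∀ u ∈ C2, ∀ (K : Finset C) (U : Finset V), #U ≤ N →
      Fintype.card C ≤ #K + N → ∃ i ∈ K, i ∉ Bad ∧ ∃ x ∈ P, x ∉ U ∧ D i x u)
    {j : C} (hj : j ∈ J) (ht : t + 6 ≤ N) {b' : ℤ}
    (hex : ∀ U : Finset V, #U ≤ t → ∃ x ∉ U, ∃ y ∉ U, D j x y ∧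
      b' = b + 1 - (if x ∈ P then 1 else 0) - (if y ∈ P' then 1 else 0))
    (hR : Reach D C2 P P' Bad ML MR t b ∅ ∅ ∅ J ∅) :
    Reach D C2 P P' Bad ML MR (t + 6) b' ∅ ∅ ∅ (J.erase j) ∅ := by
  obtain ⟨I, L, K, U, S⟩ := hR
  obtain ⟨x, hx, y, hy, hD, hb⟩ := hex U S.card_U
  have hxy : x ≠ y := by rintro rfl; exact h.loopless _ _ hD
  have S1 := S.step (XL' := {z ∈ {y} | z ∈ C2}) (XR' := {z ∈ {x} | z ∈ C2}) (H' := ∅) (G' := ∅)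
    (S.path.mem_right hx) (S.path.mem_left hy) hxy (Or.inl hx) ((S.mem_J j).1 hj).1 hD hb
    (fun z => by
      have := S.path.mem_right hy
      simp only [mem_filter, mem_singleton, notMem_empty, false_or]
      constructor
      · rintro ⟨rfl, h⟩
        exact ⟨hxy.symm, rfl, h, this⟩
      · rintro ⟨-, rfl, h, -⟩
        exact ⟨rfl, h⟩)
    (fun z => by
      have := S.path.mem_left hx
      simp only [mem_filter, mem_singleton, notMem_empty, false_or]
      constructor
      · rintro ⟨rfl, h⟩
        exact ⟨hxy, rfl, h, this⟩
      · rintro ⟨-, rfl, h, -⟩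
        exact ⟨rfl, h⟩) rfl (by simp) (by simp)
  have hc : ∀ z : V, #{w ∈ {z} | w ∈ C2} ≤ 1 := fun z =>
    (card_le_card (filter_subset _ _)).trans (card_singleton z).le
  have h1 := hc x
  have h2 := hc y
  have R1 : Reach _ _ _ _ _ _ _ _ _ _ _ _ _ _ := ⟨_, _, _, _, S1⟩
  have R2 := R1.clear_out (N := N) h.disj' (empty_subset _) (disjoint_empty_right _)
    (fun v hv K U hU hK => by simpa using hfo v (mem_filter.1 hv).2 K U hU hK) (by omega)
  have R3 := R2.clear_in (N := N) h.disj (empty_subset _) (disjoint_empty_right _)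
    (fun v hv K U hU hK => by simpa using hfi v (mem_filter.1 hv).2 K U hU hK) (by omega)
  have e1 : #{v ∈ {z ∈ {y} | z ∈ C2} | v ∈ P} = 0 := by
    rw [card_eq_zero, filter_eq_empty_iff]
    exact fun v hv => Finset.disjoint_left.1 h.disj (mem_filter.1 hv).2
  have e2 : #{v ∈ {z ∈ {x} | z ∈ C2} | v ∈ P'} = 0 := by
    rw [card_eq_zero, filter_eq_empty_iff]
    exact fun v hv => Finset.disjoint_left.1 h.disj' (mem_filter.1 hv).2
  rw [e1, e2] at R3
  simp only [Nat.cast_zero, sub_zero] at R3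
  exact R3.mono (by omega)

/-- Using up all exceptional colours. -/
lemma Reach.clear_bad (h : FourPart D C2 P P' Bad s r) {N : ℕ}
    (hN : 2 * N < (Fintype.card V + 1) / 2) (hN2 : 2 * N < #C2)
    (hfo : ∀ u ∈ C2, ∀ (K : Finset C) (U : Finset V), #U ≤ N →
      Fintype.card C ≤ #K + N → ∃ i ∈ K, i ∉ Bad ∧ ∃ y ∈ P', y ∉ U ∧ D i u y)
    (hfi : ∀ u ∈ C2, ∀ (K : Finset C) (U : Finset V), #U ≤ N →
      Fintype.card C ≤ #K + N → ∃ i ∈ K, i ∉ Bad ∧ ∃ x ∈ P, x ∉ U ∧ D i x u)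
    (heven : Even #{j ∈ J | FourPart.Poor D P P' N j}) (ht : t + 6 * #J ≤ N)
    (hR : Reach D C2 P P' Bad ML MR t b ∅ ∅ ∅ J ∅) :
    Reach D C2 P P' Bad ML MR (t + 6 * #J) b ∅ ∅ ∅ ∅ ∅ := by
  induction hn : #J using Nat.strong_induction_on generalizing J t with
  | _ n ih =>
  subst hn
  by_cases hrich : ∃ j ∈ J, ¬ FourPart.Poor D P P' N j
  · obtain ⟨j, hj, hjn⟩ := hrich
    have hcj := card_erase_add_one hj
    have R1 := hR.use_bad (b' := b) h hfo hfi hj (by omega) (fun U hU => by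
      by_contra hcon
      refine hjn ⟨U, by omega, fun x hx y hy hD => ?_⟩
      by_contra hxy
      refine hcon ⟨x, hx, y, hy, hD, ?_⟩
      by_cases h1 : x ∈ P <;> by_cases h2 : y ∈ P' <;> simp_all)
    have e1 : #{i ∈ J.erase j | FourPart.Poor D P P' N i} =
        #{i ∈ J | FourPart.Poor D P P' N i} := by
      rw [filter_erase, erase_eq_of_notMem (by simp [hjn])]
    exact (ih _ (by omega) (by rwa [e1]) (by omega) R1 rfl).mono (by omega)
  push Not at hrich
  rw [filter_true_of_mem hrich] at heven
  rcases J.eq_empty_or_nonempty with rfl | ⟨j, hj⟩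
  · simpa using hR
  have hcj := card_erase_add_one hj
  obtain ⟨l, hl⟩ : (J.erase j).Nonempty := by
    rw [← card_pos]
    rcases heven with ⟨q, hq⟩
    omega
  have hcl := card_erase_add_one hl
  have R1 := hR.use_bad (b' := b - 1) h hfo hfi hj (by omega) (fun U hU => by
    obtain ⟨x, hx, hxU, y, hyU, hD, hxy⟩ := h.exists_poor_edge (hrich j hj) (U := U) (S := P)
      (by omega) hN (by rw [h.card_P]; omega)
    refine ⟨x, hxU, y, hyU, hD, ?_⟩
    simp only [hx, true_iff] at hxy
    simp [hx, hxy])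
  have R2 := R1.use_bad (b' := b) h hfo hfi hl (by omega) (fun U hU => by
    obtain ⟨x, hx, hxU, y, hyU, hD, hxy⟩ := h.exists_poor_edge
      (hrich l (mem_of_mem_erase hl)) (U := U) (S := C2) (by omega) hN hN2
    refine ⟨x, hxU, y, hyU, hD, ?_⟩
    have hxP := Finset.disjoint_left.1 h.disj hx
    simp only [hxP, false_iff] at hxy
    simp [hxP, hxy])
  refine (ih _ (by omega) ?_ (by omega) R2 rfl).mono (by omega)
  rw [filter_true_of_mem fun i hi => hrich i (mem_of_mem_erase (mem_of_mem_erase hi))]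
  rcases heven with ⟨q, hq⟩
  exact ⟨q - 1, by omega⟩

/-- Adding `m` edges from `P` to `P'` avoiding touched vertices and given sets `A` and `B`. -/
lemma Stage.add_edges {A B : Finset V} (hP : Disjoint C2 P) (hP' : Disjoint C2 P') (hH : H ⊆ C2)
    (m : ℕ) (hex : ∀ (K : Finset C) (U : Finset V), #U + 2 ≤ t + 2 * m →
      Fintype.card C + 2 ≤ #K + (t + 2 * m) → ∃ i ∈ K, i ∉ Bad ∧ i ∉ G ∧ ∃ x ∈ P, x ∉ A ∧ x ∉ U ∧
        ∃ y ∈ P', y ∉ B ∧ y ∉ U ∧ x ≠ y ∧ D i x y)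
    (S : Stage D C2 P P' Bad ∅ ∅ t b XL XR H J G I L K U) (hA : A ⊆ L) (hB : B ⊆ I) :
    ∃ I L K U, Stage D C2 P P' Bad ∅ ∅ (t + 2 * m) (b - m) XL XR H J G I L K U ∧
      A ⊆ L ∧ B ⊆ I := by
  induction m generalizing t b I L K U with
  | zero => exact ⟨I, L, K, U, by simpa using S, hA, hB⟩
  | succ m ih =>
    have h1 := S.card_U
    have h2 := S.card_K
    obtain ⟨i, hi, hiB, hiG, x, hxP, hxA, hxU, y, hyP, hyB, hyU, hxy, hD⟩ :=
      hex K U (by omega) (by omega)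
    have hxC : x ∉ C2 := fun h => Finset.disjoint_left.1 hP h hxP
    have hyC : y ∉ C2 := fun h => Finset.disjoint_left.1 hP' h hyP
    have S1 := S.step (XL' := XL) (XR' := XR) (H' := H) (J' := J) (G' := G) (b' := b - 1)
      (S.path.mem_right hxU) (S.path.mem_left hyU) hxy
      (Or.inl hxU) hi hD (by simp [hxP, hyP])
      (fun z => ⟨fun hz => ⟨by rintro rfl; exact hxU ((S.mem_XL z).1 hz).1, Or.inl hz⟩,
        fun hz => hz.2.resolve_right fun h => hyC h.2.1⟩)
      (fun z => ⟨fun hz => ⟨by rintro rfl; exact hyU ((S.mem_XR z).1 hz).1, Or.inl hz⟩,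
        fun hz => hz.2.resolve_right fun h => hxC h.2.1⟩)
      (by rw [erase_eq_of_notMem fun h => hiB ((S.mem_J i).1 h).2])
      (fun z hz => ⟨hz, by rintro rfl; exact hxC (hH hz), by rintro rfl; exact hyC (hH hz)⟩)
      (fun j hj => ⟨hj, by rintro rfl; exact hiG hj⟩)
    obtain ⟨I', L', K', U', S', hA', hB'⟩ := ih
      (fun K U hU hK => hex K U (by omega) (by omega)) S1
      (fun z hz => mem_erase.2 ⟨by rintro rfl; exact hxA hz, hA hz⟩)
      (fun z hz => mem_erase.2 ⟨by rintro rfl; exact hyB hz, hB hz⟩)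
    refine ⟨I', L', K', U', ?_, hA', hB'⟩
    convert S' using 1
    · ring
    · push_cast
      ring

set_option maxHeartbeats 1000000 in
/-- Declaring the vertices of given sets to be touched. -/
lemma Stage.absorb {A B T T' : Finset V} (hP : Disjoint C2 P) (hP' : Disjoint C2 P') (hH : H ⊆ C2)
    (hAP : A ⊆ P) (hTP : T ⊆ P) (hBP : B ⊆ P') (hTP' : T' ⊆ P')
    (S : Stage D C2 P P' Bad ∅ ∅ t b ∅ XR H J G I L K U) (hA : A ⊆ L) (hB : B ⊆ I) :
    ∃ S₁ ⊆ T, ∃ S₂ ⊆ T', Reach D C2 P P' Bad (A ∪ T) (B ∪ T') (t + (#(A ∪ T) + #(B ∪ T'))) b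
      (A ∪ S₁) (XR ∪ B ∪ S₂) H J G := by
  have hL : ∀ z ∈ A ∪ T, z ∉ C2 := fun z hz h =>
    Finset.disjoint_left.1 hP h (union_subset hAP hTP hz)
  have hR : ∀ z ∈ B ∪ T', z ∉ C2 := fun z hz h =>
    Finset.disjoint_left.1 hP' h (union_subset hBP hTP' hz)
  refine ⟨{z ∈ T | z ∈ L}, filter_subset _ _, {z ∈ T' | z ∈ I}, filter_subset _ _, I, L, K,
    U ∪ ((A ∪ T) ∪ (B ∪ T')), ?_⟩
  refine ⟨S.path.mono subset_union_left, (card_union_le _ _).trans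
    (add_le_add S.card_U (card_union_le _ _)), S.card_K.trans (by omega), S.bal,
    subset_union_left.trans subset_union_right, subset_union_right.trans subset_union_right,
    ?_, ?_, S.mem_J, ?_, S.G_sub⟩
  · intro z
    have h1 := S.mem_XL z
    have h2 := hL z
    have h3 := hR z
    have h4 := @hA z
    simp only [mem_union, mem_filter, notMem_empty, or_false] at h1 h2 h3 ⊢
    tauto
  · intro z
    have h1 := S.mem_XR z
    have h2 := hL z
    have h3 := hR z
    have h4 := @hB z
    simp only [mem_union, mem_filter, notMem_empty, or_false] at h1 h2 h3 ⊢
    tauto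
  · rw [disjoint_union_right]
    refine ⟨S.disj_H, ?_⟩
    rw [Finset.disjoint_left]
    intro z hz hz'
    rcases mem_union.1 hz' with h | h
    · exact hL z h (hH hz)
    · exact hR z h (hH hz)

end Phases

section Assembly

set_option linter.unusedSectionVars false

open scoped Classical

variable {V C : Type} [Fintype V] [Fintype C] [DecidableEq V] [DecidableEq C]
variable {D : C → V → V → Prop} {C2 P P' : Finset V} {Bad : Finset C} {ML MR : Finset V}
  {t : ℕ} {b : ℤ} {XL XR H : Finset V} {J G : Finset C} {I L : Finset V} {K : Finset C}
  {U : Finset V} {s r : ℕ}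

lemma Reach.anti (hR : Reach D C2 P P' Bad ML MR t b XL XR H J G) {H' : Finset V} {G' : Finset C}
    (hH : H' ⊆ H) (hG : G' ⊆ G) : Reach D C2 P P' Bad ML MR t b XL XR H' J G' := by
  obtain ⟨I, L, K, U, S⟩ := hR
  exact ⟨I, L, K, U, { S with disj_H := S.disj_H.mono_left hH, G_sub := hG.trans S.G_sub }⟩

/-- Every vertex missing many edges to `C2` is either matched into `C2` or is one of at most `a`
vertices sending many edges to `P'`. -/
lemma FourPart.exists_routing (h : FourPart D C2 P P' Bad s r) {G G₃ : Finset C} {H : Finset V}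
    {a : ℕ} (ha : s ≤ a) (hG : Disjoint G Bad) (hH : H ⊆ C2) (hG₃ : Disjoint G₃ Bad)
    (hGH : 8 * s * (#G + #H) < #G * #H) (hG₃c : Fintype.card V ≤ 50 * #G₃) (hC2 : 0 < #C2)
    (hG₃' : 0 < #G₃) :
    ∃ A T : Finset V, ∃ f : V → C, ∃ g : V → V, A ⊆ FourPart.rich D C2 P P' G₃ ∧
      FourPart.low D C2 P G₃ ⊆ A ∪ T ∧ Disjoint A T ∧ T ⊆ P ∧ #T ≤ 8 * s ∧ #A ≤ a ∧
      (#A < a → FourPart.rich D C2 P P' G₃ ⊆ A) ∧ Set.InjOn f T ∧ Set.InjOn g T ∧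
      ∀ v ∈ T, f v ∈ G ∧ g v ∈ H ∧ D (f v) v (g v) := by
  have hlow := h.card_low hG₃ (Nat.mul_pos hG₃' hC2)
  have hlr := h.low_subset_rich hG₃c
  have hlP : FourPart.low D C2 P G₃ ⊆ P := filter_subset _ _
  by_cases hc : a ≤ #(FourPart.low D C2 P G₃)
  · obtain ⟨T, hT, -, h2, f, g, hf, hg, hfg⟩ := exists_rainbow_matching D G H a (8 * s) hGH
      (FourPart.low D C2 P G₃) hlow
      ((sum_le_sum_of_subset hlP).trans ((h.sum_miss hG hH).trans (Nat.mul_le_mul_right _ ha)))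
    have h2 := h2 hc
    exact ⟨FourPart.low D C2 P G₃ \ T, T, f, g, sdiff_subset.trans hlr, by simp,
      sdiff_disjoint, hT.trans hlP, (card_le_card hT).trans hlow, h2.le, fun h => by omega,
      hf, hg, hfg⟩
  · push Not at hc
    have hne : ∃ i₀, i₀ ∈ G := by
      rw [← Finset.Nonempty, nonempty_iff_ne_empty]
      rintro rfl
      simp at hGH
    obtain ⟨i₀, -⟩ := hne
    by_cases hr : #(FourPart.rich D C2 P P' G₃) ≤ a
    · exact ⟨FourPart.rich D C2 P P' G₃, ∅, fun _ => i₀, id, subset_rfl, by simpa using hlr,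
        disjoint_empty_right _, empty_subset _, by simp, hr, fun _ => subset_rfl, by simp, by simp,
        by simp⟩
    · push Not at hr
      obtain ⟨A, h1, h2, h3⟩ := exists_subsuperset_card_eq hlr hc.le hr.le
      exact ⟨A, ∅, fun _ => i₀, id, h2, by simpa using h1,
        disjoint_empty_right _, empty_subset _, by simp, h3.le, fun h => by omega, by simp, by simp,
        by simp⟩

lemma FourPart.sum_le_of_notMem_low {G₃ : Finset C} {N n : ℕ} {v : V} (hv : v ∈ P)
    (hlow : v ∉ FourPart.low D C2 P G₃) (hG₃ : #G₃ ≤ n) (hK : n ≤ #K + N) (hKG : 10 * #(K \ G₃) ≤ n)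
    (hN : 100 * N ≤ #C2) (hNn : 100 * N ≤ n) (hI : #C2 ≤ #{u ∈ I | u ∈ C2} + N) :
    10 * ∑ i ∈ K, #{u ∈ I | u ∈ C2 ∧ ¬ D i v u} ≤ 3 * (#K * #{u ∈ I | u ∈ C2}) := by
  have h1 : 8 * #{c ∈ G₃ ×ˢ C2 | ¬ D c.1 v c.2} ≤ #G₃ * #C2 := by
    by_contra! hcon
    exact hlow (mem_filter.2 ⟨hv, hcon⟩)
  rw [card_filter_product_eq_sum G₃ C2 fun i u => ¬ D i v u] at h1
  have h2 : ∑ i ∈ K, #{u ∈ I | u ∈ C2 ∧ ¬ D i v u} ≤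
      ∑ i ∈ G₃, #{u ∈ C2 | ¬ D i v u} + #(K \ G₃) * #C2 := by
    have h3 : ∀ i, #{u ∈ I | u ∈ C2 ∧ ¬ D i v u} ≤ #{u ∈ C2 | ¬ D i v u} := fun i =>
      card_le_card fun u hu => by
        rw [mem_filter] at hu ⊢
        exact hu.2
    calc _ = ∑ i ∈ K ∩ G₃, #{u ∈ I | u ∈ C2 ∧ ¬ D i v u} +
          ∑ i ∈ K \ G₃, #{u ∈ I | u ∈ C2 ∧ ¬ D i v u} := (sum_inter_add_sum_sdiff _ _ _).symm
      _ ≤ ∑ i ∈ G₃, #{u ∈ C2 | ¬ D i v u} + ∑ i ∈ K \ G₃, #C2 := by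
          refine add_le_add ?_ (sum_le_sum fun i _ => (h3 i).trans
            (card_le_card (filter_subset _ _)))
          exact (sum_le_sum fun i _ => h3 i).trans (sum_le_sum_of_subset inter_subset_right)
      _ = _ := by rw [sum_const, smul_eq_mul]
  have h4 : #G₃ * #C2 ≤ n * #C2 := Nat.mul_le_mul_right _ hG₃
  have h5 : 10 * #(K \ G₃) * #C2 ≤ n * #C2 := Nat.mul_le_mul_right _ hKG
  have h6 : (99 * n) * (99 * #C2) ≤ (100 * #K) * (100 * #{u ∈ I | u ∈ C2}) :=
    Nat.mul_le_mul (by omega) (by omega)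
  nlinarith

end Assembly

open Classical in
/-- Completing a stage in which everything exceptional has been dealt with. -/
theorem Reach.finish (E : ℕ) (hE : 1 ≤ E) : ∃ m₀ : ℕ, ∀ (V C : Type) [Fintype V] [Fintype C]
    [DecidableEq V] [DecidableEq C] (D : C → V → V → Prop) (C2 P P' : Finset V) (Bad G₃ : Finset C)
    (ML MR : Finset V) (s r N : ℕ), FourPart D C2 P P' Bad s r →
    Reach D C2 P P' Bad ML MR N 0 ∅ ∅ ∅ ∅ ∅ → Fintype.card C = Fintype.card V →
    FourPart.low D C2 P G₃ ⊆ ML → FourPart.low (fun i x y => D i y x) C2 P' G₃ ⊆ MR →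
    10 * #(Badᶜ \ G₃) ≤ Fintype.card V → 100 * N ≤ #C2 → s ≤ N → r ≤ N →
    Fintype.card V + E * N ≤ E * #C2 → m₀ + N ≤ Fintype.card V →
    100000000 * E * N + N ≤ Fintype.card V → HamSys D univ id univ := by
  obtain ⟨m₀, hm⟩ := hamSys_of_balanced E hE
  refine ⟨m₀, fun V C _ _ _ _ D C2 P P' Bad G₃ ML MR s r N h hR hVC hML hMR hG₃ hN hs hr hc2 hm₀
    hEN => ?_⟩
  obtain ⟨I, L, K, U, S⟩ := hR
  obtain ⟨e, h1, h2, h3, h4, h5⟩ := S.path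
  have hKI := S.card_K
  have hUN := S.card_U
  have hKB : ∀ i ∈ K, i ∉ Bad := fun i hi hB => by simpa using (S.mem_J i).2 ⟨hi, hB⟩
  have hL0 : ∀ z, z ∈ U → z ∈ L → ¬ (z ∈ C2 ∨ z ∈ ML) := fun z hz hz' hh => by
    simpa using (S.mem_XL z).2 ⟨hz, hz', hh⟩
  have hI0 : ∀ z, z ∈ U → z ∈ I → ¬ (z ∈ C2 ∨ z ∈ MR) := fun z hz hz' hh => by
    simpa using (S.mem_XR z).2 ⟨hz, hz', hh⟩
  have hCI : #C2 ≤ #{u ∈ I | u ∈ C2} + N := by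
    refine le_trans ?_ (Nat.add_le_add_left hUN _)
    refine le_trans (card_le_card fun u hu => ?_) (card_union_le _ _)
    by_cases hU : u ∈ U
    · exact mem_union_right _ hU
    · exact mem_union_left _ (mem_filter.2 ⟨(h3 u hU).1, hu⟩)
  have hIe : #I ≤ Fintype.card V := card_le_univ I
  have hKG : 10 * #(K \ G₃) ≤ Fintype.card V := le_trans (Nat.mul_le_mul_left _
    (card_le_card (sdiff_subset_sdiff (fun i hi => mem_compl.2 (hKB i hi)) subset_rfl))) hG₃
  have hGc : #G₃ ≤ Fintype.card V := hVC ▸ card_le_univ G₃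
  have hNn : 100 * N ≤ Fintype.card V := hN.trans (card_le_univ _)
  refine h5 (hm V C D I L e K C2 P P' N ?_ ?_ ?_ ?_ h1 h2 h4 ?_ ?_ h.disj h.disj' ?_ ?_ ?_ ?_ ?_ ?_
    ?_ ?_ ?_ ?_ ?_)
  · omega
  · have : E * #C2 ≤ E * #{u ∈ I | u ∈ C2} + E * N := by
      rw [← mul_add]
      exact Nat.mul_le_mul_left _ hCI
    omega
  · omega
  · omega
  · intro z hz hzC
    refine (h3 z fun hU => hI0 z hU hz (Or.inl hzC)).2
  · intro z hz hzC
    have hL : e z ∈ L := h2 ▸ mem_image_of_mem e hz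
    have hU : e z ∉ U := fun hU => hL0 _ hU hL (Or.inl hzC)
    have h6 := h3 _ hU
    rw [← h1 h6.1 hz h6.2]
    exact hzC
  · intro i _ v
    have := h.out i v
    omega
  · intro i _ v
    have := h.inn i v
    omega
  · exact fun i hi u hu => (h.card_miss (hKB i hi) hu).trans hr
  · exact fun i hi u hu => (h.symm.card_miss (hKB i hi) hu).trans hs
  · exact fun i hi u hu y _ hy hD => hy (h.good_out i (hKB i hi) u hu y hD)
  · exact fun i hi u hu y _ hy hD => hy (h.good_in i (hKB i hi) u hu y hD)
  · intro x hx hxP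
    refine FourPart.sum_le_of_notMem_low hxP (fun hl => ?_) hGc (by omega) hKG hN hNn hCI
    have := hML hl
    exact hL0 x (S.ML_sub this) hx (Or.inr this)
  · intro y hy hyP
    refine FourPart.sum_le_of_notMem_low (D := fun i x y => D i y x) hyP (fun hl => ?_) hGc
      (by omega) hKG hN hNn hCI
    have := hMR hl
    exact hI0 y (S.MR_sub this) hy (Or.inr this)
  · have := S.bal
    omega
  · have := h.card_P
    omega
  · have := h.card_P'
    omega

section Routing

set_option linter.unusedSectionVars false

open scoped Classical

variable {V C : Type} [Fintype V] [Fintype C] [DecidableEq V] [DecidableEq C]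
variable {D : C → V → V → Prop} {C2 P P' : Finset V} {Bad : Finset C} {ML MR : Finset V}
  {t : ℕ} {b : ℤ} {XL XR H : Finset V} {J G : Finset C} {I L : Finset V} {K : Finset C}
  {U : Finset V} {s r : ℕ}

/-- An initial stage in which the number of unused poor colours is even. -/
lemma FourPart.exists_even_stage (h : FourPart D C2 P P' Bad s r)
    (hVC : Fintype.card C = Fintype.card V) {A B : Finset V} (hA : A ⊆ P)
    (hBr : #B ≤ r) {u : V} (hu : u ∈ C2) (huH : u ∉ H) (hH : H ⊆ C2) (hG : Disjoint G Bad)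
    (N : ℕ) (hb : (#P + #P' : ℤ) = Fintype.card V + b) :
    ∃ XR ⊆ ({u} : Finset V), ∃ J ⊆ Bad, Even #{j ∈ J | FourPart.Poor D P P' N j} ∧
      ∃ I L K U, Stage D C2 P P' Bad ∅ ∅ 2 b ∅ XR H J G I L K U ∧ A ⊆ L ∧ B ⊆ I := by
  have S0 : Stage D C2 P P' Bad ∅ ∅ 0 b ∅ ∅ H Bad G univ univ univ ∅ := Stage.init hVC hb
  by_cases hev : Even #{j ∈ Bad | FourPart.Poor D P P' N j}
  · exact ⟨∅, empty_subset _, Bad, subset_rfl, hev, _, _, _, _,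
      { S0 with card_U := by simp, card_K := S0.card_K.trans (by omega) }, subset_univ _,
      subset_univ _⟩
  rw [Nat.not_even_iff_odd] at hev
  obtain ⟨j, hj⟩ : {j ∈ Bad | FourPart.Poor D P P' N j}.Nonempty := by
    rw [← card_pos]
    exact hev.pos
  have hjc := card_erase_add_one hj
  rw [mem_filter] at hj
  have huP := Finset.disjoint_left.1 h.disj hu
  have huP' := Finset.disjoint_left.1 h.disj' hu
  obtain ⟨y, hy⟩ : ({y ∈ P' | D j u y} \ B).Nonempty := by
    rw [← card_pos]
    have := h.lt_card_out j huP'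
    have := le_card_sdiff B {y ∈ P' | D j u y}
    omega
  simp only [mem_sdiff, mem_filter] at hy
  have hyC : y ∉ C2 := fun hh => Finset.disjoint_left.1 h.disj' hh hy.1.1
  have huy : u ≠ y := by rintro rfl; exact hyC hu
  have S1 := S0.step (XL' := ∅) (XR' := {u}) (H' := H) (J' := Bad.erase j) (G' := G) (b' := b)
    (mem_univ u) (mem_univ y) huy (Or.inl (notMem_empty _)) (mem_univ j) hy.1.2
    (by simp [huP, hy.1.1]) (fun z => by simp [hyC])
    (fun z => by
      simp only [mem_singleton, notMem_empty, false_or, mem_univ, and_true]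
      constructor
      · rintro rfl
        exact ⟨huy, rfl, hu⟩
      · rintro ⟨-, h, -⟩
        exact h) rfl
    (fun z hz => ⟨hz, by rintro rfl; exact huH hz, by rintro rfl; exact hyC (hH hz)⟩)
    (fun i hi => ⟨hi, by rintro rfl; exact Finset.disjoint_left.1 hG hi hj.1⟩)
  refine ⟨{u}, subset_rfl, Bad.erase j, erase_subset _ _, ?_, _, _, _, _, S1, ?_, ?_⟩
  · rw [filter_erase]
    rcases hev with ⟨q, hq⟩
    exact ⟨q, by omega⟩
  · exact fun z hz => mem_erase.2 ⟨by rintro rfl; exact huP (hA hz), mem_univ _⟩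
  · exact fun z hz => mem_erase.2 ⟨by rintro rfl; exact hy.2 hz, mem_univ _⟩

/-- Dealing with the vertices of `A ∪ T` and `B ∪ T'`, and with all exceptional colours. -/
lemma FourPart.reach_of_stage (h : FourPart D C2 P P' Bad s r)
    (hVC : Fintype.card C = Fintype.card V) {G₃ : Finset C} (hG₃ : Disjoint G₃ Bad)
    {A B T T' : Finset V} {f f' : V → C} {g g' : V → V} {u : V} {N q : ℕ}
    (hA : A ⊆ FourPart.rich D C2 P P' G₃) (hAT : Disjoint A T) (hT : T ⊆ P)
    (hf : Set.InjOn f T) (hg : Set.InjOn g T)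
    (hfg : ∀ v ∈ T, f v ∉ Bad ∧ f v ∉ G₃ ∧ g v ∈ C2 ∧ D (f v) v (g v))
    (hB : B ⊆ FourPart.rich (fun i x y => D i y x) C2 P' P G₃) (hBT : Disjoint B T')
    (hT' : T' ⊆ P') (hf' : Set.InjOn f' T') (hg' : Set.InjOn g' T')
    (hfg' : ∀ v ∈ T', f' v ∉ Bad ∧ f' v ∉ G₃ ∧ g' v ∈ C2 ∧ D (f' v) (g' v) v)
    (hff : ∀ v ∈ T, ∀ w ∈ T', f v ≠ f' w ∧ g v ≠ g' w)
    (huC : u ∈ C2) (hXR : XR ⊆ {u}) (hJ : J ⊆ Bad)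
    (hev : Even #{j ∈ J | FourPart.Poor D P P' N j})
    (S : Stage D C2 P P' Bad ∅ ∅ t (#A + #B) ∅ XR (T.image g ∪ T'.image g') J
      (T.image f ∪ T'.image f') I L K U) (hAL : A ⊆ L) (hBI : B ⊆ I)
    (ht : t ≤ q) (hAq : #A ≤ q) (hBq : #B ≤ q) (hTq : #T ≤ q) (hT'q : #T' ≤ q) (hJq : #Bad ≤ q)
    (hqN : 40 * q + 10 ≤ N) (hN2 : 800 * N < #C2) (hNn : 2 * N < (Fintype.card V + 1) / 2)
    (hG₃N : N < #G₃) :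
    Reach D C2 P P' Bad (A ∪ T) (B ∪ T') N 0 ∅ ∅ ∅ ∅ ∅ := by
  have hfo : ∀ v, v ∈ C2 ∨ v ∈ A → ∀ (K : Finset C) (U : Finset V), #U ≤ N →
      Fintype.card C ≤ #K + N → ∃ i ∈ K, i ∈ G₃ ∧ ∃ y ∈ P', y ∉ U ∧ D i v y := by
    rintro v (hv | hv) K U hU hK
    · exact h.exists_fresh_out hU hK hG₃ hG₃N (by omega) hv
    · exact FourPart.exists_fresh_of_rich hVC hU hK hN2 (hA hv)
  have hfi : ∀ v, v ∈ C2 ∨ v ∈ B → ∀ (K : Finset C) (U : Finset V), #U ≤ N →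
      Fintype.card C ≤ #K + N → ∃ i ∈ K, i ∈ G₃ ∧ ∃ y ∈ P, y ∉ U ∧ D i y v := by
    rintro v (hv | hv) K U hU hK
    · exact h.symm.exists_fresh_out hU hK hG₃ hG₃N (by omega) hv
    · exact FourPart.exists_fresh_of_rich hVC hU hK hN2 (hB hv)
  have hGB : ∀ i ∈ G₃, i ∉ Bad := fun i hi => Finset.disjoint_left.1 hG₃ hi
  have hAP : A ⊆ P := hA.trans (filter_subset _ _)
  have hBP : B ⊆ P' := hB.trans (filter_subset _ _)
  have hdP : ∀ z ∈ P, z ∉ C2 := fun z hz hz' => Finset.disjoint_left.1 h.disj hz' hz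
  have hdP' : ∀ z ∈ P', z ∉ C2 := fun z hz hz' => Finset.disjoint_left.1 h.disj' hz' hz
  have hgC : T.image g ⊆ C2 := fun z hz => by
    obtain ⟨v, hv, rfl⟩ := mem_image.1 hz
    exact (hfg v hv).2.2.1
  have hgC' : T'.image g' ⊆ C2 := fun z hz => by
    obtain ⟨v, hv, rfl⟩ := mem_image.1 hz
    exact (hfg' v hv).2.2.1
  obtain ⟨S₁, hS₁, S₂, hS₂, R0⟩ := S.absorb h.disj h.disj' (union_subset hgC hgC') hAP hT hBP hT'
    hAL hBI
  have R1 := (R0.anti (H' := S₂.image g' ∪ S₁.image g) (G' := S₂.image f' ∪ S₁.image f)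
    (by
      rw [union_comm]
      exact union_subset_union (image_subset_image hS₁) (image_subset_image hS₂))
    (by
      rw [union_comm]
      exact union_subset_union (image_subset_image hS₁) (image_subset_image hS₂))).out_matching
    h.disj h.disj' ((image_subset_image hS₂).trans hgC') (hS₁.trans hT)
    (hf.mono hS₁) (hg.mono hS₁)
    (fun v hv => ⟨fun hh => by
      obtain ⟨w, hw, he⟩ := mem_image.1 hh
      exact (hff v (hS₁ hv) w (hS₂ hw)).1 he.symm, (hfg v (hS₁ hv)).1⟩)
    (fun v hv => ⟨fun hh => by
      obtain ⟨w, hw, he⟩ := mem_image.1 hh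
      exact (hff v (hS₁ hv) w (hS₂ hw)).2 he.symm, (hfg v (hS₁ hv)).2.2.1⟩)
    (fun v hv => (hfg v (hS₁ hv)).2.2.2) (hAT.symm.mono_left hS₁)
  have R2 := Reach.in_matching (T := S₂) (f := f') (g := g') (H := ∅) (G := ∅) (XR := XR ∪ B)
    h.disj h.disj' (empty_subset _) (hS₂.trans hT')
    (hf'.mono hS₂) (hg'.mono hS₂)
    (fun v hv => ⟨notMem_empty _, (hfg' v (hS₂ hv)).1⟩)
    (fun v hv => ⟨notMem_empty _, (hfg' v (hS₂ hv)).2.2.1⟩)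
    (fun v hv => (hfg' v (hS₂ hv)).2.2.2)
    (by
      rw [disjoint_union_right]
      refine ⟨?_, hBT.symm.mono_left hS₂⟩
      rw [Finset.disjoint_left]
      intro z hz hz'
      have := hXR hz'
      rw [mem_singleton] at this
      exact hdP' z (hT' (hS₂ hz)) (this ▸ huC)) (by simpa using R1)
  have c1 : #S₁ ≤ q := (card_le_card hS₁).trans hTq
  have c2 : #S₂ ≤ q := (card_le_card hS₂).trans hT'q
  have c3 : #(A ∪ T) ≤ 2 * q := (card_union_le _ _).trans (by omega)
  have c4 : #(B ∪ T') ≤ 2 * q := (card_union_le _ _).trans (by omega)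
  have c5 : #(S₁.image g) ≤ q := card_image_le.trans c1
  have c6 : #(S₂.image g') ≤ q := card_image_le.trans c2
  have c7 : #XR ≤ 1 := (card_le_card hXR).trans (card_singleton u).le
  have c8 : #(A ∪ S₁.image g) ≤ 2 * q := (card_union_le _ _).trans (by omega)
  have c9 : #(XR ∪ B ∪ S₂.image g') ≤ 2 * q + 1 := (card_union_le _ _).trans (by
    have := card_union_le XR B
    omega)
  have hX : ∀ v ∈ A ∪ S₁.image g, v ∈ C2 ∨ v ∈ A := fun v hv => by
    rcases mem_union.1 hv with hv | hv
    · exact Or.inr hv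
    · exact Or.inl (hgC (image_subset_image hS₁ hv))
  have hY : ∀ v ∈ XR ∪ B ∪ S₂.image g', v ∈ C2 ∨ v ∈ B := fun v hv => by
    rcases mem_union.1 hv with hv | hv
    · rcases mem_union.1 hv with hv | hv
      · exact Or.inl (mem_singleton.1 (hXR hv) ▸ huC)
      · exact Or.inr hv
    · exact Or.inl (hgC' (image_subset_image hS₂ hv))
  have R3 := R2.clear_out (N := N) h.disj' (empty_subset _) (disjoint_empty_right _)
    (fun v hv K U hU hK => by
      obtain ⟨i, hi, hiG, y, hy⟩ := hfo v (hX v hv) K U hU hK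
      exact ⟨i, hi, hGB i hiG, notMem_empty _, y, hy⟩) (by omega)
  have R4 := R3.clear_in (N := N) h.disj (empty_subset _) (disjoint_empty_right _)
    (fun v hv K U hU hK => by
      obtain ⟨i, hi, hiG, y, hy⟩ := hfi v (hY v hv) K U hU hK
      exact ⟨i, hi, hGB i hiG, notMem_empty _, y, hy⟩) (by omega)
  have e1 : #{v ∈ A ∪ S₁.image g | v ∈ P} = #A := by
    congr 1
    ext v
    rw [mem_filter]
    refine ⟨fun hv => (mem_union.1 hv.1).resolve_right fun hh =>
      hdP v hv.2 (hgC (image_subset_image hS₁ hh)), fun hv => ⟨mem_union_left _ hv, hAP hv⟩⟩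
  have e2 : #{v ∈ XR ∪ B ∪ S₂.image g' | v ∈ P'} = #B := by
    congr 1
    ext v
    rw [mem_filter]
    refine ⟨fun hv => (hY v hv.1).resolve_left (hdP' v hv.2), fun hv =>
      ⟨mem_union_left _ (mem_union_right _ hv), hBP hv⟩⟩
  rw [e1, e2] at R4
  have e3 : (#A + #B : ℤ) - #A - #B = 0 := by ring
  rw [e3] at R4
  have c10 : #J ≤ q := (card_le_card hJ).trans hJq
  refine (Reach.clear_bad h (N := N) hNn (by omega) (fun u hu K U hU hK => ?_)
    (fun u hu K U hU hK => ?_) hev ?_ R4).mono ?_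
  · obtain ⟨i, hi, hiG, y, hy⟩ := hfo u (Or.inl hu) K U hU hK
    exact ⟨i, hi, hGB i hiG, y, hy⟩
  · obtain ⟨i, hi, hiG, y, hy⟩ := hfi u (Or.inl hu) K U hU hK
    exact ⟨i, hi, hGB i hiG, y, hy⟩
  · omega
  · omega

end Routing

open Classical in
/-- The four-part structure with few exceptional colours has a rainbow Hamilton cycle. -/
theorem FourPart.hamSys (E : ℕ) (hE : 1 ≤ E) : ∃ m₀ : ℕ, ∀ (V C : Type) [Fintype V] [Fintype C]
    [DecidableEq V] [DecidableEq C] (D : C → V → V → Prop) (C2 P P' : Finset V) (Bad : Finset C)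
    (s r d : ℕ), FourPart D C2 P P' Bad s r → Fintype.card C = Fintype.card V →
    s ≤ d → r ≤ d → #Bad ≤ d → 1 ≤ d → 1000000 * d ≤ #C2 →
    Fintype.card V + E * (330 * d) ≤ E * #C2 → m₀ + 330 * d ≤ Fintype.card V →
    100000000 * E * (330 * d) + 330 * d ≤ Fintype.card V → HamSys D univ id univ := by
  obtain ⟨m₀, hm⟩ := Reach.finish E hE
  refine ⟨m₀, fun V C _ _ _ _ D C2 P P' Bad s r d h hVC hs hr hB hd hC2 hEC hm₀ hEd => ?_⟩
  have hCn : #C2 ≤ Fintype.card V := card_le_univ C2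
  have hBc := card_compl_add_card Bad
  obtain ⟨u, hu⟩ : C2.Nonempty := card_pos.1 (by omega)
  -- reserved colours and vertices
  obtain ⟨G₁, hG₁, hG₁c⟩ := exists_subset_card_eq (s := Badᶜ) (n := 20 * d) (by omega)
  obtain ⟨G₂, hG₂, hG₂c⟩ := exists_subset_card_eq (s := Badᶜ \ G₁) (n := 20 * d) (by
    rw [card_sdiff_of_subset hG₁]
    omega)
  have huc := card_erase_add_one hu
  obtain ⟨H₁, hH₁, hH₁c⟩ := exists_subset_card_eq (s := C2.erase u) (n := 20 * d) (by omega)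
  obtain ⟨H₂, hH₂, hH₂c⟩ := exists_subset_card_eq (s := C2.erase u \ H₁) (n := 20 * d) (by
    rw [card_sdiff_of_subset hH₁]
    omega)
  set G₃ := Badᶜ \ (G₁ ∪ G₂) with hG₃
  have hG₁₂c : #(G₁ ∪ G₂) ≤ 40 * d := (card_union_le _ _).trans (by omega)
  have hG₃c : Fintype.card V ≤ #G₃ + 41 * d := by
    have := le_card_sdiff (G₁ ∪ G₂) Badᶜ
    rw [← hG₃] at this
    omega
  have hG₁B : ∀ i ∈ G₁, i ∉ Bad ∧ i ∉ G₃ := fun i hi =>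
    ⟨mem_compl.1 (hG₁ hi), fun hh => (mem_sdiff.1 hh).2 (mem_union_left _ hi)⟩
  have hG₂B : ∀ i ∈ G₂, i ∉ Bad ∧ i ∉ G₃ ∧ i ∉ G₁ := fun i hi =>
    ⟨mem_compl.1 (mem_sdiff.1 (hG₂ hi)).1,
      fun hh => (mem_sdiff.1 hh).2 (mem_union_right _ hi), (mem_sdiff.1 (hG₂ hi)).2⟩
  have hG₃B : Disjoint G₃ Bad := by
    rw [Finset.disjoint_left]
    exact fun i hi => mem_compl.1 (mem_sdiff.1 hi).1
  have hH₁C : H₁ ⊆ C2 := hH₁.trans (erase_subset _ _)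
  have hH₂C : H₂ ⊆ C2 := hH₂.trans (sdiff_subset.trans (erase_subset _ _))
  have hgh : ∀ s' ≤ d, 8 * s' * (20 * d + 20 * d) < 20 * d * (20 * d) := fun s' hs' => by
    have : s' * d ≤ d * d := Nat.mul_le_mul_right _ hs'
    have : 0 < d * d := by positivity
    nlinarith
  have hG₃50 : Fintype.card V ≤ 50 * #G₃ := by omega
  obtain ⟨A, T, f, g, hA, hlowA, hAT, hT, hTc, hAc, hAr, hf, hg, hfg⟩ :=
    h.exists_routing (G := G₁) (G₃ := G₃) (H := H₁) (a := s + Fintype.card V % 2) (by omega)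
      (Finset.disjoint_left.2 fun i hi => (hG₁B i hi).1) hH₁C hG₃B
      (by rw [hG₁c, hH₁c]; exact hgh s hs) hG₃50 (by omega) (by omega)
  obtain ⟨B, T', f', g', hB', hlowB, hBT, hT', hTc', hBc', hBr, hf', hg', hfg'⟩ :=
    h.symm.exists_routing (G := G₂) (G₃ := G₃) (H := H₂) (a := r) le_rfl
      (Finset.disjoint_left.2 fun i hi => (hG₂B i hi).1) hH₂C hG₃B
      (by rw [hG₂c, hH₂c]; exact hgh r hr) hG₃50 (by omega) (by omega)
  have hAP : A ⊆ P := hA.trans (filter_subset _ _)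
  have hBP : B ⊆ P' := hB'.trans (filter_subset _ _)
  have hHC : T.image g ∪ T'.image g' ⊆ C2 := by
    refine union_subset (fun z hz => ?_) fun z hz => ?_
    · obtain ⟨v, hv, rfl⟩ := mem_image.1 hz
      exact hH₁C (hfg v hv).2.1
    · obtain ⟨v, hv, rfl⟩ := mem_image.1 hz
      exact hH₂C (hfg' v hv).2.1
  have huH : u ∉ T.image g ∪ T'.image g' := fun hh => by
    rcases mem_union.1 hh with hh | hh
    · obtain ⟨v, hv, he⟩ := mem_image.1 hh
      exact (mem_erase.1 (hH₁ (hfg v hv).2.1)).1 he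
    · obtain ⟨v, hv, he⟩ := mem_image.1 hh
      exact (mem_erase.1 (mem_sdiff.1 (hH₂ (hfg' v hv).2.1)).1).1 he
  have hGB : ∀ i ∈ T.image f ∪ T'.image f', i ∉ Bad ∧ i ∉ G₃ := fun i hi => by
    rcases mem_union.1 hi with hi | hi
    · obtain ⟨v, hv, rfl⟩ := mem_image.1 hi
      exact hG₁B _ (hfg v hv).1
    · obtain ⟨v, hv, rfl⟩ := mem_image.1 hi
      have := hG₂B _ (hfg' v hv).1
      exact ⟨this.1, this.2.1⟩
  have hPc := h.card_P
  have hPc' := h.card_P'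
  obtain ⟨XR, hXR, J, hJ, hev, I, L, K, U, S, hAL, hBI⟩ := h.exists_even_stage (A := A) (B := B)
    (H := T.image g ∪ T'.image g') (G := T.image f ∪ T'.image f')
    (b := (s + r + Fintype.card V % 2 : ℕ)) hVC hAP hBc' hu huH hHC
    (Finset.disjoint_left.2 fun i hi => (hGB i hi).1) (330 * d) (by omega)
  -- the extra edges from `P` to `P'`
  obtain ⟨α, hα⟩ : ∃ α, α + #A = s + Fintype.card V % 2 :=
    ⟨s + Fintype.card V % 2 - #A, by omega⟩
  obtain ⟨β, hβ⟩ : ∃ β, β + #B = r := ⟨r - #B, by omega⟩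
  obtain ⟨I, L, K, U, S, hAL, hBI⟩ : ∃ I L K U, Stage D C2 P P' Bad ∅ ∅ (2 + 2 * (α + β))
      ((#A + #B : ℤ)) ∅ XR (T.image g ∪ T'.image g') J (T.image f ∪ T'.image f') I L K U ∧
      A ⊆ L ∧ B ⊆ I := by
    have he : ((s + r + Fintype.card V % 2 : ℕ) : ℤ) - (α + β : ℕ) = #A + #B := by omega
    rw [← he]
    rcases Nat.eq_zero_or_pos (α + β) with h0 | h0
    · rw [h0]
      exact ⟨I, L, K, U, by simpa using S, hAL, hBI⟩
    refine S.add_edges h.disj h.disj' hHC (α + β) (fun K U hU hK => ?_) hAL hBI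
    have hKc := card_compl_add_card K
    have hGK : Fintype.card V ≤ 2 * #(G₃ ∩ K) := by
      have h1 := card_inter_add_card_sdiff G₃ K
      have h2 : #(G₃ \ K) ≤ #Kᶜ := card_le_card fun i hi => by
        rw [mem_sdiff] at hi
        exact mem_compl.2 hi.2
      omega
    have hM : Fintype.card V ≤ 4 * #((P \ A) \ U) := by
      have := le_card_sdiff A P
      have := le_card_sdiff U (P \ A)
      omega
    have hM' : Fintype.card V ≤ 4 * #((P' \ B) \ U) := by
      have := le_card_sdiff B P'
      have := le_card_sdiff U (P' \ B)
      omega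
    rcases le_or_gt α β with hle | hlt
    · obtain ⟨i, hi, hi3, x, hx, hxA, hxU, y, hy, hyB, hyU, hD⟩ := h.exists_edge_of_deficit
        (K := K) (G := G₃) (A := A) (B := B) (U := U) (β := β) (by omega) (by omega)
        (hBr (by omega)) (by omega) hGK hM (by omega)
      exact ⟨i, hi, fun hh => Finset.disjoint_left.1 hG₃B hi3 hh, fun hh => (hGB i hh).2 hi3, x, hx,
        hxA, hxU, y, hy, hyB, hyU, by rintro rfl; exact h.loopless _ _ hD, hD⟩
    · obtain ⟨i, hi, hi3, y, hy, hyB, hyU, x, hx, hxA, hxU, hD⟩ := h.symm.exists_edge_of_deficit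
        (K := K) (G := G₃) (A := B) (B := A) (U := U) (β := α) (by omega) (by omega)
        (hAr (by omega)) (by omega) hGK hM' (by omega)
      exact ⟨i, hi, fun hh => Finset.disjoint_left.1 hG₃B hi3 hh, fun hh => (hGB i hh).2 hi3, x, hx,
        hxA, hxU, y, hy, hyB, hyU, by rintro rfl; exact h.loopless _ _ hD, hD⟩
  have R := h.reach_of_stage (q := 8 * d) (N := 330 * d) hVC hG₃B hA hAT hT hf hg
    (fun v hv => ⟨(hG₁B _ (hfg v hv).1).1, (hG₁B _ (hfg v hv).1).2, hH₁C (hfg v hv).2.1,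
      (hfg v hv).2.2⟩) hB' hBT hT' hf' hg'
    (fun v hv => ⟨(hG₂B _ (hfg' v hv).1).1, (hG₂B _ (hfg' v hv).1).2.1, hH₂C (hfg' v hv).2.1,
      (hfg' v hv).2.2⟩)
    (fun v hv w hw => ⟨fun hh => (hG₂B _ (hfg' w hw).1).2.2 (hh ▸ (hfg v hv).1),
      fun hh => (mem_sdiff.1 (hH₂ (hfg' w hw).2.1)).2 (hh ▸ (hfg v hv).2.1)⟩)
    hu hXR hJ hev S hAL hBI (by omega) (by omega) (by omega) (by omega) (by omega) (by omega)
    (by omega) (by omega) (by omega) (by omega)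
  refine hm V C D C2 P P' Bad G₃ _ _ s r (330 * d) h R hVC hlowA hlowB ?_ (by omega) (by omega)
    (by omega) hEC hm₀ hEd
  have : #(Badᶜ \ G₃) ≤ #(G₁ ∪ G₂) := card_le_card fun i hi => by
    simp only [hG₃, mem_sdiff, not_and, not_not] at hi
    exact hi.2 hi.1
  omega

lemma disjoint_of_card_add_eq {n : ℕ} {C1 C2 C3 C4 : Finset (Fin n)}
    (hU : C1 ∪ C2 ∪ C3 ∪ C4 = univ) (hc : C1.card + C2.card + C3.card + C4.card = n) :
    Disjoint C1 C2 ∧ Disjoint (C1 ∪ C2) C3 ∧ Disjoint (C1 ∪ C2 ∪ C3) C4 := by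
  have h1 := card_union_add_card_inter C1 C2
  have h2 := card_union_add_card_inter (C1 ∪ C2) C3
  have h3 := card_union_add_card_inter (C1 ∪ C2 ∪ C3) C4
  rw [hU, card_univ, Fintype.card_fin] at h3
  simp only [disjoint_iff_inter_eq_empty, ← card_eq_zero]
  omega

open Classical in
lemma fourPart_of_partition {n : ℕ} {D : Fin n → Fin n → Fin n → Prop}
    (hl : ∀ i v, ¬ D i v v)
    (hdeg : ∀ i v, (n + 1) / 2 ≤ outDeg (D i) v ∧ (n + 1) / 2 ≤ inDeg (D i) v)
    {C1 C2 C3 C4 : Finset (Fin n)} (hU : C1 ∪ C2 ∪ C3 ∪ C4 = univ)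
    (hc : C1.card + C2.card + C3.card + C4.card = n)
    (h34 : (n + 1) / 2 ≤ C3.card + C4.card) (h14 : (n + 1) / 2 ≤ C1.card + C4.card)
    {C' : Finset (Fin n)} (hC' : ∀ i ∈ C',
      (∀ u ∈ C2, ∀ v ∈ C2, ¬ D i u v) ∧ (∀ u ∈ C2, ∀ v ∈ C1, ¬ D i u v) ∧
      (∀ u ∈ C3, ∀ v ∈ C2, ¬ D i u v)) :
    FourPart D C2 (C1 ∪ C4) (C3 ∪ C4) C'ᶜ (C1.card + C4.card - (n + 1) / 2)
      (C3.card + C4.card - (n + 1) / 2) := by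
  obtain ⟨h1, h2, h3⟩ := disjoint_of_card_add_eq hU hc
  simp only [disjoint_union_left] at h2 h3
  have hmem : ∀ z, z ∈ C1 ∨ z ∈ C2 ∨ z ∈ C3 ∨ z ∈ C4 := fun z => by
    have : z ∈ C1 ∪ C2 ∪ C3 ∪ C4 := hU ▸ mem_univ z
    simpa only [mem_union, or_assoc] using this
  refine ⟨fun i v => ?_, fun i v => ?_, hl, ?_, ?_, ?_, ?_, ?_, ?_⟩
  · have := (hdeg i v).1
    rw [outDeg, Nat.card_eq_fintype_card, Fintype.card_subtype] at this
    simpa using this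
  · have := (hdeg i v).2
    rw [inDeg, Nat.card_eq_fintype_card, Fintype.card_subtype] at this
    simpa using this
  · rw [disjoint_union_right]
    exact ⟨h1.symm, h3.1.2⟩
  · rw [disjoint_union_right]
    exact ⟨h2.2, h3.1.2⟩
  · rw [card_union_of_disjoint h3.1.1, Fintype.card_fin]
    omega
  · rw [card_union_of_disjoint h3.2, Fintype.card_fin]
    omega
  · intro i hi u hu y hD
    obtain ⟨a, b, -⟩ := hC' i (by simpa using hi)
    rw [mem_union]
    rcases hmem y with h | h | h | h
    · exact absurd hD (b u hu y h)
    · exact absurd hD (a u hu y h)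
    · exact Or.inl h
    · exact Or.inr h
  · intro i hi u hu x hD
    obtain ⟨a, -, b⟩ := hC' i (by simpa using hi)
    rw [mem_union]
    rcases hmem x with h | h | h | h
    · exact Or.inl h
    · exact absurd hD (a x h u hu)
    · exact absurd hD (b x h u hu)
    · exact Or.inr h

/-- **Extremal-case lemma for the four-part structure.**  For `0 < 1/n ≪ δ ≪ 1` and
`0 ≤ γ < δ`: let `𝒟 = {D i : i ∈ 𝒞}` (colours `𝒞 = Fin n`) be loopless digraphs on a
vertex set of size `n` with minimum semi-degree at least `⌈n/2⌉`.  Assume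
`C¹ ∪ C² ∪ C³ ∪ C⁴` is a vertex partition with `|C²| ≥ 50δ^{1/4}n`,
`min{|C³|+|C⁴|, |C¹|+|C⁴|} ≥ ⌈n/2⌉` and `|C⁴| = ⌊(|C²|+|C⁴|+1)/2⌋ + γn`; `𝒞'` is a set
of colours with `|𝒞 \ 𝒞'| ≤ δn`; and for every `i ∈ 𝒞'` the sub-digraphs `D i[C²]`,
`D i[C², C¹]` and `D i[C³, C²]` are empty.  Then `𝒟` contains a transversal directed
Hamilton cycle. -/
theorem extremal_four_part_hamilton :
    ∃ δ0 : ℝ, 0 < δ0 ∧ ∀ δ : ℝ, 0 < δ → δ ≤ δ0 →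
    ∃ n0 : ℕ, ∀ n : ℕ, n0 ≤ n →
    ∀ γ : ℝ, 0 ≤ γ → γ < δ →
    ∀ D : Fin n → Fin n → Fin n → Prop,
    (∀ i v, ¬ D i v v) →
    (∀ i v, (n + 1) / 2 ≤ outDeg (D i) v ∧ (n + 1) / 2 ≤ inDeg (D i) v) →
    ∀ C1 C2 C3 C4 : Finset (Fin n),
    C1 ∪ C2 ∪ C3 ∪ C4 = univ →
    C1.card + C2.card + C3.card + C4.card = n →
    (50 * δ ^ ((1 : ℝ) / 4) * n ≤ (C2.card : ℝ)) →
    ((n + 1) / 2 ≤ C3.card + C4.card) →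
    ((n + 1) / 2 ≤ C1.card + C4.card) →
    ((C4.card : ℝ) = (((C2.card + C4.card + 1) / 2 : ℕ) : ℝ) + γ * n) →
    ∀ C' : Finset (Fin n), ((C'ᶜ.card : ℝ) ≤ δ * n) →
    (∀ i ∈ C',
      (∀ u ∈ C2, ∀ v ∈ C2, ¬ D i u v) ∧
      (∀ u ∈ C2, ∀ v ∈ C1, ¬ D i u v) ∧
      (∀ u ∈ C3, ∀ v ∈ C2, ¬ D i u v)) →
    ∃ σ φ : Fin n ≃ Fin n, ∀ k : Fin n, D (φ k) (σ k) (σ (finRotate n k)) := by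
  refine ⟨(10000⁻¹ : ℝ) ^ 4, by positivity, fun δ hδ hδ0 => ?_⟩
  obtain ⟨ρ, hρdef⟩ : ∃ ρ : ℝ, ρ = δ ^ ((1 : ℝ) / 4) := ⟨_, rfl⟩
  have hρ : 0 < ρ := hρdef ▸ Real.rpow_pos_of_pos hδ _
  have hρ4 : ρ ^ 4 = δ := by
    rw [hρdef, ← Real.rpow_natCast, ← Real.rpow_mul hδ.le]
    norm_num
  have hρ1 : ρ ≤ 10000⁻¹ := by
    by_contra! hcon
    have := pow_lt_pow_left₀ hcon (by positivity) (n := 4) (by norm_num)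
    linarith
  set E := ⌈ρ⁻¹⌉₊ with hE
  have hE1 : ρ⁻¹ ≤ E := Nat.le_ceil _
  have hE2 : (E : ℝ) < ρ⁻¹ + 1 := Nat.ceil_lt_add_one (by positivity)
  have hρE1 : 1 ≤ ρ * E := by
    have := mul_le_mul_of_nonneg_left hE1 hρ.le
    rwa [mul_inv_cancel₀ hρ.ne'] at this
  have hρE2 : ρ * E ≤ 2 := by
    have := mul_le_mul_of_nonneg_left hE2.le hρ.le
    rw [mul_add, mul_inv_cancel₀ hρ.ne'] at this
    linarith
  have hEpos : 1 ≤ E := Nat.ceil_pos.2 (by positivity)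
  obtain ⟨m₀, hm⟩ := FourPart.hamSys E hEpos
  refine ⟨4 * m₀ + ⌈10 ^ 13 * ρ⁻¹⌉₊, fun n hn γ hγ0 hγ D hl hdeg C1 C2 C3 C4 hU hc hC2 h34 h14 h4
    C' hC'c hC' => ?_⟩
  rw [← hρdef] at hC2
  have hn1 : (10 ^ 13 * ρ⁻¹ : ℝ) ≤ n :=
    (Nat.le_ceil _).trans (by exact_mod_cast (by omega : ⌈10 ^ 13 * ρ⁻¹⌉₊ ≤ n))
  have hn2 : (10 ^ 13 : ℝ) ≤ ρ * n := by
    have := mul_le_mul_of_nonneg_left hn1 hρ.le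
    rwa [mul_left_comm, mul_inv_cancel₀ hρ.ne', mul_one] at this
  have hn3 : (E : ℝ) * 10 ^ 12 ≤ n := by
    have : (E : ℝ) ≤ 2 * ρ⁻¹ := by
      have : (1 : ℝ) ≤ ρ⁻¹ := (one_le_inv₀ hρ).2 (by linarith)
      linarith
    nlinarith
  have hn0 : (0 : ℝ) ≤ n := Nat.cast_nonneg n
  have h := fourPart_of_partition hl hdeg hU hc h34 h14 hC'
  obtain ⟨d, hd⟩ : ∃ d, d = ⌊2 * δ * n⌋₊ + 2 := ⟨_, rfl⟩
  have hd1 : 2 * δ * n + 1 < d := by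
    rw [hd]
    push_cast
    have := Nat.lt_floor_add_one (2 * δ * n)
    linarith
  have hd2 : (d : ℝ) ≤ 2 * δ * n + 2 := by
    rw [hd]
    push_cast
    have := Nat.floor_le (show 0 ≤ 2 * δ * n by positivity)
    linarith
  have hγn : γ * n ≤ δ * n := mul_le_mul_of_nonneg_right hγ.le hn0
  have hδn : 0 ≤ δ * n := by positivity
  have hsr : C4.card ≤ C2.card + d := by
    have h5 : (((C2.card + C4.card + 1) / 2 : ℕ) : ℝ) ≤ (C2.card + C4.card + 1 : ℝ) / 2 := by
      have := Nat.cast_div_le (α := ℝ) (m := C2.card + C4.card + 1) (n := 2)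
      push_cast at this
      exact this
    have : (C4.card : ℝ) ≤ C2.card + d := by linarith
    exact_mod_cast this
  have hB : C'ᶜ.card ≤ d := by
    have : (C'ᶜ.card : ℝ) ≤ d := by linarith
    exact_mod_cast this
  have hρ3 : ρ ^ 3 ≤ (10000⁻¹ : ℝ) ^ 3 := pow_le_pow_left₀ hρ.le hρ1 3
  have hρd : (d : ℝ) ≤ 2 * ρ ^ 3 * (ρ * n) + 2 := by
    rw [← hρ4] at hd2
    linarith
  have hρn : 0 ≤ ρ * n := by positivity
  have hd3 : 10 ^ 10 * (d : ℝ) ≤ ρ * n := by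
    have := mul_le_mul_of_nonneg_right hρ3 hρn
    nlinarith
  have hEd : 10 ^ 11 * (E * d : ℝ) ≤ n := by
    have e1 : (E : ℝ) * d ≤ E * (2 * ρ ^ 3 * (ρ * n) + 2) := by gcongr
    have e2 : E * (2 * ρ ^ 3 * (ρ * n) + 2) = 2 * ρ ^ 3 * (ρ * E * n) + 2 * (E : ℝ) := by ring
    have e3 : ρ ^ 3 * (ρ * E * n) ≤ (10000⁻¹ : ℝ) ^ 3 * (2 * n) := by gcongr
    norm_num at e3
    linarith
  refine HamSys.exists_equiv (hm (Fin n) (Fin n) D C2 _ _ _ _ _ d h rfl (by omega) (by omega) hB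
    (by omega) ?_ ?_ ?_ ?_)
  · have : (1000000 * d : ℝ) ≤ C2.card := by nlinarith
    exact_mod_cast this
  · rw [Fintype.card_fin]
    have e1 : (E : ℝ) * (50 * ρ * n) ≤ E * C2.card := by gcongr
    have e2 : (n : ℝ) ≤ ρ * E * n := le_mul_of_one_le_left hn0 hρE1
    have : (n : ℝ) + E * (330 * d) ≤ E * C2.card := by nlinarith
    exact_mod_cast this
  · rw [Fintype.card_fin]
    have e1 : (4 * m₀ : ℝ) ≤ n := by
      exact_mod_cast (by omega : 4 * m₀ ≤ n)
    have e2 : ρ * n ≤ 1 * n := mul_le_mul_of_nonneg_right (by linarith) hn0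
    have : (m₀ + 330 * d : ℝ) ≤ n := by linarith
    exact_mod_cast this
  · rw [Fintype.card_fin]
    have e2 : ρ * n ≤ 1 * n := mul_le_mul_of_nonneg_right (by linarith) hn0
    have : (100000000 * E * (330 * d) + 330 * d : ℝ) ≤ n := by linarith
    exact_mod_cast this
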